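/- arXiv:2107.10380 — 5 statements merged into one kernel-verified Lean document; each statement's English description precedes it below -/
import Mathlib

section
/- Let A₀ be the 4×4 matrix with 1's on the anti-diagonal and 0's elsewhere, and for a symmetric 4×4 matrix B let f_B(x) = det(A₀x − B), a monic quartic polynomial. Let B be a symmetric 4×4 matrix with rational entries whose (1,1)- and (1,2)-entries are 0. Assume: (i) f_B is irreducible over ℚ, and (ii) there do not exist rationals u, u', v, v', d with d not a square of a rational and (u',v') ≠ (0,0) such that f_B(x) = (x² + ux + v)² − d·(u'x + v')². Let γ₀ = diag(i, i, −i, −i) ∈ GL₄(ℂ), and suppose g = h or g = γ₀h, where h is a 4×4 integer matrix with hA₀hᵀ = A₀ and det h = 1. Set B' = gBgᵀ (which has rational entries). Then: if the (1,1)- and (1,2)-entries of B' are 0, the (1,3)-entry of B' equals the (1,3)-entry of B up to sign; and if the (1,1)- and (1,3)-entries of B' are 0, the (1,2)-entry of B' equals the (1,3)-entry of B up to sign. -/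
open Polynomial Matrix

/-- The 4×4 anti-diagonal matrix of 1's. -/
def A0 (R : Type*) [Zero R] [One R] : Matrix (Fin 4) (Fin 4) R :=
  !![0, 0, 0, 1; 0, 0, 1, 0; 0, 1, 0, 0; 1, 0, 0, 0]

lemma aux_det4 {R : Type*} [CommRing R] (M : Matrix (Fin 4) (Fin 4) R) :
    M.det = (M 0 0 * M 1 1 - M 0 1 * M 1 0) * (M 2 2 * M 3 3 - M 2 3 * M 3 2)
      - (M 0 0 * M 1 2 - M 0 2 * M 1 0) * (M 2 1 * M 3 3 - M 2 3 * M 3 1)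
      + (M 0 0 * M 1 3 - M 0 3 * M 1 0) * (M 2 1 * M 3 2 - M 2 2 * M 3 1)
      + (M 0 1 * M 1 2 - M 0 2 * M 1 1) * (M 2 0 * M 3 3 - M 2 3 * M 3 0)
      - (M 0 1 * M 1 3 - M 0 3 * M 1 1) * (M 2 0 * M 3 2 - M 2 2 * M 3 0)
      + (M 0 2 * M 1 3 - M 0 3 * M 1 2) * (M 2 0 * M 3 1 - M 2 1 * M 3 0) := by
  simp [Matrix.det_succ_row_zero, Fin.sum_univ_succ, Fin.succAbove]
  ring

/-- The value of the pencil determinant for a matrix with vanishing (1,1) and (1,2) entries. -/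
lemma aux_eval (B : Matrix (Fin 4) (Fin 4) ℚ) (x : ℚ) :
    Polynomial.eval x (Matrix.det ((Polynomial.X : Polynomial ℚ) • ((A0 ℚ).map Polynomial.C)
      - B.map Polynomial.C)) = (x • A0 ℚ - B).det := by
  rw [aux_det4, aux_det4]
  simp [A0]

lemma aux_entries (h : Matrix (Fin 4) (Fin 4) ℤ) (hA : h * A0 ℤ * hᵀ = A0 ℤ) (i j : Fin 4) :
    h i 0 * h j 3 + h i 1 * h j 2 + h i 2 * h j 1 + h i 3 * h j 0 = A0 ℤ i j := by
  rw [← hA]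
  simp [A0, Matrix.mul_apply, Fin.sum_univ_four]
  ring

lemma aux_sand {R : Type*} [CommRing R] (S M T : Matrix (Fin 4) (Fin 4) R) (i j : Fin 4) :
    (S * M * Tᵀ) i j = ∑ k, ∑ l, S i k * M k l * T j l := by
  simp only [Matrix.mul_apply, Matrix.transpose_apply, Finset.sum_mul]
  exact Finset.sum_comm

lemma aux_sandA (S T : Matrix (Fin 4) (Fin 4) ℤ) (i j : Fin 4) :
    (S * A0 ℤ * Tᵀ) i j = S i 0 * T j 3 + S i 1 * T j 2 + S i 2 * T j 1 + S i 3 * T j 0 := by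
  rw [aux_sand]
  simp [A0, Fin.sum_univ_four]

/-- Jacobi complementary minors, through multiplicativity of the determinant. -/
lemma aux_jac (h : Matrix (Fin 4) (Fin 4) ℤ) (hdet : h.det = 1)
    (S T : Matrix (Fin 4) (Fin 4) ℤ) (hT : S * A0 ℤ * hᵀ = T) : S.det = T.det := by
  rw [← hT, Matrix.det_mul, Matrix.det_mul, Matrix.det_transpose, hdet]
  have : (A0 ℤ).det = 1 := by rw [aux_det4]; simp [A0]
  rw [this]; ring

lemma aux_pl1 (h : Matrix (Fin 4) (Fin 4) ℤ) (hA : h * A0 ℤ * hᵀ = A0 ℤ) (hdet : h.det = 1)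
    (p34 : h 0 2 * h 1 3 - h 0 3 * h 1 2 = 0) : h 0 2 = 0 ∧ h 0 3 = 0 ∧ h 1 2 = 0 := by
  have E := aux_entries h hA
  have key : ∀ u v : Fin 4 → ℤ, (Matrix.of ![h 0, h 1, u, v]).det =
      (Matrix.of ![![0,0,0,1], ![0,0,1,0],
        (fun j => u 0 * h j 3 + u 1 * h j 2 + u 2 * h j 1 + u 3 * h j 0),
        (fun j => v 0 * h j 3 + v 1 * h j 2 + v 2 * h j 1 + v 3 * h j 0)]).det := by
    intro u v
    apply aux_jac h hdet
    ext i j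
    have e0 := E 0 j
    have e1 := E 1 j
    rw [aux_sandA]
    fin_cases i
    · simp only [Fin.zero_eta, Matrix.of_apply, Matrix.cons_val]
      rw [e0]; fin_cases j <;> rfl
    · simp only [Fin.mk_one, Matrix.of_apply, Matrix.cons_val]
      rw [e1]; fin_cases j <;> rfl
    · rfl
    · rfl
  have k13 := key ![0,1,0,0] ![0,0,0,1]
  have k24 := key ![1,0,0,0] ![0,0,1,0]
  have k14 := key ![0,1,0,0] ![0,0,1,0]
  rw [aux_det4, aux_det4] at k13 k24 k14
  simp at k13 k24 k14
  have p13 : h 0 0 * h 1 2 - h 0 2 * h 1 0 = 0 := by linarith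
  have p24 : h 0 1 * h 1 3 - h 0 3 * h 1 1 = 0 := by linarith
  have p1423 : (h 0 0 * h 1 3 - h 0 3 * h 1 0) * (h 0 1 * h 1 2 - h 0 2 * h 1 1) = 0 := by
    linear_combination -(h 0 0 * h 1 1 - h 0 1 * h 1 0) * p34 +
      (h 0 1 * h 1 3 - h 0 3 * h 1 1) * p13
  have hd := hdet
  rw [aux_det4] at hd
  have p14 : h 0 0 * h 1 3 - h 0 3 * h 1 0 = 0 := by
    rcases mul_eq_zero.1 p1423 with h1 | h1 <;> linarith
  have p23 : h 0 1 * h 1 2 - h 0 2 * h 1 1 = 0 := by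
    rcases mul_eq_zero.1 p1423 with h1 | h1 <;> linarith
  have p12 : h 0 0 * h 1 1 - h 0 1 * h 1 0 ≠ 0 := by
    intro p12
    rw [p12, p13, p14, p23, p24, p34] at hd
    simp at hd
  refine ⟨?_, ?_, ?_⟩
  · apply (mul_eq_zero.1 (_ : (h 0 0 * h 1 1 - h 0 1 * h 1 0) * h 0 2 = 0)).resolve_left p12
    linear_combination h 0 1 * p13 - h 0 0 * p23
  · apply (mul_eq_zero.1 (_ : (h 0 0 * h 1 1 - h 0 1 * h 1 0) * h 0 3 = 0)).resolve_left p12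
    linear_combination h 0 1 * p14 - h 0 0 * p24
  · apply (mul_eq_zero.1 (_ : (h 0 0 * h 1 1 - h 0 1 * h 1 0) * h 1 2 = 0)).resolve_left p12
    linear_combination h 1 1 * p13 - h 1 0 * p23

lemma aux_pl2 (h : Matrix (Fin 4) (Fin 4) ℤ) (hA : h * A0 ℤ * hᵀ = A0 ℤ) (hdet : h.det = 1) :
    h 0 2 * h 2 3 - h 0 3 * h 2 2 = 0 ∧ h 0 0 * h 2 1 - h 0 1 * h 2 0 = 0 := by
  have E := aux_entries h hA
  have key : ∀ u v : Fin 4 → ℤ, (Matrix.of ![h 0, h 2, u, v]).det =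
      (Matrix.of ![![0,0,0,1], ![0,1,0,0],
        (fun j => u 0 * h j 3 + u 1 * h j 2 + u 2 * h j 1 + u 3 * h j 0),
        (fun j => v 0 * h j 3 + v 1 * h j 2 + v 2 * h j 1 + v 3 * h j 0)]).det := by
    intro u v
    apply aux_jac h hdet
    ext i j
    have e0 := E 0 j
    have e1 := E 2 j
    rw [aux_sandA]
    fin_cases i
    · simp only [Fin.zero_eta, Matrix.of_apply, Matrix.cons_val]
      rw [e0]; fin_cases j <;> rfl
    · simp only [Fin.mk_one, Matrix.of_apply, Matrix.cons_val]
      rw [e1]; fin_cases j <;> rfl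
    · rfl
    · rfl
  have k34 := key ![1,0,0,0] ![0,1,0,0]
  have k12 := key ![0,0,1,0] ![0,0,0,1]
  rw [aux_det4, aux_det4] at k34 k12
  simp at k34 k12
  constructor <;> linarith

lemma aux_nd2 (h : Matrix (Fin 4) (Fin 4) ℤ) (hdet : h.det = 1)
    (p12 : h 0 0 * h 2 1 - h 0 1 * h 2 0 = 0) (p13 : h 0 0 * h 2 2 - h 0 2 * h 2 0 = 0)
    (p14 : h 0 0 * h 2 3 - h 0 3 * h 2 0 = 0) (p23 : h 0 1 * h 2 2 - h 0 2 * h 2 1 = 0)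
    (p24 : h 0 1 * h 2 3 - h 0 3 * h 2 1 = 0) (p34 : h 0 2 * h 2 3 - h 0 3 * h 2 2 = 0) :
    False := by
  have hd := hdet
  rw [aux_det4] at hd
  have : (0:ℤ) = 1 := by
    rw [← hd]
    linear_combination 
      (h 1 2 * h 3 3 - h 1 3 * h 3 2) * p12
      - (h 1 1 * h 3 3 - h 1 3 * h 3 1) * p13
      + (h 1 1 * h 3 2 - h 1 2 * h 3 1) * p14
      + (h 1 0 * h 3 3 - h 1 3 * h 3 0) * p23
      - (h 1 0 * h 3 2 - h 1 2 * h 3 0) * p24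
      + (h 1 0 * h 3 1 - h 1 1 * h 3 0) * p34
  norm_num at this

section
section
variable {B : Matrix (Fin 4) (Fin 4) ℚ}

lemma aux_noroot (hirr : Irreducible
      (Matrix.det ((Polynomial.X : Polynomial ℚ) • ((A0 ℚ).map Polynomial.C) - B.map Polynomial.C)))
    (x : ℚ) (hx : (x • A0 ℚ - B).det = 0) : False := by
  have h1 := Polynomial.degree_eq_one_of_irreducible_of_root hirr (x := x) (by
    rw [Polynomial.IsRoot.def, aux_eval]; exact hx)
  have h2 := Polynomial.eq_X_add_C_of_degree_le_one h1.le
  have ev := fun y : ℚ => aux_eval B y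
  rw [h2] at ev
  simp only [aux_det4] at ev
  have e0 := ev 0
  have e1 := ev 1
  have e2 := ev 2
  have e3 := ev 3
  have e4 := ev 4
  simp [A0] at e0 e1 e2 e3 e4
  have : (24 : ℚ) = 0 := by
    linear_combination -e0 + 4 * e1 - 6 * e2 + 4 * e3 - e4
  norm_num at this

lemma aux_noprod (hirr : Irreducible
      (Matrix.det ((Polynomial.X : Polynomial ℚ) • ((A0 ℚ).map Polynomial.C) - B.map Polynomial.C)))
    (u v u' v' : ℚ) (hx : ∀ x : ℚ, (x • A0 ℚ - B).det =
      (x ^ 2 + u * x + v) * (x ^ 2 + u' * x + v')) : False := by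
  have hf : Matrix.det ((Polynomial.X : Polynomial ℚ) • ((A0 ℚ).map Polynomial.C)
      - B.map Polynomial.C) = (X ^ 2 + C u * X + C v) * (X ^ 2 + C u' * X + C v') := by
    apply Polynomial.funext
    intro x
    rw [aux_eval, hx]
    simp
  have hd : ∀ a b : ℚ, ¬ IsUnit (X ^ 2 + C a * X + C b : ℚ[X]) := by
    intro a b hu
    have h1 := Polynomial.natDegree_eq_zero_of_isUnit hu
    have h2 : (X ^ 2 + C a * X + C b : ℚ[X]).natDegree = 2 := by compute_degree!
    omega
  rcases hirr.isUnit_or_isUnit hf with h | h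
  · exact hd _ _ h
  · exact hd _ _ h

lemma aux_m (hirr : Irreducible
      (Matrix.det ((Polynomial.X : Polynomial ℚ) • ((A0 ℚ).map Polynomial.C) - B.map Polynomial.C)))
    (hs : B.IsSymm)
    (h00 : B 0 0 = 0) (h01 : B 0 1 = 0) : B 1 1 ≠ 0 := by
  intro h11
  have e := fun i j => hs.apply i j
  apply aux_noprod hirr (-(B 0 3 + B 1 2)) (B 0 3 * B 1 2 - B 0 2 * B 1 3)
    (-(B 0 3 + B 1 2)) (B 0 3 * B 1 2 - B 0 2 * B 1 3)
  intro x
  rw [aux_det4]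
  simp [A0, h00, h01, h11, e 0 1, e 0 2, e 0 3, e 1 2, e 1 3]
  ring

lemma aux_q (hirr : Irreducible
      (Matrix.det ((Polynomial.X : Polynomial ℚ) • ((A0 ℚ).map Polynomial.C) - B.map Polynomial.C)))
    (hs : B.IsSymm)
    (h00 : B 0 0 = 0) (h01 : B 0 1 = 0) : B 0 2 ≠ 0 := by
  intro h02
  have e := fun i j => hs.apply i j
  apply aux_noroot hirr (B 0 3)
  rw [aux_det4]
  simp [A0, h00, h01, h02, e 0 1, e 0 2, e 0 3]

end

/-- The bilinear form of a matrix. -/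
def auxBil (B : Matrix (Fin 4) (Fin 4) ℚ) (r s : Fin 4 → ℚ) : ℚ := r ⬝ᵥ (B *ᵥ s)

lemma auxBil_eq (B : Matrix (Fin 4) (Fin 4) ℚ) (r s : Fin 4 → ℚ) : auxBil B r s =
    ∑ i, ∑ j, r i * B i j * s j := by
  simp [auxBil, dotProduct, Matrix.mulVec, Finset.mul_sum, mul_assoc]

lemma aux_disj {B : Matrix (Fin 4) (Fin 4) ℚ} (hs : B.IsSymm)
    (h00 : B 0 0 = 0) (h01 : B 0 1 = 0) (r s : Fin 4 → ℚ)
    (arr : auxBil (A0 ℚ) r r = 0) (ars : auxBil (A0 ℚ) r s = 0) (ass : auxBil (A0 ℚ) s s = 0)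
    (brr : auxBil B r r = 0) (brs : auxBil B r s = 0) (x : ℚ) :
    (x • A0 ℚ - B).det * (r 2 * s 3 - r 3 * s 2) ^ 2 =
      ((x * r 3 - auxBil B ![1,0,0,0] r) * (x * s 2 - auxBil B ![0,1,0,0] s)
        - (x * s 3 - auxBil B ![1,0,0,0] s) * (x * r 2 - auxBil B ![0,1,0,0] r)) ^ 2
      - B 1 1 * auxBil B s s * (x * r 3 - auxBil B ![1,0,0,0] r) ^ 2 := by
  have e := fun i j => hs.apply i j
  set S : Matrix (Fin 4) (Fin 4) ℚ := Matrix.of ![![1,0,0,0], ![0,1,0,0], r, s] with hS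
  have hdS : S.det = r 2 * s 3 - r 3 * s 2 := by
    rw [aux_det4]; simp [hS]
  have h1 : (S * (x • A0 ℚ - B) * Sᵀ).det = (x • A0 ℚ - B).det * (r 2 * s 3 - r 3 * s 2) ^ 2 := by
    rw [Matrix.det_mul, Matrix.det_mul, Matrix.det_transpose, hdS]; ring
  have h2 : S * (x • A0 ℚ - B) * Sᵀ =
      !![0, 0, x * r 3 - auxBil B ![1,0,0,0] r, x * s 3 - auxBil B ![1,0,0,0] s;
         0, -B 1 1, x * r 2 - auxBil B ![0,1,0,0] r, x * s 2 - auxBil B ![0,1,0,0] s;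
         x * r 3 - auxBil B ![1,0,0,0] r, x * r 2 - auxBil B ![0,1,0,0] r, 0, 0;
         x * s 3 - auxBil B ![1,0,0,0] s, x * s 2 - auxBil B ![0,1,0,0] s, 0, - auxBil B s s] := by
    rw [auxBil_eq] at arr ars ass brr brs
    simp only [auxBil_eq]
    ext i j
    rw [aux_sand]
    fin_cases i <;> fin_cases j <;>
      simp [A0, hS, Fin.sum_univ_four, h00, h01, e 0 1, e 0 2, e 0 3, e 1 2, e 1 3, e 2 3]
        at arr ars ass brr brs ⊢ <;>
      first
        | ring1
        | linear_combination x * arr - brr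
        | linear_combination x * ars - brs
        | linear_combination x * ass
  rw [← h1, h2, aux_det4]
  simp
  ring

lemma aux_root {B : Matrix (Fin 4) (Fin 4) ℚ} (hs : B.IsSymm)
    (h00 : B 0 0 = 0) (h01 : B 0 1 = 0) (r s : Fin 4 → ℚ)
    (arr : auxBil (A0 ℚ) r r = 0) (ars : auxBil (A0 ℚ) r s = 0)
    (brr : auxBil B r r = 0) (brs : auxBil B r s = 0) (p34 : r 2 * s 3 - r 3 * s 2 = 0)
    (hr3 : r 3 ≠ 0) (hw : r 1 * s 3 - r 3 * s 1 ≠ 0) :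
    ∃ x : ℚ, (x • A0 ℚ - B).det = 0 := by
  have e := fun i j => hs.apply i j
  obtain ⟨x, hx⟩ : ∃ x : ℚ, x * r 3 = auxBil B ![1,0,0,0] r := ⟨_, div_mul_cancel₀ _ hr3⟩
  refine ⟨x, ?_⟩
  set S : Matrix (Fin 4) (Fin 4) ℚ := Matrix.of ![![1,0,0,0], r,
    ![s 3 * r 0 - r 3 * s 0, s 3 * r 1 - r 3 * s 1, 0, 0], ![0,0,1,0]] with hS
  have hdS : S.det = (r 1 * s 3 - r 3 * s 1) * r 3 := by
    rw [aux_det4]; simp [hS]; ring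
  have h1 : (S * (x • A0 ℚ - B) * Sᵀ).det =
      (x • A0 ℚ - B).det * ((r 1 * s 3 - r 3 * s 1) * r 3) ^ 2 := by
    rw [Matrix.det_mul, Matrix.det_mul, Matrix.det_transpose, hdS]; ring
  have h2 : (S * (x • A0 ℚ - B) * Sᵀ).det = 0 := by
    rw [auxBil_eq] at arr ars brr brs hx
    simp [A0, Fin.sum_univ_four, h00, h01, e 0 1, e 0 2, e 0 3, e 1 2, e 1 3, e 2 3]
        at arr ars brr brs hx
    have m00 : (S * (x • A0 ℚ - B) * Sᵀ) 0 0 = 0 := by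
      rw [aux_sand]; simp [A0, hS, Fin.sum_univ_four, h00]
    have m01 : (S * (x • A0 ℚ - B) * Sᵀ) 0 1 = 0 := by
      rw [aux_sand]; simp [A0, hS, Fin.sum_univ_four, h00, h01]
      linear_combination hx
    have m10 : (S * (x • A0 ℚ - B) * Sᵀ) 1 0 = 0 := by
      rw [aux_sand]; simp [A0, hS, Fin.sum_univ_four, h00, h01, e 0 1, e 0 2, e 0 3]
      linear_combination hx
    have m02 : (S * (x • A0 ℚ - B) * Sᵀ) 0 2 = 0 := by
      rw [aux_sand]; simp [A0, hS, Fin.sum_univ_four, h00, h01]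
    have m11 : (S * (x • A0 ℚ - B) * Sᵀ) 1 1 = 0 := by
      rw [aux_sand]
      simp [A0, hS, Fin.sum_univ_four, h00, h01, e 0 1, e 0 2, e 0 3, e 1 2, e 1 3, e 2 3]
      linear_combination x * arr - brr
    have m12 : (S * (x • A0 ℚ - B) * Sᵀ) 1 2 = 0 := by
      rw [aux_sand]
      simp [A0, hS, Fin.sum_univ_four, h00, h01, e 0 1, e 0 2, e 0 3, e 1 2, e 1 3, e 2 3]
      linear_combination s 3 * (x * arr - brr) - r 3 * (x * ars - brs)
        + (-x * r 1 + r 0 * B 0 2 + r 1 * B 1 2 + r 2 * B 2 2 + r 3 * B 2 3) * p34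
    rw [aux_det4, m00, m01, m02, m10, m11, m12]
    ring
  rw [h2] at h1
  exact (mul_eq_zero.1 h1.symm).resolve_right (pow_ne_zero _ (mul_ne_zero hw hr3))

lemma aux_castA (h : Matrix (Fin 4) (Fin 4) ℤ) (hA : h * A0 ℤ * hᵀ = A0 ℤ) (i j : Fin 4) :
    auxBil (A0 ℚ) (fun k => (h i k : ℚ)) (fun k => (h j k : ℚ)) = ((A0 ℤ i j : ℤ) : ℚ) := by
  rw [← aux_entries h hA, auxBil_eq]
  simp [A0, Fin.sum_univ_four]

/-- First part, over the rationals. -/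
lemma aux_part1 (B : Matrix (Fin 4) (Fin 4) ℚ) (hs : B.IsSymm)
    (h00 : B 0 0 = 0) (h01 : B 0 1 = 0)
    (hirr : Irreducible
      (Matrix.det ((Polynomial.X : Polynomial ℚ) • ((A0 ℚ).map Polynomial.C) - B.map Polynomial.C)))
    (hconj : ¬ ∃ u u' v v' d : ℚ, ¬ IsSquare d ∧ (u' ≠ 0 ∨ v' ≠ 0) ∧
      Matrix.det ((Polynomial.X : Polynomial ℚ) • ((A0 ℚ).map Polynomial.C) - B.map Polynomial.C) =
        (Polynomial.X ^ 2 + Polynomial.C u * Polynomial.X + Polynomial.C v) ^ 2 -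
          Polynomial.C d * (Polynomial.C u' * Polynomial.X + Polynomial.C v') ^ 2)
    (h : Matrix (Fin 4) (Fin 4) ℤ) (hA : h * A0 ℤ * hᵀ = A0 ℤ) (hdet : h.det = 1)
    (b00 : auxBil B (fun k => (h 0 k : ℚ)) (fun k => (h 0 k : ℚ)) = 0)
    (b01 : auxBil B (fun k => (h 0 k : ℚ)) (fun k => (h 1 k : ℚ)) = 0) :
    auxBil B (fun k => (h 0 k : ℚ)) (fun k => (h 2 k : ℚ)) = B 0 2 ∨
    auxBil B (fun k => (h 0 k : ℚ)) (fun k => (h 2 k : ℚ)) = - B 0 2 := by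
  by_cases p34 : h 0 2 * h 1 3 - h 0 3 * h 1 2 = 0
  · obtain ⟨h02, h03, h12⟩ := aux_pl1 h hA hdet p34
    have e := fun i j => hs.apply i j
    have hm := aux_m hirr hs h00 h01
    have hh01 : h 0 1 = 0 := by
      rw [auxBil_eq] at b00
      simp [Fin.sum_univ_four, h00, h01, e 0 1, h02, h03] at b00
      simpa [hm] using b00
    have e02 := aux_entries h hA 0 2
    have e03 := aux_entries h hA 0 3
    have e12 := aux_entries h hA 1 2
    simp [A0, h02, h03, hh01] at e02 e03 e12
    have hh00 : h 0 0 ≠ 0 := by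
      intro h0; simp [h0] at e03
    have h23 : h 2 3 = 0 := e02.resolve_left hh00
    have e01 := aux_entries h hA 0 1
    simp [A0, h02, h03, hh01, hh00] at e01
    simp [h23, h12, e01] at e12
    rw [auxBil_eq]
    have u1 : h 0 0 = 1 ∨ h 0 0 = -1 := Int.eq_one_or_neg_one_of_mul_eq_one e03
    have u2 : h 2 2 = 1 ∨ h 2 2 = -1 :=
      Int.eq_one_or_neg_one_of_mul_eq_one (by rw [mul_comm]; exact e12)
    simp [Fin.sum_univ_four, h00, h01, e 0 1, e 0 2, e 0 3, h02, h03, hh01, h23]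
    rcases u1 with u1 | u1 <;> rcases u2 with u2 | u2 <;> simp [u1, u2]
  · exfalso
    have D := aux_disj hs h00 h01 (fun k => (h 0 k : ℚ)) (fun k => (h 1 k : ℚ))
      (by rw [aux_castA h hA]; simp [A0]) (by rw [aux_castA h hA]; simp [A0])
      (by rw [aux_castA h hA]; simp [A0]) b00 b01
    have hΔ : ((h 0 2 : ℚ) * h 1 3 - h 0 3 * h 1 2) ≠ 0 := by exact_mod_cast p34
    set Δ : ℚ := (h 0 2 : ℚ) * h 1 3 - h 0 3 * h 1 2 with hΔd
    set d : ℚ := B 1 1 * auxBil B (fun k => (h 1 k : ℚ)) (fun k => (h 1 k : ℚ))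
    set α := auxBil B ![1,0,0,0] (fun k => (h 0 k : ℚ))
    set β := auxBil B ![0,1,0,0] (fun k => (h 1 k : ℚ))
    set γ := auxBil B ![1,0,0,0] (fun k => (h 1 k : ℚ))
    set δ := auxBil B ![0,1,0,0] (fun k => (h 0 k : ℚ))
    set u : ℚ := ((h 0 3 : ℚ) * β + h 1 2 * α - h 1 3 * δ - h 0 2 * γ) / Δ
    set v : ℚ := (γ * δ - α * β) / Δ
    have F : ∀ x : ℚ, (x • A0 ℚ - B).det =
        (x ^ 2 + u * x + v) ^ 2 - d * (h 0 3 / Δ * x + (- α / Δ)) ^ 2 := by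
      intro x
      have hu : u * Δ = (h 0 3 : ℚ) * β + h 1 2 * α - h 1 3 * δ - h 0 2 * γ :=
        div_mul_cancel₀ _ hΔ
      have hv : v * Δ = γ * δ - α * β := div_mul_cancel₀ _ hΔ
      apply mul_right_cancel₀ (pow_ne_zero 2 hΔ)
      have D' := D x
      refine (Eq.trans ?_ D').trans ?_
      · rfl
      have t1 : (h 0 3 / Δ * x + (- α / Δ)) * Δ = x * h 0 3 - α := by field_simp; ring
      have t2 : (x ^ 2 + u * x + v) * Δ = - ((x * h 0 3 - α) * (x * h 1 2 - β)
        - (x * h 1 3 - γ) * (x * h 0 2 - δ)) := by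
        rw [add_mul, add_mul, mul_right_comm, hu, hv, hΔd]; ring
      have t3 : ((x ^ 2 + u * x + v) ^ 2 - d * (h 0 3 / Δ * x + (- α / Δ)) ^ 2) * Δ ^ 2 =
        ((x ^ 2 + u * x + v) * Δ) ^ 2 - d * ((h 0 3 / Δ * x + (- α / Δ)) * Δ) ^ 2 := by ring
      rw [t3, t2, t1]
      ring
    by_cases hd : IsSquare d
    · obtain ⟨t, ht⟩ := hd
      apply aux_noprod hirr (u + t * (h 0 3 / Δ)) (v + t * (- α / Δ))
        (u - t * (h 0 3 / Δ)) (v - t * (- α / Δ))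
      intro x
      rw [F, ht]; ring
    · by_cases hz : (h 0 3 / Δ : ℚ) ≠ 0 ∨ (- α / Δ) ≠ 0
      · apply hconj
        refine ⟨u, h 0 3 / Δ, v, - α / Δ, d, hd, hz, ?_⟩
        apply Polynomial.funext
        intro x
        rw [aux_eval, F]
        simp
      · push Not at hz
        apply aux_noprod hirr u v u v
        intro x
        rw [F, hz.1, hz.2]; ring

/-- The hypotheses of the second part are contradictory. -/
lemma aux_part2 (B : Matrix (Fin 4) (Fin 4) ℚ) (hs : B.IsSymm)
    (h00 : B 0 0 = 0) (h01 : B 0 1 = 0)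
    (hirr : Irreducible
      (Matrix.det ((Polynomial.X : Polynomial ℚ) • ((A0 ℚ).map Polynomial.C) - B.map Polynomial.C)))
    (h : Matrix (Fin 4) (Fin 4) ℤ) (hA : h * A0 ℤ * hᵀ = A0 ℤ) (hdet : h.det = 1)
    (b00 : auxBil B (fun k => (h 0 k : ℚ)) (fun k => (h 0 k : ℚ)) = 0)
    (b02 : auxBil B (fun k => (h 0 k : ℚ)) (fun k => (h 2 k : ℚ)) = 0) : False := by
  obtain ⟨p34, p12⟩ := aux_pl2 h hA hdet
  have hm := aux_m hirr hs h00 h01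
  have hq := aux_q hirr hs h00 h01
  have e := fun i j => hs.apply i j
  have a00 := aux_entries h hA 0 0
  have a02 := aux_entries h hA 0 2
  simp [A0] at a00 a02
  by_cases h03 : h 0 3 = 0
  · rw [h03] at a00 a02 p34
    rw [auxBil_eq] at b00 b02
    by_cases h02 : h 0 2 = 0
    · have hh01 : h 0 1 = 0 := by
        simp [Fin.sum_univ_four, h00, h01, e 0 1, h02, h03] at b00
        simpa [hm] using b00
      simp [h02, hh01] at a02 p12
      have hh00 : h 0 0 ≠ 0 := by
        intro h0
        apply aux_nd2 h hdet <;> simp [h0, h02, h03, hh01]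
      have h23 := a02.resolve_left hh00
      have h21 := p12.resolve_left hh00
      simp [Fin.sum_univ_four, h00, h01, e 0 1, h02, h03, hh01, h23, h21, hq, hh00] at b02
      apply aux_nd2 h hdet <;> simp [h02, h03, hh01, h23, h21, b02]
    · have h23 : h 2 3 = 0 := by simpa [h02] using p34
      have hh01 : h 0 1 = 0 := by
        have : h 0 1 * h 0 2 = 0 := by linarith
        exact (mul_eq_zero.1 this).resolve_right h02
      have h21 : h 2 1 = 0 := by simpa [hh01, h23, h02] using a02
      have p13 : h 0 0 * h 2 2 - h 0 2 * h 2 0 ≠ 0 := by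
        intro p13
        apply aux_nd2 h hdet <;> simp [h03, hh01, h23, h21, p13]
      simp [Fin.sum_univ_four, h00, h01, e 0 1, e 0 2, h03, hh01, h23, h21] at b00 b02
      have p13' : (h 0 0 : ℚ) * h 2 2 - h 0 2 * h 2 0 ≠ 0 := by exact_mod_cast p13
      have h02' : (h 0 2 : ℚ) ≠ 0 := by exact_mod_cast h02
      have : ((h 0 0 : ℚ) * h 2 2 - h 0 2 * h 2 0) * (h 0 2 * B 0 2) = 0 := by
        linear_combination (h 2 2 : ℚ) * b00 - h 0 2 * b02
      simp [p13', h02', hq] at this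
  · have hw : h 0 1 * h 2 3 - h 0 3 * h 2 1 ≠ 0 := by
      intro p24
      have p14 : h 0 0 * h 2 3 - h 0 3 * h 2 0 = 0 := by
        have : (h 0 0 * h 2 3 - h 0 3 * h 2 0) * h 0 3 = 0 := by
          linear_combination h 2 3 * a00 * 1 - h 0 3 * a02 - h 0 1 * p34 - h 0 2 * p24
        exact (mul_eq_zero.1 this).resolve_right h03
      apply aux_nd2 h hdet p12 _ p14 _ p24 p34
      · apply (mul_eq_zero.1 (_ : _ * h 0 3 = 0)).resolve_right h03
        linear_combination h 0 2 * p14 - h 0 0 * p34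
      · apply (mul_eq_zero.1 (_ : _ * h 0 3 = 0)).resolve_right h03
        linear_combination h 0 2 * p24 - h 0 1 * p34
    obtain ⟨x, hx⟩ := aux_root hs h00 h01 (fun k => (h 0 k : ℚ)) (fun k => (h 2 k : ℚ))
      (by rw [aux_castA h hA]; simp [A0]) (by rw [aux_castA h hA]; simp [A0]) b00 b02
      (by exact_mod_cast p34) (by exact_mod_cast h03) (by exact_mod_cast hw)
    exact aux_noroot hirr x hx

lemma aux_conn (B : Matrix (Fin 4) (Fin 4) ℚ) (h : Matrix (Fin 4) (Fin 4) ℤ) (i j : Fin 4) :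
    (h.map (Int.cast : ℤ → ℂ) * B.map (Rat.cast : ℚ → ℂ) * (h.map (Int.cast : ℤ → ℂ))ᵀ) i j =
    ((auxBil B (fun k => (h i k : ℚ)) (fun k => (h j k : ℚ)) : ℚ) : ℂ) := by
  rw [aux_sand, auxBil_eq]
  simp

/-- **Proposition 2.1 (Q-invariant)**. Let B ∈ W₀₀(ℚ) be symmetric with (1,1)- and
(1,2)-entries zero, whose invariant polynomial f_B = det(A₀x - B) is irreducible over ℚ
and does not factor as a product of quadratics conjugate over a quadratic extension.
If B' = gBgᵀ with g = h or γ₀h, h ∈ SO(A₀)(ℤ), then: if B' ∈ W₀₀ its (1,3)-entry equals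
that of B up to sign, and if B' ∈ W₀₁ its (1,2)-entry equals the (1,3)-entry of B up to sign. -/
theorem stmt_5 (B : Matrix (Fin 4) (Fin 4) ℚ) (hBsymm : B.IsSymm)
    (hB11 : B 0 0 = 0) (hB12 : B 0 1 = 0)
    (hirr : Irreducible
      (Matrix.det ((Polynomial.X : Polynomial ℚ) • ((A0 ℚ).map Polynomial.C) - B.map Polynomial.C)))
    (hconj : ¬ ∃ u u' v v' d : ℚ, ¬ IsSquare d ∧ (u' ≠ 0 ∨ v' ≠ 0) ∧
      Matrix.det ((Polynomial.X : Polynomial ℚ) • ((A0 ℚ).map Polynomial.C) - B.map Polynomial.C) =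
        (Polynomial.X ^ 2 + Polynomial.C u * Polynomial.X + Polynomial.C v) ^ 2 -
          Polynomial.C d * (Polynomial.C u' * Polynomial.X + Polynomial.C v') ^ 2)
    (h : Matrix (Fin 4) (Fin 4) ℤ) (hA : h * A0 ℤ * hᵀ = A0 ℤ) (hdet : h.det = 1)
    (g : Matrix (Fin 4) (Fin 4) ℂ)
    (hg : g = h.map (Int.cast : ℤ → ℂ) ∨
      g = Matrix.diagonal ![Complex.I, Complex.I, -Complex.I, -Complex.I] *
            h.map (Int.cast : ℤ → ℂ))
    (B' : Matrix (Fin 4) (Fin 4) ℂ)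
    (hB' : B' = g * B.map (Rat.cast : ℚ → ℂ) * gᵀ) :
    ((B' 0 0 = 0 ∧ B' 0 1 = 0) →
        (B' 0 2 = (B 0 2 : ℂ) ∨ B' 0 2 = -(B 0 2 : ℂ))) ∧
    ((B' 0 0 = 0 ∧ B' 0 2 = 0) →
        (B' 0 1 = (B 0 2 : ℂ) ∨ B' 0 1 = -(B 0 2 : ℂ))) := by
  have key : (B' 0 0 = 0 → auxBil B (fun k => (h 0 k : ℚ)) (fun k => (h 0 k : ℚ)) = 0) ∧
      (B' 0 1 = 0 → auxBil B (fun k => (h 0 k : ℚ)) (fun k => (h 1 k : ℚ)) = 0) ∧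
      B' 0 2 = ((auxBil B (fun k => (h 0 k : ℚ)) (fun k => (h 2 k : ℚ)) : ℚ) : ℂ) := by
    rcases hg with rfl | rfl
    · subst hB'
      simp only [aux_conn]
      exact ⟨fun H => by exact_mod_cast H, fun H => by exact_mod_cast H, trivial⟩
    · have hB2 : B' = Matrix.diagonal ![Complex.I, Complex.I, -Complex.I, -Complex.I] *
          (h.map (Int.cast : ℤ → ℂ) * B.map (Rat.cast : ℚ → ℂ) * (h.map (Int.cast : ℤ → ℂ))ᵀ) *
          Matrix.diagonal ![Complex.I, Complex.I, -Complex.I, -Complex.I] := by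
        rw [hB', Matrix.transpose_mul, Matrix.diagonal_transpose]
        simp only [Matrix.mul_assoc]
      have E : ∀ i j, B' i j = ![Complex.I, Complex.I, -Complex.I, -Complex.I] i *
          ((auxBil B (fun k => (h i k : ℚ)) (fun k => (h j k : ℚ)) : ℚ) : ℂ) *
          ![Complex.I, Complex.I, -Complex.I, -Complex.I] j := by
        intro i j
        rw [hB2, Matrix.mul_diagonal, Matrix.diagonal_mul, aux_conn]
      refine ⟨fun H => ?_, fun H => ?_, ?_⟩
      · rw [E] at H
        simpa using H
      · rw [E] at H
        simpa using H
      · rw [E]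
        simp only [Matrix.cons_val]
        linear_combination -((auxBil B (fun k => (h 0 k : ℚ)) (fun k => (h 2 k : ℚ)) : ℚ) : ℂ) *
          Complex.I_mul_I
  obtain ⟨k0, k1, k2⟩ := key
  constructor
  · rintro ⟨H0, H1⟩
    rw [k2]
    rcases aux_part1 B hBsymm hB11 hB12 hirr hconj h hA hdet (k0 H0) (k1 H1) with H | H
    · left; rw [H]
    · right; rw [H]; push_cast; rfl
  · rintro ⟨H0, H2⟩
    exfalso
    rw [k2] at H2
    exact aux_part2 B hBsymm hB11 hB12 hirr h hA hdet (k0 H0) (by exact_mod_cast H2)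
end
end

section
/- There is an absolute constant C such that for all X ≥ 2, the number of pairs (a,b) ∈ ℤ² with |a| < X³, |b| < X⁴, 256b³ − 27a⁴ ≠ 0, and such that the polynomial f(x) = x⁴ + ax + b either (i) is reducible over ℚ, or (ii) can be written as f(x) = (x² + ux + v)² − d·(u'x + v')² for some rationals u, u', v, v', d with d not a square of a rational and (u',v') ≠ (0,0), is at most C·X⁴·log X. -/
open Polynomial in
lemma aux_int_root3 (a b : ℤ) (D : ℚ) (h : D ^ 3 - 4 * b * D - (a:ℚ) ^ 2 = 0) :
    ∃ E : ℤ, E ^ 3 - 4 * b * E - a ^ 2 = 0 ∧ (E : ℚ) = D := by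
  have hi : IsIntegral ℤ D := by
    refine ⟨X ^ 3 - (C (4 * b) * X + C (a ^ 2)), ?_, ?_⟩
    · apply monic_X_pow_sub
      compute_degree
      norm_num
    · simp only [eval₂_sub, eval₂_add, eval₂_mul, eval₂_C, eval₂_X, eval₂_X_pow]
      push_cast [eq_intCast, algebraMap_int_eq]
      linarith
  obtain ⟨E, hE⟩ := IsIntegrallyClosed.isIntegral_iff.1 hi
  have hE' : (E : ℚ) = D := by simpa using hE
  refine ⟨E, ?_, hE'⟩
  rw [← hE'] at h
  exact_mod_cast h

open Polynomial in
lemma aux_int_root4 (a b : ℤ) (D : ℚ) (h : D ^ 4 + a * D + (b:ℚ) = 0) :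
    ∃ E : ℤ, E ^ 4 + a * E + b = 0 := by
  have hi : IsIntegral ℤ D := by
    refine ⟨X ^ 4 + (C a * X + C b), ?_, ?_⟩
    · apply monic_X_pow_add
      compute_degree
      norm_num
    · simp only [eval₂_add, eval₂_mul, eval₂_C, eval₂_X, eval₂_X_pow]
      push_cast [eq_intCast, algebraMap_int_eq]
      linarith
  obtain ⟨E, hE⟩ := IsIntegrallyClosed.isIntegral_iff.1 hi
  have hE' : (E : ℚ) = D := by simpa using hE
  refine ⟨E, ?_⟩
  rw [← hE'] at h
  exact_mod_cast h

open Polynomial in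
lemma aux_deg (a b : ℚ) : ((X : ℚ[X]) ^ 4 + C a * X + C b).natDegree = 4 := by
  compute_degree!

open Polynomial in
lemma aux_monic (a b : ℚ) : ((X : ℚ[X]) ^ 4 + C a * X + C b).Monic := by
  monicity!

open Polynomial in
lemma aux_red (a b : ℚ) (h : ¬ Irreducible ((X : ℚ[X]) ^ 4 + C a * X + C b)) :
    (∃ r : ℚ, r ^ 4 + a * r + b = 0) ∨ ∃ D : ℚ, D ^ 3 - 4 * b * D - a ^ 2 = 0 ∧ (D = 0 → a = 0) := by
  rw [(aux_monic a b).irreducible_iff_natDegree'] at h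
  have h1 : (X : ℚ[X]) ^ 4 + C a * X + C b ≠ 1 := by
    intro h1
    have := aux_deg a b
    rw [h1] at this
    simp at this
  simp only [ne_eq, h1, not_false_eq_true, true_and, aux_deg] at h
  push Not at h
  obtain ⟨f, g, hf, hg, hfg, hd⟩ := h
  have hdeg : f.natDegree + g.natDegree = 4 := by
    rw [← hf.natDegree_mul hg, hfg, aux_deg]
  simp only [Finset.mem_Ioc] at hd
  have hcase : g.natDegree = 1 ∨ g.natDegree = 2 := by omega
  rcases hcase with hc | hc
  · left
    refine ⟨-g.coeff 0, ?_⟩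
    have hgX : g = X + C (g.coeff 0) := by
      have := g.as_sum_range_C_mul_X_pow
      have hl : g.coeff 1 = 1 := by rw [← hc]; exact hg
      rw [hc] at this
      simp [Finset.sum_range_succ, hl] at this
      rw [add_comm]; exact this
    have he := congrArg (eval (-g.coeff 0)) hfg
    have h0 : eval (-g.coeff 0) g = 0 := by
      conv_lhs => arg 2; rw [hgX]
      simp
    rw [eval_mul, h0] at he
    simp at he
    linarith
  · right
    have hcf : f.natDegree = 2 := by omega
    have key : ∀ q : ℚ[X], q.Monic → q.natDegree = 2 → q = C (q.coeff 0) + C (q.coeff 1) * X + X ^ 2 := by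
      intro q hq hq2
      have := q.as_sum_range_C_mul_X_pow
      have hl : q.coeff 2 = 1 := by rw [← hq2]; exact hq
      rw [hq2] at this
      simp [Finset.sum_range_succ, hl] at this
      exact this
    have kf := key f hf hcf
    have kg := key g hg hc
    generalize f.coeff 0 = v at kf
    generalize f.coeff 1 = u at kf
    generalize g.coeff 0 = w at kg
    generalize g.coeff 1 = t at kg
    rw [kf, kg] at hfg
    have e0 := congrArg (eval 0) hfg
    have e1 := congrArg (eval 1) hfg
    have e2 := congrArg (eval (-1)) hfg
    have e3 := congrArg (eval 2) hfg
    simp at e0 e1 e2 e3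
    have ht : t = -u := by linarith
    subst ht
    have hw : w = u ^ 2 - v := by linarith
    subst hw
    have ha : a = u * (u ^ 2 - 2 * v) := by linarith
    refine ⟨u ^ 2, ?_, ?_⟩
    · rw [ha, ← e0]; ring
    · intro h0
      have : u = 0 := by simpa using h0
      rw [ha, this]; ring

open Polynomial in
lemma aux_conj (a b u u' v v' d : ℚ) (h : (X : ℚ[X]) ^ 4 + C a * X + C b =
    (X ^ 2 + C u * X + C v) ^ 2 - C d * (C u' * X + C v') ^ 2) :
    ∃ D : ℚ, D ^ 3 - 4 * b * D - a ^ 2 = 0 ∧ (D = 0 → a = 0) := by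
  have e0 := congrArg (eval 0) h
  have e1 := congrArg (eval 1) h
  have e2 := congrArg (eval (-1)) h
  have e3 := congrArg (eval 2) h
  have e4 := congrArg (eval (-2)) h
  simp at e0 e1 e2 e3 e4
  have hu : u = 0 := by linarith
  subst hu
  have hv : 2 * v = d * u' ^ 2 := by linarith
  have ha : a = - 2 * d * u' * v' := by linarith
  have hv' : v = d * u' ^ 2 / 2 := by linarith
  subst hv'
  refine ⟨d * u' ^ 2, ?_, ?_⟩
  · rw [ha, e0]; ring
  · intro h0
    have : d = 0 ∨ u' = 0 := by simpa using h0
    rcases this with h | h <;> rw [ha, h] <;> ring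

/-- factorization of the parameters in the cubic resolvent case -/
lemma aux_param (N : ℕ) (hN : 1 ≤ N) (a b E : ℤ) (ha0 : a ≠ 0) (ha : |a| ≤ (N:ℤ) ^ 3) (hb : |b| ≤ (N:ℤ) ^ 4)
    (h : E ^ 3 - 4 * b * E - a ^ 2 = 0) :
    ∃ (e : ℤ) (m s : ℕ) (k : ℤ), (e = 1 ∨ e = -1) ∧ 1 ≤ m ∧ m ≤ 2 * N ∧ 1 ≤ s ∧ s ≤ N ^ 3 ∧
      |k| ≤ ((N ^ 3 / s : ℕ) : ℤ) ∧ a = s * m * k ∧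
      b = ((e * s * m ^ 2) ^ 2 - a ^ 2 / (e * s * m ^ 2)) / 4 := by
  have hE0 : E ≠ 0 := by
    rintro rfl
    apply ha0
    have : a ^ 2 = 0 := by linarith
    simpa using this
  have hN' : (1:ℤ) ≤ N := by exact_mod_cast hN
  have hdvd : E ∣ a ^ 2 := ⟨E ^ 2 - 4 * b, by linarith⟩
  have hbval : b = (E ^ 2 - a ^ 2 / E) / 4 := by
    have h1 : a ^ 2 = E * (E ^ 2 - 4 * b) := by linarith
    rw [h1, Int.mul_ediv_cancel_left _ hE0]
    omega
  have hEb : |E| ≤ 3 * (N:ℤ) ^ 2 := by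
    by_contra hc
    push Not at hc
    set y := |E| with hy
    have h1 : y ^ 3 ≤ 4 * |b| * y + |a| ^ 2 := by
      have : E ^ 3 = 4 * b * E + a ^ 2 := by linarith
      calc y ^ 3 = |E ^ 3| := by rw [abs_pow]
        _ = |4 * b * E + a ^ 2| := by rw [this]
        _ ≤ |4 * b * E| + |a ^ 2| := abs_add_le _ _
        _ = _ := by simp [abs_mul, abs_pow, hy]
    have h2 : |a| ^ 2 ≤ ((N:ℤ) ^ 3) ^ 2 := by gcongr
    have hy0 : 0 < y := abs_pos.2 hE0
    have h3 : |b| * y ≤ (N:ℤ) ^ 4 * y := by gcongr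
    set M := (N:ℤ) ^ 2 with hM
    have hM1 : 1 ≤ M := one_le_pow₀ hN'
    have h4 : (N:ℤ) ^ 4 = M ^ 2 := by rw [hM]; ring
    have h5 : ((N:ℤ) ^ 3) ^ 2 = M ^ 3 := by rw [hM]; ring
    rw [h4] at h3
    rw [h5] at h2
    have h6 : y ^ 3 ≤ 4 * M ^ 2 * y + M ^ 3 := by nlinarith
    have h7 : (3 * M) ^ 2 ≤ y ^ 2 := by gcongr
    have h8 : 9 * M ^ 2 * y ≤ y ^ 3 := by nlinarith
    have h9 : M ^ 2 * (3 * M) ≤ M ^ 2 * y := by gcongr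
    have : 0 < M ^ 3 := by positivity
    nlinarith
  obtain ⟨s, m, hsm, hsq⟩ := Nat.sq_mul_squarefree E.natAbs
  have hEn : E.natAbs ≠ 0 := by simpa using hE0
  have hm1 : 1 ≤ m := by
    rcases Nat.eq_zero_or_pos m with h | h
    · subst h; simp at hsm; omega
    · exact h
  have hs1 : 1 ≤ s := by
    rcases Nat.eq_zero_or_pos s with h | h
    · subst h; simp at hsm; omega
    · exact h
  have hdn : m ^ 2 * s ∣ a.natAbs ^ 2 := by
    rw [hsm, ← Int.natAbs_pow]
    exact Int.natAbs_dvd_natAbs.2 hdvd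
  have hma : m ∣ a.natAbs := (Nat.pow_dvd_pow_iff two_ne_zero).1 (dvd_of_mul_right_dvd hdn)
  obtain ⟨y, hy⟩ := hma
  have hsy : s ∣ y := by
    rw [hy, mul_pow] at hdn
    have := Nat.dvd_of_mul_dvd_mul_left (by positivity) hdn
    exact (hsq.dvd_pow_iff_dvd two_ne_zero).1 this
  obtain ⟨j, hj⟩ := hsy
  have hdv : ((s:ℤ) * m) ∣ a := by
    rw [← Int.dvd_natAbs, hy, hj]
    exact ⟨j, by push_cast; ring⟩
  obtain ⟨k, hk⟩ := hdv
  have haN : a.natAbs ≤ N ^ 3 := by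
    zify; exact ha
  have hkn : s * m * k.natAbs = a.natAbs := by
    rw [hk]; simp [Int.natAbs_mul]
  have hk0 : 1 ≤ k.natAbs := by
    rcases Nat.eq_zero_or_pos k.natAbs with h | h
    · rw [h] at hkn; simp at hkn; omega
    · exact h
  have hEE : ∃ e : ℤ, (e = 1 ∨ e = -1) ∧ E = e * s * m ^ 2 := by
    have h1 : ((E.natAbs : ℕ) : ℤ) = m ^ 2 * s := by rw [← hsm]; push_cast; ring
    rcases Int.natAbs_eq E with h | h
    · exact ⟨1, Or.inl rfl, by rw [h, h1]; ring⟩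
    · exact ⟨-1, Or.inr rfl, by rw [h, h1]; ring⟩
  obtain ⟨e, he, hEe⟩ := hEE
  refine ⟨e, m, s, k, he, hm1, ?_, hs1, ?_, ?_, hk, ?_⟩
  · have h1 : E.natAbs ≤ 3 * N ^ 2 := by zify; exact hEb
    rw [← hsm] at h1
    by_contra hc
    push Not at hc
    have : (2 * N) ^ 2 < m ^ 2 := by gcongr
    nlinarith
  · calc s = s * 1 * 1 := by ring
      _ ≤ s * m * k.natAbs := by gcongr
      _ ≤ N ^ 3 := by rw [hkn]; exact haN
  · rw [Int.abs_eq_natAbs]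
    norm_cast
    rw [Nat.le_div_iff_mul_le (by omega)]
    calc k.natAbs * s = s * 1 * k.natAbs := by ring
      _ ≤ s * m * k.natAbs := by gcongr
      _ ≤ N ^ 3 := by rw [hkn]; exact haN
  · rw [← hEe]; exact hbval

lemma aux_rootbound (N : ℕ) (hN : 1 ≤ N) (a b r : ℤ) (ha : |a| ≤ (N:ℤ) ^ 3) (hb : |b| ≤ (N:ℤ) ^ 4)
    (h : r ^ 4 + a * r + b = 0) : |r| ≤ 2 * (N:ℤ) := by
  by_contra hc
  push Not at hc
  have hN' : (1:ℤ) ≤ N := by exact_mod_cast hN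
  set M := (N:ℤ)
  set y := |r| with hy
  have h1 : y ^ 4 ≤ |a| * y + |b| := by
    have : r ^ 4 = -(a * r + b) := by linarith
    calc y ^ 4 = |r ^ 4| := by rw [abs_pow]
      _ = |a * r + b| := by rw [this, abs_neg]
      _ ≤ |a * r| + |b| := abs_add_le _ _
      _ = _ := by simp [abs_mul, hy]
  have hy0 : 0 < y := by linarith
  have h2 : |a| * y ≤ M ^ 3 * y := by gcongr
  have h3 : (2 * M) ^ 3 ≤ y ^ 3 := by gcongr
  have h4 : (2 * M) ^ 3 * y ≤ y ^ 3 * y := by gcongr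
  have h5 : M ^ 3 * (2 * M) ≤ M ^ 3 * y := by gcongr
  have h6 : 0 < M ^ 4 := by positivity
  nlinarith

/-- The finite set of parameters of the resolvent case. -/
noncomputable def auxT (N : ℕ) : Finset ((ℤ × ℕ) × (Σ _ : ℕ, ℤ)) :=
  (({1, -1} : Finset ℤ) ×ˢ Finset.Icc 1 (2 * N)) ×ˢ
    (Finset.Icc 1 (N ^ 3)).sigma
      (fun s => Finset.Icc (-((N ^ 3 / s : ℕ) : ℤ)) ((N ^ 3 / s : ℕ) : ℤ))

lemma auxT_card (N : ℕ) (hN : 1 ≤ N) :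
    ((auxT N).card : ℝ) ≤ 12 * (N:ℝ) ^ 4 * (1 + 3 * Real.log N) := by
  have h1 : ((auxT N).card : ℝ) = (4 * N) *
      ∑ s ∈ Finset.Icc 1 (N ^ 3), (2 * ((N ^ 3 / s : ℕ) : ℝ) + 1) := by
    unfold auxT
    rw [Finset.card_product, Finset.card_product, Finset.card_sigma]
    have : ({1, -1} : Finset ℤ).card = 2 := by decide
    rw [this]
    have h2 : ∀ s : ℕ, (Finset.Icc (-((N ^ 3 / s : ℕ) : ℤ)) ((N ^ 3 / s : ℕ) : ℤ)).card
        = 2 * (N ^ 3 / s) + 1 := by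
      intro s
      rw [Int.card_Icc]
      omega
    simp only [h2, Nat.card_Icc]
    push_cast
    simp
    left; ring
  have h3 : ∑ s ∈ Finset.Icc 1 (N ^ 3), (2 * ((N ^ 3 / s : ℕ) : ℝ) + 1) ≤
      ∑ s ∈ Finset.Icc 1 (N ^ 3), 3 * (N:ℝ) ^ 3 * ((s:ℝ)⁻¹) := by
    apply Finset.sum_le_sum
    intro s hs
    rw [Finset.mem_Icc] at hs
    have hs0 : (0:ℝ) < s := by exact_mod_cast hs.1
    have h4 : ((N ^ 3 / s : ℕ) : ℝ) ≤ (N:ℝ) ^ 3 * (s:ℝ)⁻¹ := by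
      have := @Nat.cast_div_le ℝ _ _ _ (N ^ 3) s
      push_cast at this ⊢
      rwa [div_eq_mul_inv] at this
    have h5 : (1:ℝ) ≤ (N:ℝ) ^ 3 * (s:ℝ)⁻¹ := by
      rw [← div_eq_mul_inv, le_div_iff₀ hs0, one_mul]
      exact_mod_cast hs.2
    linarith
  have h6 : ∑ s ∈ Finset.Icc 1 (N ^ 3), ((s:ℝ)⁻¹) ≤ 1 + 3 * Real.log N := by
    have := harmonic_le_one_add_log (N ^ 3)
    rw [harmonic_eq_sum_Icc] at this
    push_cast at this
    rwa [Real.log_pow] at this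
  rw [← Finset.mul_sum] at h3
  rw [h1]
  calc (4 * (N:ℝ)) * _ ≤ (4 * N) * (3 * (N:ℝ) ^ 3 * (1 + 3 * Real.log N)) := by
        gcongr
        exact h3.trans (by gcongr)
    _ = _ := by ring

/-- The finite set covering everything. -/
noncomputable def auxS (N : ℕ) : Finset (ℤ × ℤ) :=
  ((Finset.Icc (-(N:ℤ) ^ 4) ((N:ℤ) ^ 4)).image (fun b => ((0:ℤ), b)) ∪
    (Finset.Icc (-(N:ℤ) ^ 3) ((N:ℤ) ^ 3) ×ˢ Finset.Icc (-(2 * (N:ℤ))) (2 * (N:ℤ))).image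
      (fun q => (q.1, -(q.2 ^ 4 + q.1 * q.2)))) ∪
  (auxT N).image (fun q =>
      ((q.2.1 : ℤ) * (q.1.2 : ℤ) * q.2.2,
        ((q.1.1 * (q.2.1 : ℤ) * (q.1.2 : ℤ) ^ 2) ^ 2 -
          ((q.2.1 : ℤ) * (q.1.2 : ℤ) * q.2.2) ^ 2 / (q.1.1 * (q.2.1 : ℤ) * (q.1.2 : ℤ) ^ 2)) / 4))

lemma auxS_card (N : ℕ) (hN : 1 ≤ N) :
    ((auxS N).card : ℝ) ≤ 30 * (N:ℝ) ^ 4 + 36 * (N:ℝ) ^ 4 * Real.log N := by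
  have h1 : ((auxS N).card : ℝ) ≤ ((2 * N ^ 4 + 1 : ℕ) : ℝ) +
      (((2 * N ^ 3 + 1) * (4 * N + 1) : ℕ) : ℝ) + ((auxT N).card : ℝ) := by
    norm_cast
    unfold auxS
    refine (Finset.card_union_le _ _).trans ?_
    refine add_le_add ((Finset.card_union_le _ _).trans (add_le_add ?_ ?_)) Finset.card_image_le
    · refine Finset.card_image_le.trans ?_
      rw [Int.card_Icc]
      have : (N:ℤ) ^ 4 = ((N ^ 4 : ℕ) : ℤ) := by push_cast; rfl
      rw [this]
      omega
    · refine Finset.card_image_le.trans ?_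
      rw [Finset.card_product, Int.card_Icc, Int.card_Icc]
      have : (N:ℤ) ^ 3 = ((N ^ 3 : ℕ) : ℤ) := by push_cast; rfl
      rw [this]
      apply Nat.mul_le_mul <;> omega
  have h2 := auxT_card N hN
  have h3 : (1:ℝ) ≤ N := by exact_mod_cast hN
  have h4 : (1:ℝ) ≤ (N:ℝ) ^ 4 := one_le_pow₀ h3
  have h5 : (1:ℝ) ≤ (N:ℝ) ^ 3 := one_le_pow₀ h3
  have h6 : ((2 * (N:ℝ) ^ 3 + 1) * (4 * N + 1)) ≤ (3 * (N:ℝ) ^ 3) * (5 * N) := by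
    gcongr <;> linarith
  push_cast at h1
  nlinarith

lemma aux_mem (N : ℕ) (hN : 1 ≤ N) (a b : ℤ) (ha : |a| ≤ (N:ℤ) ^ 3) (hb : |b| ≤ (N:ℤ) ^ 4)
    (h : (∃ r : ℚ, r ^ 4 + a * r + (b:ℚ) = 0) ∨
      ∃ D : ℚ, D ^ 3 - 4 * b * D - (a:ℚ) ^ 2 = 0 ∧ (D = 0 → (a:ℚ) = 0)) :
    (a, b) ∈ auxS N := by
  unfold auxS
  rw [Finset.mem_union, Finset.mem_union]
  by_cases ha0 : a = 0
  · left; left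
    subst ha0
    rw [Finset.mem_image]
    exact ⟨b, Finset.mem_Icc.2 (abs_le.1 hb), rfl⟩
  rcases h with ⟨r, hr⟩ | ⟨D, hD, -⟩
  · left; right
    obtain ⟨E, hE⟩ := aux_int_root4 a b r hr
    have := aux_rootbound N hN a b E ha hb hE
    rw [Finset.mem_image]
    refine ⟨(a, E), ?_, ?_⟩
    · rw [Finset.mem_product]
      exact ⟨Finset.mem_Icc.2 (abs_le.1 ha), Finset.mem_Icc.2 (abs_le.1 this)⟩
    · ext
      · rfl
      · simp only; linarith
  · right
    obtain ⟨E, hE, -⟩ := aux_int_root3 a b D hD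
    obtain ⟨e, m, s, k, he, hm1, hm2, hs1, hs2, hk, hak, hbk⟩ := aux_param N hN a b E ha0 ha hb hE
    rw [Finset.mem_image]
    refine ⟨((e, m), ⟨s, k⟩), ?_, ?_⟩
    · unfold auxT
      simp only [Finset.mem_product, Finset.mem_sigma, Finset.mem_Icc, Finset.mem_insert,
        Finset.mem_singleton]
      exact ⟨⟨he, hm1, hm2⟩, ⟨hs1, hs2⟩, abs_le.1 hk⟩
    · ext
      · exact hak.symm
      · simp only
        rw [← hak]; exact hbk.symm

/-- **Proposition 2.2**: the number of pairs (a,b) with |a| < X³, |b| < X⁴,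
nonzero discriminant, such that x⁴+ax+b is reducible over ℚ or factors into a
product of conjugate quadratics over a quadratic extension, is O(X⁴ log X). -/
theorem stmt_6 :
    ∃ C : ℝ, 0 < C ∧ ∀ X : ℝ, 2 ≤ X →
      ({p : ℤ × ℤ | (|p.1| : ℝ) < X ^ 3 ∧ (|p.2| : ℝ) < X ^ 4 ∧
          256 * p.2 ^ 3 - 27 * p.1 ^ 4 ≠ 0 ∧
          (¬ Irreducible ((Polynomial.X : Polynomial ℚ) ^ 4 +
              Polynomial.C (p.1 : ℚ) * Polynomial.X + Polynomial.C (p.2 : ℚ)) ∨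
            ∃ u u' v v' d : ℚ, ¬ IsSquare d ∧ (u' ≠ 0 ∨ v' ≠ 0) ∧
              (Polynomial.X : Polynomial ℚ) ^ 4 +
                  Polynomial.C (p.1 : ℚ) * Polynomial.X + Polynomial.C (p.2 : ℚ) =
                ((Polynomial.X : Polynomial ℚ) ^ 2 + Polynomial.C u * Polynomial.X +
                    Polynomial.C v) ^ 2 -
                  Polynomial.C d * (Polynomial.C u' * Polynomial.X +
                    Polynomial.C v') ^ 2)}.ncard : ℝ)
        ≤ C * X ^ 4 * Real.log X := by
  refine ⟨2112, by norm_num, ?_⟩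
  intro X hX
  set N := ⌈X⌉₊ with hNdef
  have hXN : X ≤ N := Nat.le_ceil X
  have hN2 : (N:ℝ) ≤ 2 * X := by
    have := Nat.ceil_lt_add_one (show 0 ≤ X by linarith)
    linarith
  have hN1 : 1 ≤ N := by
    have : (1:ℝ) ≤ N := by linarith
    exact_mod_cast this
  have hN1' : (1:ℝ) ≤ N := by exact_mod_cast hN1
  have hcard := auxS_card N hN1
  have hlogX : 1 / 2 ≤ Real.log X := by
    have h1 := Real.log_two_gt_d9
    have h2 := Real.log_le_log (by norm_num) hX
    linarith
  have hlogN : Real.log N ≤ 2 * Real.log X := by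
    have h1 : Real.log N ≤ Real.log (2 * X) := Real.log_le_log (by linarith) hN2
    have h2 : Real.log (2 * X) ≤ Real.log (X * X) :=
      Real.log_le_log (by linarith) (by nlinarith)
    rw [Real.log_mul (x := X) (y := X) (by linarith) (by linarith)] at h2
    linarith
  have hfin : 30 * (N:ℝ) ^ 4 + 36 * (N:ℝ) ^ 4 * Real.log N ≤ 2112 * X ^ 4 * Real.log X := by
    have h1 : (N:ℝ) ^ 4 ≤ (2 * X) ^ 4 := by gcongr
    calc 30 * (N:ℝ) ^ 4 + 36 * (N:ℝ) ^ 4 * Real.log N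
        = (N:ℝ) ^ 4 * (30 + 36 * Real.log N) := by ring
      _ ≤ (N:ℝ) ^ 4 * (132 * Real.log X) := by gcongr; linarith
      _ ≤ (2 * X) ^ 4 * (132 * Real.log X) := by gcongr
      _ = _ := by ring
  refine le_trans ?_ (hcard.trans hfin)
  rw [← Set.ncard_coe_finset]
  refine Nat.cast_le.2 ?_
  refine Set.ncard_le_ncard ?_ (Finset.finite_toSet _)
  rintro ⟨a, b⟩ ⟨ha, hb, -, h⟩
  have ha' : |a| ≤ (N:ℤ) ^ 3 := by
    have : |(a:ℝ)| ≤ (N:ℝ) ^ 3 := ha.le.trans (by gcongr)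
    exact_mod_cast this
  have hb' : |b| ≤ (N:ℤ) ^ 4 := by
    have : |(b:ℝ)| ≤ (N:ℝ) ^ 4 := hb.le.trans (by gcongr)
    exact_mod_cast this
  refine Finset.mem_coe.2 (aux_mem N hN1 a b ha' hb' ?_)
  rcases h with h | ⟨u, u', v, v', d, -, -, h⟩
  · exact aux_red _ _ h
  · exact Or.inr (aux_conj _ _ _ _ _ _ _ h)
end

section
/- Let A₀ be the 4×4 matrix with 1's on the anti-diagonal and 0's elsewhere. For a prime p and a symmetric 4×4 matrix B over 𝔽_p, let f_B(x) = det(A₀x − B), and say B is 𝔽_p-distinguished if there exist linearly independent vectors v, w ∈ 𝔽_p⁴ with vᵀA₀v = vᵀBv = wᵀA₀w = vᵀA₀w = vᵀBw = 0. For p a prime, let d_p be the number of symmetric 4×4 matrices B over 𝔽_p such that f_B(x) = x⁴ + ax + b for some a, b ∈ 𝔽_p with 256b³ − 27a⁴ ≠ 0 in 𝔽_p, and B is not 𝔽_p-distinguished. Then there is an absolute constant c such that for every prime p ≥ 7, p⁸/16 − c·p⁷ ≤ d_p ≤ (3/4)·p⁸ + c·p⁷. -/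
open Matrix

noncomputable def fpol {k : Type*} [Field k] (B : Matrix (Fin 4) (Fin 4) k) : Polynomial k :=
  Matrix.det ((Polynomial.X : Polynomial k) • ((A0 k).map Polynomial.C) - B.map Polynomial.C)

/-- symmetric matrix from ten entries -/
def smat {k : Type*} (b00 b01 b02 b03 b11 b12 b13 b22 b23 b33 : k) : Matrix (Fin 4) (Fin 4) k :=
  !![b00, b01, b02, b03; b01, b11, b12, b13; b02, b12, b22, b23; b03, b13, b23, b33]

lemma smat_symm {k : Type*} (b00 b01 b02 b03 b11 b12 b13 b22 b23 b33 : k) :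
    (smat b00 b01 b02 b03 b11 b12 b13 b22 b23 b33).IsSymm := by
  ext i j
  fin_cases i <;> fin_cases j <;> rfl

lemma eq_smat {k : Type*} (B : Matrix (Fin 4) (Fin 4) k) (h : B.IsSymm) :
    B = smat (B 0 0) (B 0 1) (B 0 2) (B 0 3) (B 1 1) (B 1 2) (B 1 3) (B 2 2) (B 2 3) (B 3 3) := by
  ext i j
  fin_cases i <;> fin_cases j <;> first | rfl | exact h.apply _ _

lemma A0_symm {k : Type*} [Field k] : (A0 k)ᵀ = A0 k := by
  ext i j
  fin_cases i <;> fin_cases j <;> rfl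

lemma A0_mul {k : Type*} [Field k] : A0 k * A0 k = 1 := by
  ext i j
  fin_cases i <;> fin_cases j <;> simp [A0, Matrix.mul_apply, Fin.sum_univ_four]

set_option maxHeartbeats 1000000 in
lemma fpol_smat {k : Type*} [Field k] (b00 b01 b02 b03 b11 b12 b13 b22 b23 b33 : k) :
    fpol (smat b00 b01 b02 b03 b11 b12 b13 b22 b23 b33) =
      Polynomial.X ^ 4 + Polynomial.C (-2 * (b03 + b12)) * Polynomial.X ^ 3
      + Polynomial.C (b03 ^ 2 + b12 ^ 2 + 4 * b03 * b12 - b00 * b33 - b11 * b22 - 2 * b01 * b23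
          - 2 * b02 * b13) * Polynomial.X ^ 2
      + Polynomial.C (-2 * b03 ^ 2 * b12 - 2 * b03 * b12 ^ 2 + 2 * b12 * b00 * b33
          + 2 * b03 * b11 * b22
          + 2 * b01 * b23 * (b03 + b12) + 2 * b02 * b13 * (b03 + b12)
          - 2 * b00 * b13 * b23 - 2 * b01 * b02 * b33 - 2 * b01 * b13 * b22
          - 2 * b02 * b11 * b23) * Polynomial.X
      + Polynomial.C (b00 * b11 * b22 * b33 - b00 * b11 * b23 * b23 - b00 * b12 * b12 * b33
          + 2 * b00 * b12 * b13 * b23 - b00 * b13 * b13 * b22 - b01 * b01 * b22 * b33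
          + b01 * b01 * b23 * b23 + 2 * b01 * b02 * b12 * b33 - 2 * b01 * b03 * b12 * b23
          - 2 * b01 * b02 * b13 * b23 + 2 * b01 * b03 * b13 * b22 - b02 * b02 * b11 * b33
          + 2 * b02 * b03 * b11 * b23 + b02 * b02 * b13 * b13 - 2 * b02 * b03 * b12 * b13
          - b03 * b03 * b11 * b22 + b03 * b03 * b12 * b12) := by
  simp only [fpol, smat, A0, Matrix.det_succ_row_zero, Fin.sum_univ_succ]
  simp [Fin.succAbove, Matrix.submatrix]
  have h2 : (Polynomial.C (2 : k)) = 2 := rfl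
  have h4 : (Polynomial.C (4 : k)) = 4 := rfl
  try simp only [h2, h4]
  ring


lemma fpol_conj {k : Type*} [Field k] (B g : Matrix (Fin 4) (Fin 4) k)
    (hg : gᵀ * A0 k * g = A0 k) : fpol (gᵀ * B * g) = fpol B := by
  have h1 : (gᵀ.map Polynomial.C) * ((A0 k).map Polynomial.C) * (g.map Polynomial.C)
      = (A0 k).map Polynomial.C := by
    rw [← Matrix.map_mul, ← Matrix.map_mul, hg]
  have hd : g.det * g.det = 1 := by
    have h := congrArg Matrix.det hg
    have h' := congrArg Matrix.det (A0_mul (k := k))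
    simp only [Matrix.det_mul, Matrix.det_transpose, Matrix.det_one] at h h'
    have h0 : (A0 k).det ≠ 0 := by
      intro h0; simp [h0] at h'
    apply mul_right_cancel₀ h0
    linear_combination h
  have h2 : (Polynomial.X : Polynomial k) • ((A0 k).map Polynomial.C) - (gᵀ * B * g).map Polynomial.C
      = (gᵀ.map Polynomial.C) * ((Polynomial.X : Polynomial k) • ((A0 k).map Polynomial.C)
        - B.map Polynomial.C) * (g.map Polynomial.C) := by
    rw [Matrix.mul_sub, Matrix.sub_mul, Matrix.mul_smul, Matrix.smul_mul, h1, Matrix.map_mul,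
      Matrix.map_mul]
  have h3 : (g.map (Polynomial.C : k →+* Polynomial k)).det = Polynomial.C g.det := by
    rw [RingHom.map_det]; rfl
  have h4 : (gᵀ.map (Polynomial.C : k →+* Polynomial k)).det = Polynomial.C g.det := by
    rw [← Matrix.det_transpose g, RingHom.map_det]; rfl
  unfold fpol
  rw [h2, Matrix.det_mul, Matrix.det_mul, h3, h4, mul_comm (Polynomial.C g.det), mul_assoc,
    ← Polynomial.C_mul, hd]
  simp

lemma fpol_eval {k : Type*} [Field k] (B : Matrix (Fin 4) (Fin 4) k) (x : k) :
    (fpol B).eval x = (x • A0 k - B).det := by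
  unfold fpol
  rw [← Polynomial.coe_evalRingHom, RingHom.map_det]
  congr 1
  ext i j
  simp
  ring

lemma A0_map {k K : Type*} [Field k] [Field K] (φ : k →+* K) : (A0 k).map φ = A0 K := by
  ext i j
  fin_cases i <;> fin_cases j <;> simp [A0]

lemma fpol_map {k K : Type*} [Field k] [Field K] (φ : k →+* K) (B : Matrix (Fin 4) (Fin 4) k) :
    fpol (B.map φ) = (fpol B).map φ := by
  unfold fpol
  rw [← Polynomial.coe_mapRingHom, RingHom.map_det, ← A0_map φ]
  congr 1
  ext1 i j
  simp

/-- simultaneous diagonalisation -/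
lemma diagK {K : Type*} [Field K] (B : Matrix (Fin 4) (Fin 4) K) (hB : B.IsSymm) (l : Fin 4 → K)
    (hl : Function.Injective l) (hdet : ∀ i, (l i • A0 K - B).det = 0) :
    ∃ (Q : Matrix (Fin 4) (Fin 4) K) (N : Fin 4 → K), IsUnit Q ∧ (∀ i, N i ≠ 0) ∧
      A0 K = Qᵀ * diagonal N * Q ∧ B = Qᵀ * diagonal (fun i => N i * l i) * Q ∧
      B * A0 K * B = Qᵀ * diagonal (fun i => N i * l i * l i) * Q := by
  have h1 : ∀ i, ∃ u : Fin 4 → K, u ≠ 0 ∧ (l i • A0 K - B) *ᵥ u = 0 := fun i =>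
    Matrix.exists_mulVec_eq_zero_iff.mpr (hdet i)
  choose u hu0 hu using h1
  have hu' : ∀ i, B *ᵥ u i = l i • (A0 K *ᵥ u i) := by
    intro i
    have := hu i
    rw [Matrix.sub_mulVec, Matrix.smul_mulVec, sub_eq_zero] at this
    exact this.symm
  have hT : ∀ i, (A0 K * B) *ᵥ u i = l i • u i := by
    intro i
    rw [← Matrix.mulVec_mulVec, hu', Matrix.mulVec_smul, Matrix.mulVec_mulVec, A0_mul,
      Matrix.one_mulVec]
  have hli : LinearIndependent K u := by
    apply Module.End.eigenvectors_linearIndependent' (Matrix.toLin' (A0 K * B)) l hl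
    intro i
    refine ⟨?_, hu0 i⟩
    rw [Module.End.mem_eigenspace_iff, Matrix.toLin'_apply, hT]
  let P : Matrix (Fin 4) (Fin 4) K := Matrix.of u
  have hP : IsUnit P := Matrix.linearIndependent_rows_iff_isUnit.mp hli
  have hPA : ∀ i j, (P * A0 K * Pᵀ) i j = u i ⬝ᵥ (A0 K *ᵥ u j) := by
    intro i j
    rw [Matrix.mul_assoc]
    simp [P, Matrix.mul_apply, dotProduct, mulVec]
  have hPB : ∀ i j, (P * B * Pᵀ) i j = l j * (u i ⬝ᵥ (A0 K *ᵥ u j)) := by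
    intro i j
    have : (P * B * Pᵀ) i j = u i ⬝ᵥ (B *ᵥ u j) := by
      rw [Matrix.mul_assoc]
      simp [P, Matrix.mul_apply, dotProduct, mulVec]
    rw [this, hu', dotProduct_smul, smul_eq_mul]
  have horth : ∀ i j, i ≠ j → u i ⬝ᵥ (A0 K *ᵥ u j) = 0 := by
    intro i j hij
    have e1 : (P * A0 K * Pᵀ)ᵀ = P * A0 K * Pᵀ := by
      simp [Matrix.transpose_mul, A0_symm, Matrix.mul_assoc]
    have e2 : (P * B * Pᵀ)ᵀ = P * B * Pᵀ := by
      simp [Matrix.transpose_mul, hB.eq, Matrix.mul_assoc]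
    have e1' := congrFun (congrFun e1 i) j
    have e2' := congrFun (congrFun e2 i) j
    rw [Matrix.transpose_apply, hPA, hPA] at e1'
    rw [Matrix.transpose_apply, hPB, hPB, e1'] at e2'
    have : (l i - l j) * (u i ⬝ᵥ (A0 K *ᵥ u j)) = 0 := by linear_combination e2'
    rcases mul_eq_zero.mp this with h | h
    · exact absurd (hl (sub_eq_zero.mp h)) hij
    · exact h
  let N : Fin 4 → K := fun i => u i ⬝ᵥ (A0 K *ᵥ u i)
  have hA : P * A0 K * Pᵀ = diagonal N := by
    ext i j
    rw [hPA]
    by_cases hij : i = j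
    · subst hij; simp [N]
    · rw [horth i j hij, Matrix.diagonal_apply_ne _ hij]
  have hBd : P * B * Pᵀ = diagonal (fun i => N i * l i) := by
    ext i j
    rw [hPB]
    by_cases hij : i = j
    · subst hij; simp [N, mul_comm]
    · rw [horth i j hij, Matrix.diagonal_apply_ne _ hij, mul_zero]
  have hA0u : IsUnit (A0 K) := ⟨⟨A0 K, A0 K, A0_mul, A0_mul⟩, rfl⟩
  have hPt : IsUnit Pᵀ := by
    rw [Matrix.isUnit_iff_isUnit_det, Matrix.det_transpose, ← Matrix.isUnit_iff_isUnit_det]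
    exact hP
  have hN : ∀ i, N i ≠ 0 := by
    have : IsUnit (diagonal N) := hA ▸ (hP.mul hA0u).mul hPt
    rw [Matrix.isUnit_iff_isUnit_det, Matrix.det_diagonal, isUnit_iff_ne_zero] at this
    intro i
    exact (Finset.prod_ne_zero_iff.mp this) i (Finset.mem_univ i)
  have i1 : P * P⁻¹ = 1 := Matrix.mul_nonsing_inv _ ((Matrix.isUnit_iff_isUnit_det _).mp hP)
  have i2 : P⁻¹ * P = 1 := Matrix.nonsing_inv_mul _ ((Matrix.isUnit_iff_isUnit_det _).mp hP)
  have j1 : Pᵀ * (P⁻¹)ᵀ = 1 := by rw [← Matrix.transpose_mul, i2, Matrix.transpose_one]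
  have key : ∀ M : Matrix (Fin 4) (Fin 4) K, M = P⁻¹ * (P * M * Pᵀ) * (P⁻¹)ᵀ := by
    intro M
    calc M = (P⁻¹ * P) * M * (Pᵀ * (P⁻¹)ᵀ) := by rw [i2, j1, Matrix.one_mul, Matrix.mul_one]
      _ = _ := by simp only [Matrix.mul_assoc]
  have hQ : A0 K = P⁻¹ * diagonal N * (P⁻¹)ᵀ := by rw [← hA]; exact key _
  have hQB : B = P⁻¹ * diagonal (fun i => N i * l i) * (P⁻¹)ᵀ := by rw [← hBd]; exact key _
  have hinv : A0 K = Pᵀ * diagonal (fun i => (N i)⁻¹) * P := by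
    have : A0 K * (Pᵀ * diagonal (fun i => (N i)⁻¹) * P) = 1 := by
      have e : (P⁻¹)ᵀ * Pᵀ = 1 := by rw [← Matrix.transpose_mul, i1, Matrix.transpose_one]
      calc A0 K * (Pᵀ * diagonal (fun i => (N i)⁻¹) * P)
          = P⁻¹ * diagonal N * ((P⁻¹)ᵀ * Pᵀ) * diagonal (fun i => (N i)⁻¹) * P := by
            conv_lhs => rw [hQ]
            simp only [Matrix.mul_assoc]
        _ = P⁻¹ * (diagonal N * diagonal (fun i => (N i)⁻¹)) * P := by
            rw [e, Matrix.mul_one]; simp only [Matrix.mul_assoc]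
        _ = 1 := by
            rw [Matrix.diagonal_mul_diagonal]
            have : (fun i => N i * (N i)⁻¹) = fun _ => 1 := by
              funext i; exact mul_inv_cancel₀ (hN i)
            rw [this, Matrix.diagonal_one, Matrix.mul_one, i2]
    calc A0 K = A0 K * (A0 K * (Pᵀ * diagonal (fun i => (N i)⁻¹) * P)) := by
          rw [this, Matrix.mul_one]
      _ = _ := by rw [← Matrix.mul_assoc, A0_mul, Matrix.one_mul]
  refine ⟨(P⁻¹)ᵀ, N, ?_, hN, ?_, ?_, ?_⟩
  · rw [Matrix.isUnit_iff_isUnit_det, Matrix.det_transpose, ← Matrix.isUnit_iff_isUnit_det]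
    exact Matrix.isUnit_nonsing_inv_iff.mpr hP
  · rw [Matrix.transpose_transpose]; exact hQ
  · rw [Matrix.transpose_transpose]; exact hQB
  · rw [Matrix.transpose_transpose]
    have e : (P⁻¹)ᵀ * Pᵀ = 1 := by rw [← Matrix.transpose_mul, i1, Matrix.transpose_one]
    calc B * A0 K * B = P⁻¹ * diagonal (fun i => N i * l i) * ((P⁻¹)ᵀ * Pᵀ) *
          diagonal (fun i => (N i)⁻¹) * (P * P⁻¹) * diagonal (fun i => N i * l i) * (P⁻¹)ᵀ := by
          conv_lhs => rw [hQB, hinv]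
          simp only [Matrix.mul_assoc]
      _ = P⁻¹ * (diagonal (fun i => N i * l i) * diagonal (fun i => (N i)⁻¹) *
            diagonal (fun i => N i * l i)) * (P⁻¹)ᵀ := by
          rw [e, i1]; simp only [Matrix.mul_assoc, Matrix.one_mul, Matrix.mul_one]
      _ = _ := by
          rw [Matrix.diagonal_mul_diagonal, Matrix.diagonal_mul_diagonal]
          congr 3
          funext i
          have := hN i
          field_simp

lemma roots4 {K : Type*} [Field K] [IsAlgClosed K] (a b : K) (hd : 256 * b ^ 3 - 27 * a ^ 4 ≠ 0) :
    ∃ l : Fin 4 → K, Function.Injective l ∧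
      (Polynomial.X ^ 4 + Polynomial.C a * Polynomial.X + Polynomial.C b : Polynomial K) =
        ∏ i, (Polynomial.X - Polynomial.C (l i)) := by
  set f : Polynomial K := Polynomial.X ^ 4 + Polynomial.C a * Polynomial.X + Polynomial.C b with hf
  have hdeg : f.natDegree = 4 := by rw [hf]; compute_degree!
  have hmon : f.Monic := by rw [hf]; monicity!
  have hsep : f.Separable := by
    rw [Polynomial.separable_def]
    have hder : f.derivative = 4 * Polynomial.X ^ 3 + Polynomial.C a := by
      rw [hf]
      have h3 : (Polynomial.C (3 : K)) = 3 := rfl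
      simp [h3]
      norm_num
    rw [hder]
    set d := 256 * b ^ 3 - 27 * a ^ 4 with hdd
    have h1 : Polynomial.C d⁻¹ * Polynomial.C d = 1 := by
      rw [← Polynomial.C_mul, inv_mul_cancel₀ hd, Polynomial.C_1]
    have h2 : Polynomial.C d = 256 * Polynomial.C b ^ 3 - 27 * Polynomial.C a ^ 4 := by
      rw [hdd]
      have e1 : (Polynomial.C (256 : K)) = 256 := rfl
      have e2 : (Polynomial.C (27 : K)) = 27 := rfl
      simp [e1, e2]
    refine ⟨Polynomial.C d⁻¹ * (16 * (9 * Polynomial.C a ^ 2 * Polynomial.X ^ 2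
      - 12 * Polynomial.C a * Polynomial.C b * Polynomial.X + 16 * Polynomial.C b ^ 2)),
      Polynomial.C d⁻¹ * (-4 * Polynomial.X * (9 * Polynomial.C a ^ 2 * Polynomial.X ^ 2
      - 12 * Polynomial.C a * Polynomial.C b * Polynomial.X + 16 * Polynomial.C b ^ 2)
      - 27 * Polynomial.C a ^ 3), ?_⟩
    rw [← h1, h2, hf]
    ring
  have hnd : f.roots.Nodup := Polynomial.nodup_roots hsep
  have hsp : f.Splits := IsAlgClosed.splits f
  have hcard : f.roots.card = 4 := by rw [← hdeg]; exact hsp.natDegree_eq_card_roots.symm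
  have hprod : f = (f.roots.map fun x => Polynomial.X - Polynomial.C x).prod :=
    hsp.eq_prod_roots_of_monic hmon
  classical
  have hc : f.roots.toFinset.card = 4 := by
    rw [Multiset.toFinset_card_of_nodup hnd, hcard]
  let e := (Finset.equivFinOfCardEq hc).symm
  refine ⟨fun i => (e i : K), fun i j h => e.injective (Subtype.ext h), ?_⟩
  have h1 : ∏ i : Fin 4, (Polynomial.X - Polynomial.C ((e i : K)))
      = ∏ x : f.roots.toFinset, (Polynomial.X - Polynomial.C (x : K)) :=
    Equiv.prod_comp e (fun x : f.roots.toFinset => Polynomial.X - Polynomial.C (x : K))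
  rw [h1, Finset.prod_coe_sort f.roots.toFinset (fun x => Polynomial.X - Polynomial.C x)]
  conv_lhs => rw [hprod]
  rw [Finset.prod_multiset_map_count]
  apply Finset.prod_congr rfl
  intro x hx
  rw [Multiset.count_eq_one_of_mem hnd (Multiset.mem_toFinset.mp hx), pow_one]

lemma roots4' {K : Type*} [Field K] [IsAlgClosed K] (a b : K)
    (hd : 256 * b ^ 3 - 27 * a ^ 4 ≠ 0) :
    ∃ l : Fin 4 → K, Function.Injective l ∧
      (∀ x, x ^ 4 + a * x + b = (x - l 0) * (x - l 1) * (x - l 2) * (x - l 3)) ∧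
      l 0 + l 1 + l 2 + l 3 = 0 ∧
      l 0 * l 1 + l 0 * l 2 + l 0 * l 3 + l 1 * l 2 + l 1 * l 3 + l 2 * l 3 = 0 ∧
      a = -(l 0 * l 1 * l 2 + l 0 * l 1 * l 3 + l 0 * l 2 * l 3 + l 1 * l 2 * l 3) := by
  obtain ⟨l, hl, h⟩ := roots4 a b hd
  refine ⟨l, hl, ?_, ?_⟩
  · intro x
    have := congrArg (Polynomial.eval x) h
    rw [Fin.prod_univ_four] at this
    simpa using this
  · have h' : (Polynomial.X ^ 4 + Polynomial.C a * Polynomial.X + Polynomial.C b : Polynomial K)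
      = Polynomial.X ^ 4 + Polynomial.C (-(l 0 + l 1 + l 2 + l 3)) * Polynomial.X ^ 3
        + Polynomial.C (l 0 * l 1 + l 0 * l 2 + l 0 * l 3 + l 1 * l 2 + l 1 * l 3 + l 2 * l 3)
          * Polynomial.X ^ 2
        + Polynomial.C (-(l 0 * l 1 * l 2 + l 0 * l 1 * l 3 + l 0 * l 2 * l 3 + l 1 * l 2 * l 3))
          * Polynomial.X + Polynomial.C (l 0 * l 1 * l 2 * l 3) := by
      rw [h, Fin.prod_univ_four]
      simp only [Polynomial.C_neg, Polynomial.C_add, Polynomial.C_mul]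
      ring
    have c3 := congrArg (fun q => Polynomial.coeff q 3) h'
    have c2 := congrArg (fun q => Polynomial.coeff q 2) h'
    have c1 := congrArg (fun q => Polynomial.coeff q 1) h'
    simp only [Polynomial.coeff_add, Polynomial.coeff_C_mul, Polynomial.coeff_X_pow,
      Polynomial.coeff_X, Polynomial.coeff_C] at c1 c2 c3
    norm_num at c1 c2 c3
    refine ⟨?_, c2.symm, ?_⟩
    · linear_combination c3
    · rw [c1]; ring

lemma vand {K : Type*} [Field K] (l : Fin 4 → K) (hl : Function.Injective l) (a : K)
    (e1 : l 0 + l 1 + l 2 + l 3 = 0)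
    (e2 : l 0 * l 1 + l 0 * l 2 + l 0 * l 3 + l 1 * l 2 + l 1 * l 3 + l 2 * l 3 = 0)
    (e3 : a = -(l 0 * l 1 * l 2 + l 0 * l 1 * l 3 + l 0 * l 2 * l 3 + l 1 * l 2 * l 3)) :
    (∀ i, 4 * l i ^ 3 + a ≠ 0) ∧
    ∀ z : Fin 4 → K, ∑ i, z i = 0 → ∑ i, l i * z i = 0 → ∑ i, l i * l i * z i = 0 →
      ∀ i, z i * (4 * l i ^ 3 + a) = z 0 * (4 * l 0 ^ 3 + a) := by
  have d0 : 4 * l 0 ^ 3 + a = (l 0 - l 1) * (l 0 - l 2) * (l 0 - l 3) := by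
    linear_combination (3 * l 0 ^ 2) * e1 - 2 * l 0 * e2 + e3
  have d1 : 4 * l 1 ^ 3 + a = (l 1 - l 0) * (l 1 - l 2) * (l 1 - l 3) := by
    linear_combination (3 * l 1 ^ 2) * e1 - 2 * l 1 * e2 + e3
  have d2 : 4 * l 2 ^ 3 + a = (l 2 - l 0) * (l 2 - l 1) * (l 2 - l 3) := by
    linear_combination (3 * l 2 ^ 2) * e1 - 2 * l 2 * e2 + e3
  have d3 : 4 * l 3 ^ 3 + a = (l 3 - l 0) * (l 3 - l 1) * (l 3 - l 2) := by
    linear_combination (3 * l 3 ^ 2) * e1 - 2 * l 3 * e2 + e3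
  have hne : ∀ i j, i ≠ j → l i - l j ≠ 0 := fun i j h => sub_ne_zero.mpr (fun h' => h (hl h'))
  constructor
  · intro i
    fin_cases i
    · show 4 * l 0 ^ 3 + a ≠ 0
      rw [d0]
      exact mul_ne_zero (mul_ne_zero (hne _ _ (by decide)) (hne _ _ (by decide))) (hne _ _ (by decide))
    · show 4 * l 1 ^ 3 + a ≠ 0
      rw [d1]
      exact mul_ne_zero (mul_ne_zero (hne _ _ (by decide)) (hne _ _ (by decide))) (hne _ _ (by decide))
    · show 4 * l 2 ^ 3 + a ≠ 0
      rw [d2]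
      exact mul_ne_zero (mul_ne_zero (hne _ _ (by decide)) (hne _ _ (by decide))) (hne _ _ (by decide))
    · show 4 * l 3 ^ 3 + a ≠ 0
      rw [d3]
      exact mul_ne_zero (mul_ne_zero (hne _ _ (by decide)) (hne _ _ (by decide))) (hne _ _ (by decide))
  · intro z h0 h1 h2 i
    simp only [Fin.sum_univ_four] at h0 h1 h2
    fin_cases i
    · rfl
    · show z 1 * (4 * l 1 ^ 3 + a) = z 0 * (4 * l 0 ^ 3 + a)
      rw [d1, d0]
      linear_combination (l 1 - l 0) * (h2 - (l 2 + l 3) * h1 + l 2 * l 3 * h0)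
    · show z 2 * (4 * l 2 ^ 3 + a) = z 0 * (4 * l 0 ^ 3 + a)
      rw [d2, d0]
      linear_combination (l 2 - l 0) * (h2 - (l 1 + l 3) * h1 + l 1 * l 3 * h0)
    · show z 3 * (4 * l 3 ^ 3 + a) = z 0 * (4 * l 0 ^ 3 + a)
      rw [d3, d0]
      linear_combination (l 3 - l 0) * (h2 - (l 1 + l 2) * h1 + l 1 * l 2 * h0)

lemma quad_diag {K : Type*} [Field K] (Q : Matrix (Fin 4) (Fin 4) K) (D x y : Fin 4 → K) :
    x ⬝ᵥ ((Qᵀ * diagonal D * Q) *ᵥ y) = ∑ i, D i * (Q *ᵥ x) i * (Q *ᵥ y) i := by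
  rw [← Matrix.mulVec_mulVec, ← Matrix.mulVec_mulVec, Matrix.dotProduct_mulVec,
    Matrix.vecMul_transpose]
  simp only [dotProduct, Matrix.mulVec_diagonal]
  apply Finset.sum_congr rfl
  intro i _
  ring

lemma map_quad {k K : Type*} [Field k] [Field K] (φ : k →+* K) (M : Matrix (Fin 4) (Fin 4) k)
    (x y : Fin 4 → k) :
    φ (x ⬝ᵥ (M *ᵥ y)) = (φ ∘ x) ⬝ᵥ ((M.map φ) *ᵥ (φ ∘ y)) := by
  rw [RingHom.map_dotProduct]
  congr 1
  funext i
  exact RingHom.map_mulVec φ M y i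

lemma kdiag {k : Type} [Field k] (B : Matrix (Fin 4) (Fin 4) k) (hB : B.IsSymm) (a b : k)
    (hd : 256 * b ^ 3 - 27 * a ^ 4 ≠ 0)
    (hf : fpol B = Polynomial.X ^ 4 + Polynomial.C a * Polynomial.X + Polynomial.C b) :
    ∃ (K : Type) (_ : Field K) (φ : k →+* K) (l N : Fin 4 → K) (ξ : (Fin 4 → k) → Fin 4 → K),
      Function.Injective l ∧ (∀ i, N i ≠ 0) ∧
      (∀ x, x ^ 4 + φ a * x + φ b = (x - l 0) * (x - l 1) * (x - l 2) * (x - l 3)) ∧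
      (∀ i, 4 * l i ^ 3 + φ a ≠ 0) ∧
      (∀ z : Fin 4 → K, ∑ i, z i = 0 → ∑ i, l i * z i = 0 → ∑ i, l i * l i * z i = 0 →
        ∀ i, z i * (4 * l i ^ 3 + φ a) = z 0 * (4 * l 0 ^ 3 + φ a)) ∧
      (∀ v w t, (∀ i, ξ v i = t * ξ w i) → ∀ i, φ (v i) = t * φ (w i)) ∧
      (∀ v w, φ (v ⬝ᵥ A0 k *ᵥ w) = ∑ i, N i * ξ v i * ξ w i) ∧
      (∀ v w, φ (v ⬝ᵥ B *ᵥ w) = ∑ i, N i * l i * ξ v i * ξ w i) ∧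
      (∀ v w, φ (v ⬝ᵥ (B * A0 k * B) *ᵥ w) = ∑ i, N i * l i * l i * ξ v i * ξ w i) ∧
      (∀ v x, B *ᵥ v = x • (A0 k *ᵥ v) → ∀ i, (l i - φ x) * ξ v i = 0) := by
  let K := AlgebraicClosure k
  let φ : k →+* K := algebraMap k K
  have hd' : 256 * (φ b) ^ 3 - 27 * (φ a) ^ 4 ≠ 0 := by
    intro h
    apply hd
    apply φ.injective
    rw [map_sub, map_mul, map_mul, map_pow, map_pow, map_ofNat, map_ofNat, map_zero]
    exact h
  obtain ⟨l, hl, hx, e1, e2, e3⟩ := roots4' (φ a) (φ b) hd'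
  have hBs : (B.map φ).IsSymm := by
    rw [Matrix.IsSymm, ← Matrix.transpose_map, hB.eq]
  have hdet : ∀ i, (l i • A0 K - B.map φ).det = 0 := by
    intro i
    rw [← fpol_eval, fpol_map, hf]
    have := hx (l i)
    simp only [Polynomial.map_add, Polynomial.map_pow, Polynomial.map_X, Polynomial.map_mul,
      Polynomial.map_C, Polynomial.eval_add, Polynomial.eval_pow, Polynomial.eval_X,
      Polynomial.eval_mul, Polynomial.eval_C]
    rw [this]
    fin_cases i <;> simp
  obtain ⟨Q, N, hQ, hN, q1, q2, q3⟩ := diagK (B.map φ) hBs l hl hdet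
  have hv := vand l hl (φ a) e1 e2 e3
  have hinj : ∀ x y : Fin 4 → K, Q *ᵥ x = Q *ᵥ y → x = y := by
    intro x y h
    exact Matrix.mulVec_injective_iff_isUnit.mpr hQ h
  refine ⟨K, inferInstance, φ, l, N, fun v => Q *ᵥ (φ ∘ v), hl, hN, hx, hv.1, hv.2, ?_, ?_, ?_,
    ?_, ?_⟩
  · intro v w t h i
    have : φ ∘ v = t • (φ ∘ w) := by
      apply hinj
      rw [Matrix.mulVec_smul]
      funext i
      simpa using h i
    simpa using congrFun this i
  · intro v w
    rw [map_quad, A0_map, q1, quad_diag]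
  · intro v w
    rw [map_quad]
    conv_lhs => rw [q2]
    rw [quad_diag]
  · intro v w
    rw [map_quad, Matrix.map_mul, Matrix.map_mul, A0_map, q3, quad_diag]
  · intro v x h i
    have h' : (B.map φ) *ᵥ (φ ∘ v) = φ x • (A0 K *ᵥ (φ ∘ v)) := by
      funext j
      rw [← A0_map φ]
      have := congrArg φ (congrFun h j)
      rw [RingHom.map_mulVec] at this
      rw [this]
      simp [RingHom.map_mulVec]
    rw [q1, q2, ← Matrix.mulVec_mulVec, ← Matrix.mulVec_mulVec, ← Matrix.mulVec_mulVec,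
      ← Matrix.mulVec_mulVec, ← Matrix.mulVec_smul] at h'
    have hQt : IsUnit Qᵀ := by
      rw [Matrix.isUnit_iff_isUnit_det, Matrix.det_transpose, ← Matrix.isUnit_iff_isUnit_det]
      exact hQ
    have h2 := Matrix.mulVec_injective_iff_isUnit.mpr hQt h'
    have h3 := congrFun h2 i
    simp only [Matrix.mulVec_diagonal, Pi.smul_apply, smul_eq_mul] at h3
    apply mul_left_cancel₀ (hN i)
    rw [mul_zero]
    linear_combination h3

/-- An isotropic plane is its own orthogonal. -/
lemma isotropic_plane {k : Type} [Field k] (v w y : Fin 4 → k)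
    (hli : LinearIndependent k ![v, w])
    (hvv : v ⬝ᵥ A0 k *ᵥ v = 0) (hww : w ⬝ᵥ A0 k *ᵥ w = 0) (hvw : v ⬝ᵥ A0 k *ᵥ w = 0)
    (hvy : v ⬝ᵥ A0 k *ᵥ y = 0) (hwy : w ⬝ᵥ A0 k *ᵥ y = 0) : y ⬝ᵥ A0 k *ᵥ y = 0 := by
  have hsym : ∀ x z : Fin 4 → k, x ⬝ᵥ A0 k *ᵥ z = z ⬝ᵥ A0 k *ᵥ x := by
    intro x z
    rw [Matrix.dotProduct_mulVec, ← Matrix.mulVec_transpose, A0_symm, dotProduct_comm]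
  have hmem : y ∈ Submodule.span k (Set.range ![v, w]) := by
    by_contra hy
    have h3 : LinearIndependent k (Fin.cons y ![v, w] : Fin 3 → Fin 4 → k) :=
      linearIndependent_finCons.mpr ⟨hli, hy⟩
    let M : Matrix (Fin 2) (Fin 4) k := Matrix.of ![v, w]
    let M' : Matrix (Fin 2) (Fin 4) k := M * A0 k
    have hA0u : IsUnit (A0 k) := ⟨⟨A0 k, A0 k, A0_mul, A0_mul⟩, rfl⟩
    have hrank : M'.rank = 2 := by
      have h1 : M'.rank = M.rank :=
        Matrix.rank_mul_eq_left_of_isUnit_det _ _ ((Matrix.isUnit_iff_isUnit_det _).mp hA0u)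
      rw [h1]
      have : M.rank = Fintype.card (Fin 2) := LinearIndependent.rank_matrix (M := M) hli
      simpa using this
    have hker : ∀ x, v ⬝ᵥ A0 k *ᵥ x = 0 → w ⬝ᵥ A0 k *ᵥ x = 0 →
        x ∈ LinearMap.ker M'.mulVecLin := by
      intro x h1 h2
      rw [LinearMap.mem_ker, Matrix.mulVecLin_apply, ← Matrix.mulVec_mulVec]
      funext i
      fin_cases i
      · exact h1
      · exact h2
    have hle : Submodule.span k (Set.range (Fin.cons y ![v, w] : Fin 3 → Fin 4 → k)) ≤
        LinearMap.ker M'.mulVecLin := by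
      rw [Submodule.span_le]
      rintro x ⟨i, rfl⟩
      fin_cases i
      · exact hker y hvy hwy
      · exact hker v hvv (by rw [hsym]; exact hvw)
      · exact hker w hvw hww
    have hfr := Submodule.finrank_mono hle
    rw [finrank_span_eq_card h3] at hfr
    have hrn := LinearMap.finrank_range_add_finrank_ker M'.mulVecLin
    have : Module.finrank k (LinearMap.range M'.mulVecLin) = 2 := hrank
    simp at hfr hrn
    omega
  rw [Matrix.range_cons, Matrix.range_cons, Matrix.range_empty, Set.union_empty,
    Set.singleton_union, Submodule.mem_span_pair] at hmem
  obtain ⟨α, β, rfl⟩ := hmem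
  simp only [Matrix.mulVec_add, Matrix.mulVec_smul, dotProduct_add, add_dotProduct,
    dotProduct_smul, smul_dotProduct, hvv, hww, hvw, hsym w v]
  simp

def Distg {k : Type} [Field k] (B : Matrix (Fin 4) (Fin 4) k) : Prop :=
  ∃ v w : Fin 4 → k, LinearIndependent k ![v, w] ∧
            v ⬝ᵥ (A0 k).mulVec v = 0 ∧ v ⬝ᵥ B.mulVec v = 0 ∧
            w ⬝ᵥ (A0 k).mulVec w = 0 ∧ v ⬝ᵥ (A0 k).mulVec w = 0 ∧
            v ⬝ᵥ B.mulVec w = 0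

lemma distg_vec {k : Type} [Field k] (B : Matrix (Fin 4) (Fin 4) k) (hB : B.IsSymm)
    (h : Distg B) : ∃ v : Fin 4 → k, v ≠ 0 ∧ v ⬝ᵥ A0 k *ᵥ v = 0 ∧ v ⬝ᵥ B *ᵥ v = 0 ∧
      v ⬝ᵥ (B * A0 k * B) *ᵥ v = 0 := by
  obtain ⟨v, w, hli, h1, h2, h3, h4, h5⟩ := h
  have hA : ∀ x z : Fin 4 → k, x ⬝ᵥ A0 k *ᵥ (A0 k *ᵥ z) = x ⬝ᵥ z := by
    intro x z
    rw [Matrix.mulVec_mulVec, A0_mul, Matrix.one_mulVec]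
  have hBs : ∀ x z : Fin 4 → k, x ⬝ᵥ B *ᵥ z = z ⬝ᵥ B *ᵥ x := by
    intro x z
    rw [Matrix.dotProduct_mulVec, ← Matrix.mulVec_transpose, hB.eq, dotProduct_comm]
  refine ⟨v, hli.ne_zero 0, h1, h2, ?_⟩
  have := isotropic_plane v w (A0 k *ᵥ (B *ᵥ v)) hli h1 h3 h4 (by rw [hA]; exact h2)
    (by rw [hA, hBs]; exact h5)
  rw [hA] at this
  rw [← Matrix.mulVec_mulVec, ← Matrix.mulVec_mulVec, hBs]
  exact this

lemma eig_prop {k : Type} [Field k] (B : Matrix (Fin 4) (Fin 4) k) (hB : B.IsSymm) (a b : k)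
    (hd : 256 * b ^ 3 - 27 * a ^ 4 ≠ 0)
    (hf : fpol B = Polynomial.X ^ 4 + Polynomial.C a * Polynomial.X + Polynomial.C b)
    (x : k) (u u' : Fin 4 → k) (hu : B *ᵥ u = x • (A0 k *ᵥ u)) (hu' : B *ᵥ u' = x • (A0 k *ᵥ u'))
    (hu0 : u ≠ 0) : ∃ c : k, u' = c • u := by
  obtain ⟨K, _, φ, l, N, ξ, hl, hN, hx, hD, hV, hprop, hA, hBf, hB2, heig⟩ :=
    kdiag B hB a b hd hf
  have e1 := heig u x hu
  have e2 := heig u' x hu'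
  have hex : ∃ i, ξ u i ≠ 0 := by
    by_contra hcon
    push Not at hcon
    apply hu0
    funext j
    have := hprop u u 0 (fun i => by rw [hcon i]; ring) j
    rw [zero_mul, map_eq_zero] at this
    exact this
  obtain ⟨i, hi⟩ := hex
  have hli : l i = φ x := sub_eq_zero.mp ((mul_eq_zero.mp (e1 i)).resolve_right hi)
  have hother : ∀ w : Fin 4 → k, (∀ i, (l i - φ x) * ξ w i = 0) → ∀ j, j ≠ i → ξ w j = 0 := by
    intro w hw j hj
    refine (mul_eq_zero.mp (hw j)).resolve_left ?_
    rw [← hli]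
    exact sub_ne_zero.mpr (fun h => hj (hl h))
  have hp := hprop u' u (ξ u' i / ξ u i) (by
    intro j
    by_cases hj : j = i
    · subst hj; field_simp
    · rw [hother u' e2 j hj, hother u e1 j hj, mul_zero])
  obtain ⟨m, hm⟩ := Function.ne_iff.mp hu0
  have hm' : u m ≠ 0 := hm
  refine ⟨u' m / u m, ?_⟩
  funext j
  apply φ.injective
  have hφ : φ (u m) ≠ 0 := by rw [Ne, map_eq_zero]; exact hm'
  have := hp m
  rw [Pi.smul_apply, smul_eq_mul, map_mul, map_div₀, hp m, hp j]
  field_simp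

lemma eig_root {k : Type} [Field k] (B : Matrix (Fin 4) (Fin 4) k) (x : k) (u : Fin 4 → k)
    (hu : B *ᵥ u = x • (A0 k *ᵥ u)) (hu0 : u ≠ 0) : (fpol B).eval x = 0 := by
  rw [fpol_eval]
  apply Matrix.exists_mulVec_eq_zero_iff.mp
  refine ⟨u, hu0, ?_⟩
  rw [Matrix.sub_mulVec, Matrix.smul_mulVec, hu, sub_self]

lemma crit {k : Type} [Field k] (B : Matrix (Fin 4) (Fin 4) k) (hB : B.IsSymm) (a b : k)
    (hd : 256 * b ^ 3 - 27 * a ^ 4 ≠ 0)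
    (hf : fpol B = Polynomial.X ^ 4 + Polynomial.C a * Polynomial.X + Polynomial.C b)
    (x y : k) (u u' : Fin 4 → k) (hu : B *ᵥ u = x • (A0 k *ᵥ u)) (hu' : B *ᵥ u' = y • (A0 k *ᵥ u'))
    (hu0 : u ≠ 0) (hu0' : u' ≠ 0) (hdist : Distg B) :
    IsSquare ((u ⬝ᵥ A0 k *ᵥ u) * (u' ⬝ᵥ A0 k *ᵥ u') * (4 * x ^ 3 + a) * (4 * y ^ 3 + a)) := by
  obtain ⟨v, hv0, h1, h2, h3⟩ := distg_vec B hB hdist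
  obtain ⟨K, _, φ, l, N, ξ, hl, hN, hx, hD, hV, hprop, hA, hBf, hB2, heig⟩ :=
    kdiag B hB a b hd hf
  have hex : ∀ u : Fin 4 → k, u ≠ 0 → ∃ i, ξ u i ≠ 0 := by
    intro u hu0
    by_contra hcon
    push Not at hcon
    apply hu0
    funext j
    have := hprop u u 0 (fun i => by rw [hcon i]; ring) j
    rw [zero_mul, map_eq_zero] at this
    exact this
  have hz := hV (fun i => N i * ξ v i * ξ v i)
    (by rw [← hA, h1, map_zero])
    (by
      have := hBf v v
      rw [h2, map_zero] at this
      rw [this]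
      exact Finset.sum_congr rfl (fun i _ => by ring))
    (by
      have := hB2 v v
      rw [h3, map_zero] at this
      rw [this]
      exact Finset.sum_congr rfl (fun i _ => by ring))
  set c := N 0 * ξ v 0 * ξ v 0 * (4 * l 0 ^ 3 + φ a) with hc
  have hc0 : c ≠ 0 := by
    obtain ⟨i, hi⟩ := hex v hv0
    rw [← hz i]
    exact mul_ne_zero (mul_ne_zero (mul_ne_zero (hN i) hi) hi) (hD i)
  have key : ∀ (u : Fin 4 → k) (x : k), B *ᵥ u = x • (A0 k *ᵥ u) → u ≠ 0 →
      φ (u ⬝ᵥ A0 k *ᵥ v) ^ 2 * (4 * φ x ^ 3 + φ a) = c * φ (u ⬝ᵥ A0 k *ᵥ u) ∧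
      φ (u ⬝ᵥ A0 k *ᵥ u) ≠ 0 := by
    intro u x hu hu0
    obtain ⟨i, hi⟩ := hex u hu0
    have e1 := heig u x hu
    have hli : l i = φ x := sub_eq_zero.mp ((mul_eq_zero.mp (e1 i)).resolve_right hi)
    have hother : ∀ j, j ≠ i → ξ u j = 0 := by
      intro j hj
      refine (mul_eq_zero.mp (e1 j)).resolve_left ?_
      rw [← hli]
      exact sub_ne_zero.mpr (fun h => hj (hl h))
    have s1 : φ (u ⬝ᵥ A0 k *ᵥ v) = N i * ξ u i * ξ v i := by
      rw [hA, Finset.sum_eq_single i]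
      · intro j _ hj; rw [hother j hj]; ring
      · intro h; exact absurd (Finset.mem_univ i) h
    have s2 : φ (u ⬝ᵥ A0 k *ᵥ u) = N i * ξ u i * ξ u i := by
      rw [hA, Finset.sum_eq_single i]
      · intro j _ hj; rw [hother j hj]; ring
      · intro h; exact absurd (Finset.mem_univ i) h
    rw [s1, s2, ← hli, ← hz i]
    refine ⟨by ring, mul_ne_zero (mul_ne_zero (hN i) hi) hi⟩
  obtain ⟨k1, n1⟩ := key u x hu hu0
  obtain ⟨k2, n2⟩ := key u' y hu' hu0'
  set m1 := u ⬝ᵥ A0 k *ᵥ v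
  set m2 := u' ⬝ᵥ A0 k *ᵥ v
  set N1 := u ⬝ᵥ A0 k *ᵥ u
  set N2 := u' ⬝ᵥ A0 k *ᵥ u'
  have hm1 : m1 ≠ 0 := by
    intro h
    rw [h, map_zero] at k1
    have : c * φ N1 = 0 := by rw [← k1]; ring
    exact (mul_ne_zero hc0 n1) this
  have hrel : m1 ^ 2 * (4 * x ^ 3 + a) * N2 = m2 ^ 2 * (4 * y ^ 3 + a) * N1 := by
    apply φ.injective
    simp only [map_mul, map_add, map_pow, map_ofNat]
    linear_combination φ N2 * k1 - φ N1 * k2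
  refine ⟨m2 * (4 * y ^ 3 + a) * N1 / m1, ?_⟩
  field_simp
  linear_combination N1 * (4 * y ^ 3 + a) * hrel

lemma lines8 {k : Type} [Field k] (B : Matrix (Fin 4) (Fin 4) k) (hB : B.IsSymm) (a b : k)
    (hd : 256 * b ^ 3 - 27 * a ^ 4 ≠ 0)
    (hf : fpol B = Polynomial.X ^ 4 + Polynomial.C a * Polynomial.X + Polynomial.C b)
    (S : Finset (Fin 4 → k)) (hS : ∀ v ∈ S, v 0 = 1 ∧ v ⬝ᵥ A0 k *ᵥ v = 0 ∧ v ⬝ᵥ B *ᵥ v = 0 ∧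
      v ⬝ᵥ (B * A0 k * B) *ᵥ v = 0) : S.card ≤ 8 := by
  classical
  obtain ⟨K, _, φ, l, N, ξ, hl, hN, hx, hD, hV, hprop, hA, hBf, hB2, heig⟩ :=
    kdiag B hB a b hd hf
  rcases S.eq_empty_or_nonempty with rfl | ⟨v', hv'⟩
  · simp
  have hz : ∀ v ∈ S, (∀ i, ξ v i ≠ 0) ∧ ∀ i, N i * ξ v i * ξ v i * (4 * l i ^ 3 + φ a)
      = N 0 * ξ v 0 * ξ v 0 * (4 * l 0 ^ 3 + φ a) := by
    intro v hv
    obtain ⟨h0, h1, h2, h3⟩ := hS v hv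
    have hz := hV (fun i => N i * ξ v i * ξ v i)
      (by rw [← hA, h1, map_zero])
      (by
        have := hBf v v
        rw [h2, map_zero] at this
        rw [this]
        exact Finset.sum_congr rfl (fun i _ => by ring))
      (by
        have := hB2 v v
        rw [h3, map_zero] at this
        rw [this]
        exact Finset.sum_congr rfl (fun i _ => by ring))
    refine ⟨?_, hz⟩
    intro i hi
    have hz0 : N 0 * ξ v 0 * ξ v 0 * (4 * l 0 ^ 3 + φ a) = 0 := by
      rw [← hz i, hi]; ring
    have hall : ∀ j, ξ v j = 0 := by
      intro j
      have := hz j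
      rw [hz0] at this
      have h' := (mul_eq_zero.mp this).resolve_right (hD j)
      rcases mul_eq_zero.mp h' with h' | h'
      · exact (mul_eq_zero.mp h').resolve_left (hN j)
      · exact h'
    have := hprop v v 0 (fun i => by rw [hall i]; ring) 0
    rw [h0] at this
    simp at this
  have hinj : Set.InjOn (fun (v : Fin 4 → k) (i : Fin 3) =>
      decide (ξ v i.succ * ξ v' 0 = ξ v 0 * ξ v' i.succ)) (S : Set (Fin 4 → k)) := by
    intro v hv w hw hvw
    obtain ⟨nv, zv⟩ := hz v hv
    obtain ⟨nw, zw⟩ := hz w hw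
    obtain ⟨n', z'⟩ := hz v' hv'
    have hsq : ∀ v ∈ S, ∀ j, ξ v j * ξ v' 0 = ξ v 0 * ξ v' j ∨
        ξ v j * ξ v' 0 = -(ξ v 0 * ξ v' j) := by
      intro v hv j
      obtain ⟨nv, zv⟩ := hz v hv
      apply sq_eq_sq_iff_eq_or_eq_neg.mp
      have h0 : N j * N 0 * (4 * l j ^ 3 + φ a) * (4 * l 0 ^ 3 + φ a) ≠ 0 :=
        mul_ne_zero (mul_ne_zero (mul_ne_zero (hN j) (hN 0)) (hD j)) (hD 0)
      apply mul_left_cancel₀ h0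
      linear_combination N 0 * ξ v' 0 * ξ v' 0 * (4 * l 0 ^ 3 + φ a) * zv j
        - N 0 * ξ v 0 * ξ v 0 * (4 * l 0 ^ 3 + φ a) * z' j
    have hcross : ∀ j, ξ v j * ξ w 0 = ξ w j * ξ v 0 := by
      intro j
      refine Fin.cases (by ring) (fun i => ?_) j
      have hi := congrFun hvw i
      simp only [decide_eq_decide] at hi
      by_cases hc : ξ v i.succ * ξ v' 0 = ξ v 0 * ξ v' i.succ
      · have hc' := hi.mp hc
        apply mul_right_cancel₀ (n' 0)
        linear_combination ξ w 0 * hc - ξ v 0 * hc'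
      · have hc' := fun h => hc (hi.mpr h)
        have g1 := (hsq v hv i.succ).resolve_left hc
        have g2 := (hsq w hw i.succ).resolve_left hc'
        apply mul_right_cancel₀ (n' 0)
        linear_combination ξ w 0 * g1 - ξ v 0 * g2
    have hp := hprop v w (ξ v 0 / ξ w 0) (by
      intro j
      have := nw 0
      field_simp
      linear_combination hcross j)
    have h00 := hp 0
    rw [(hS v hv).1, (hS w hw).1, map_one, mul_one] at h00
    funext j
    apply φ.injective
    rw [hp j, ← h00, one_mul]
  have := Finset.card_le_card_of_injOn (t := (Finset.univ : Finset (Fin 3 → Bool))) _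
    (fun v _ => Finset.mem_univ _) hinj
  simpa using this

def Hm {k : Type} [Field k] (s t : k) : Matrix (Fin 4) (Fin 4) k :=
  !![1, 0, 0, 0; s, 1, 0, 0; t, 0, 1, 0; -(s * t), -t, -s, 1]

def Km {k : Type} [Field k] (n z : k) : Matrix (Fin 4) (Fin 4) k :=
  !![1, z, 0, 0; 0, 1, 0, 0; n * z, n * z ^ 2, 1, -z; 0, -(n * z), 0, 1]

def Sg {k : Type} [Field k] : Matrix (Fin 4) (Fin 4) k :=
  !![1, 0, 0, 0; 0, 0, 1, 0; 0, 1, 0, 0; 0, 0, 0, 1]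

lemma Hm_orth {k : Type} [Field k] (s t : k) : (Hm s t)ᵀ * A0 k * Hm s t = A0 k := by
  ext i j
  fin_cases i <;> fin_cases j <;> simp [A0, Hm, Matrix.mul_apply, Fin.sum_univ_four] <;> ring

lemma Km_orth {k : Type} [Field k] (s t : k) : (Km s t)ᵀ * A0 k * Km s t = A0 k := by
  ext i j
  fin_cases i <;> fin_cases j <;> simp [A0, Km, Matrix.mul_apply, Fin.sum_univ_four] <;> ring

lemma Sg_orth {k : Type} [Field k] : (Sg (k := k))ᵀ * A0 k * Sg = A0 k := by
  ext i j
  fin_cases i <;> fin_cases j <;> simp [A0, Sg, Matrix.mul_apply, Fin.sum_univ_four]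

lemma Sg_mul {k : Type} [Field k] : (Sg (k := k)) * Sg = 1 := by
  ext i j
  fin_cases i <;> fin_cases j <;> simp [Sg, Matrix.mul_apply, Fin.sum_univ_four]

lemma Hm_inv {k : Type} [Field k] (s t : k) : Hm (-s) (-t) * Hm s t = 1 := by
  ext i j
  fin_cases i <;> fin_cases j <;> simp [Hm, Matrix.mul_apply, Fin.sum_univ_four] <;> ring

lemma Km_inv {k : Type} [Field k] (s t : k) : Km s (-t) * Km s t = 1 := by
  ext i j
  fin_cases i <;> fin_cases j <;> simp [Km, Matrix.mul_apply, Fin.sum_univ_four] <;> ring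

lemma orth_mul {k : Type} [Field k] (g h : Matrix (Fin 4) (Fin 4) k)
    (hg : gᵀ * A0 k * g = A0 k) (hh : hᵀ * A0 k * h = A0 k) :
    (g * h)ᵀ * A0 k * (g * h) = A0 k := by
  calc (g * h)ᵀ * A0 k * (g * h) = hᵀ * (gᵀ * A0 k * g) * h := by
        rw [Matrix.transpose_mul]; simp only [Matrix.mul_assoc]
    _ = _ := by rw [hg, hh]

lemma orth_transpose {k : Type} [Field k] (g : Matrix (Fin 4) (Fin 4) k)
    (hg : gᵀ * A0 k * g = A0 k) : g * A0 k * gᵀ = A0 k := by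
  have h1 : (A0 k * gᵀ * A0 k) * g = 1 := by
    calc (A0 k * gᵀ * A0 k) * g = A0 k * (gᵀ * A0 k * g) := by simp only [Matrix.mul_assoc]
      _ = 1 := by rw [hg, A0_mul]
  have h2 := mul_eq_one_comm.mp h1
  calc g * A0 k * gᵀ = (g * (A0 k * gᵀ * A0 k)) * A0 k := by
        simp only [Matrix.mul_assoc, A0_mul, Matrix.mul_one]
    _ = _ := by rw [h2, Matrix.one_mul]

lemma conj_form {k : Type} [Field k] (g g' M : Matrix (Fin 4) (Fin 4) k) (h : g * g' = 1)
    (x y : Fin 4 → k) : (g' *ᵥ x) ⬝ᵥ ((gᵀ * M * g) *ᵥ (g' *ᵥ y)) = x ⬝ᵥ (M *ᵥ y) := by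
  have e : (g' *ᵥ x) ⬝ᵥ ((gᵀ * M * g) *ᵥ (g' *ᵥ y)) =
      (g *ᵥ (g' *ᵥ x)) ⬝ᵥ (M *ᵥ (g *ᵥ (g' *ᵥ y))) := by
    rw [← Matrix.mulVec_mulVec, ← Matrix.mulVec_mulVec, Matrix.dotProduct_mulVec,
      Matrix.vecMul_transpose]
  have hx : ∀ x, g *ᵥ (g' *ᵥ x) = x := by
    intro x
    rw [Matrix.mulVec_mulVec, h, Matrix.one_mulVec]
  rw [e, hx, hx]

lemma conj_eig {k : Type} [Field k] (g g' M : Matrix (Fin 4) (Fin 4) k) (h : g * g' = 1)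
    (hg : gᵀ * A0 k * g = A0 k) (x : k) (u : Fin 4 → k) (hu : M *ᵥ u = x • (A0 k *ᵥ u)) :
    (gᵀ * M * g) *ᵥ (g' *ᵥ u) = x • (A0 k *ᵥ (g' *ᵥ u)) := by
  have e : ∀ L : Matrix (Fin 4) (Fin 4) k, (gᵀ * L * g) *ᵥ (g' *ᵥ u) = gᵀ *ᵥ (L *ᵥ u) := by
    intro L
    rw [Matrix.mulVec_mulVec, Matrix.mul_assoc, h, Matrix.mul_one, Matrix.mulVec_mulVec]
  have e2 := e (A0 k)
  rw [hg] at e2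
  rw [e, hu, e2, Matrix.mulVec_smul]

lemma conj_inj {k : Type} [Field k] (g g' M L : Matrix (Fin 4) (Fin 4) k) (h : g * g' = 1)
    (e : gᵀ * M * g = gᵀ * L * g) : M = L := by
  have h2 : g'ᵀ * gᵀ = 1 := by rw [← Matrix.transpose_mul, h, Matrix.transpose_one]
  have key : ∀ M : Matrix (Fin 4) (Fin 4) k, g'ᵀ * (gᵀ * M * g) * g' = M := by
    intro M
    calc g'ᵀ * (gᵀ * M * g) * g' = (g'ᵀ * gᵀ) * M * (g * g') := by simp only [Matrix.mul_assoc]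
      _ = M := by rw [h, h2, Matrix.one_mul, Matrix.mul_one]
  rw [← key M, e, key]

lemma conj_symm {k : Type} [Field k] (g M : Matrix (Fin 4) (Fin 4) k) (h : M.IsSymm) :
    (gᵀ * M * g).IsSymm := by
  rw [Matrix.IsSymm]
  simp only [Matrix.transpose_mul, Matrix.transpose_transpose, h.eq, Matrix.mul_assoc]

lemma conj_sq {k : Type} [Field k] (g M : Matrix (Fin 4) (Fin 4) k)
    (hg : gᵀ * A0 k * g = A0 k) :
    (gᵀ * M * g) * A0 k * (gᵀ * M * g) = gᵀ * (M * A0 k * M) * g := by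
  calc (gᵀ * M * g) * A0 k * (gᵀ * M * g) = gᵀ * M * (g * A0 k * gᵀ) * M * g := by
        simp only [Matrix.mul_assoc]
    _ = _ := by rw [orth_transpose g hg]; simp only [Matrix.mul_assoc]

/-- the complementary quadratic factor -/
def qq {k : Type} [Field k] (x y a : k) : k := a ^ 2 + (x + y) * a + (x ^ 2 + x * y + y ^ 2)

def al {k : Type} [Field k] (x y : k) : k := (x + y) * (x * y - (x ^ 2 + x * y + y ^ 2))
def be {k : Type} [Field k] (x y : k) : k := x * y * (x ^ 2 + x * y + y ^ 2)

def BP {k : Type} [Field k] (x y a b n m : k) : Matrix (Fin 4) (Fin 4) k :=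
  smat (n * (x - a) / 2) (-(n * m * b)) (n * b) ((x + a) / 2)
    (m * (y - (-x - y - a)) / 2) ((y + (-x - y - a)) / 2) (m * b)
    ((y - (-x - y - a)) / (2 * m)) (-b) ((x - a) / (2 * n))

lemma fpol_BP {k : Type} [Field k] (h2 : (2 : k) ≠ 0) (x y a b n m : k) (hn : n ≠ 0) (hm : m ≠ 0)
    (h : n * m * (4 * b ^ 2) = - qq x y a) :
    fpol (BP x y a b n m) = Polynomial.X ^ 4 + Polynomial.C (al x y) * Polynomial.X
      + Polynomial.C (be x y) := by
  unfold BP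
  rw [fpol_smat]
  unfold qq at h
  unfold al be
  have e3 : ∀ c : k, c = 0 → Polynomial.X ^ 4 + Polynomial.C c * Polynomial.X ^ 3 =
      (Polynomial.X ^ 4 : Polynomial k) := by
    rintro c rfl; simp
  have e2 : ∀ c : k, c = 0 → Polynomial.X ^ 4 + Polynomial.C c * Polynomial.X ^ 2 =
      (Polynomial.X ^ 4 : Polynomial k) := by
    rintro c rfl; simp
  have h4 : (4 : k) ≠ 0 := by
    have : (4 : k) = 2 * 2 := by norm_num
    rw [this]; exact mul_ne_zero h2 h2
  rw [e3, e2]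
  · congr 3
    · congr 1
      linear_combination (norm := (field_simp; ring)) (x + y) * h
    · linear_combination (norm := (field_simp; ring)) (-(x * y)) * h
  · linear_combination (norm := (field_simp; ring)) (-1) * h
  · field_simp
    ring

def GP {k : Type} [Field k] (n z s t : k) : Matrix (Fin 4) (Fin 4) k := Km n (-z) * Hm (-s) (-t)
def GQ {k : Type} [Field k] (n z s t : k) : Matrix (Fin 4) (Fin 4) k := Hm s t * Km n z

lemma GP_mul {k : Type} [Field k] (n z s t : k) : GP n z s t * GQ n z s t = 1 := by
  unfold GP GQ
  rw [Matrix.mul_assoc, ← Matrix.mul_assoc (Hm (-s) (-t)), Hm_inv, Matrix.one_mul, Km_inv]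

lemma GP_orth {k : Type} [Field k] (n z s t : k) :
    (GP n z s t)ᵀ * A0 k * GP n z s t = A0 k :=
  orth_mul _ _ (Km_orth _ _) (Hm_orth _ _)

def PB {k : Type} [Field k] (x y a b n m z s t : k) : Matrix (Fin 4) (Fin 4) k :=
  (GP n z s t)ᵀ * BP x y a b n m * GP n z s t

lemma PB_symm {k : Type} [Field k] (x y a b n m z s t : k) : (PB x y a b n m z s t).IsSymm :=
  conj_symm _ _ (smat_symm _ _ _ _ _ _ _ _ _ _)

lemma PB_fpol {k : Type} [Field k] (h2 : (2 : k) ≠ 0) (x y a b n m z s t : k) (hn : n ≠ 0)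
    (hm : m ≠ 0) (h : n * m * (4 * b ^ 2) = - qq x y a) :
    fpol (PB x y a b n m z s t) = Polynomial.X ^ 4 + Polynomial.C (al x y) * Polynomial.X
      + Polynomial.C (be x y) := by
  unfold PB
  rw [fpol_conj _ _ (GP_orth _ _ _ _), fpol_BP h2 x y a b n m hn hm h]

def u1 {k : Type} [Field k] (n s t : k) : Fin 4 → k := ![1, s, t, n - s * t]
def u2 {k : Type} [Field k] (n m z s t : k) : Fin 4 → k :=
  ![z, s * z + 1, t * z + (m + n * z ^ 2),
    -(s * t) * z - t - s * (m + n * z ^ 2) - n * z]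

lemma u1_eq {k : Type} [Field k] (n z s t : k) : GQ n z s t *ᵥ ![1, 0, 0, n] = u1 n s t := by
  ext i
  fin_cases i <;> simp [GQ, u1, Hm, Km, Matrix.mulVec, dotProduct, Fin.sum_univ_four,
    Matrix.mul_apply] <;> ring

lemma u2_eq {k : Type} [Field k] (n m z s t : k) :
    GQ n z s t *ᵥ ![0, 1, m, 0] = u2 n m z s t := by
  ext i
  fin_cases i <;> simp [GQ, u2, Hm, Km, Matrix.mulVec, dotProduct, Fin.sum_univ_four,
    Matrix.mul_apply] <;> ring

lemma PB_eig1 {k : Type} [Field k] (h2 : (2 : k) ≠ 0) (x y a b n m z s t : k) (hn : n ≠ 0) :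
    PB x y a b n m z s t *ᵥ u1 n s t = x • (A0 k *ᵥ u1 n s t) := by
  unfold PB
  rw [← u1_eq n z s t]
  apply conj_eig _ _ _ (GP_mul _ _ _ _) (GP_orth _ _ _ _)
  ext i
  fin_cases i <;> simp [BP, smat, A0, Matrix.mulVec, dotProduct, Fin.sum_univ_four] <;>
    field_simp <;> ring

lemma PB_eig2 {k : Type} [Field k] (h2 : (2 : k) ≠ 0) (x y a b n m z s t : k) (hm : m ≠ 0) :
    PB x y a b n m z s t *ᵥ u2 n m z s t = y • (A0 k *ᵥ u2 n m z s t) := by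
  unfold PB
  rw [← u2_eq n m z s t]
  apply conj_eig _ _ _ (GP_mul _ _ _ _) (GP_orth _ _ _ _)
  ext i
  fin_cases i <;> simp [BP, smat, A0, Matrix.mulVec, dotProduct, Fin.sum_univ_four] <;>
    field_simp <;> ring

lemma u1_norm {k : Type} [Field k] (n s t : k) : u1 n s t ⬝ᵥ (A0 k *ᵥ u1 n s t) = 2 * n := by
  simp [u1, A0, Matrix.mulVec, dotProduct, Fin.sum_univ_four]
  ring

lemma u2_norm {k : Type} [Field k] (n m z s t : k) :
    u2 n m z s t ⬝ᵥ (A0 k *ᵥ u2 n m z s t) = 2 * m := by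
  simp [u2, A0, Matrix.mulVec, dotProduct, Fin.sum_univ_four]
  ring

lemma u1_ne {k : Type} [Field k] (n s t : k) : u1 n s t ≠ 0 := by
  intro h
  have := congrFun h 0
  simp [u1] at this

lemma u2_ne {k : Type} [Field k] (n m z s t : k) : u2 n m z s t ≠ 0 := by
  intro h
  have h0 := congrFun h 0
  have h1 := congrFun h 1
  simp [u2] at h0 h1
  simp [h0] at h1

lemma disc_id {k : Type} [Field k] (x y : k) : 256 * (be x y) ^ 3 - 27 * (al x y) ^ 4 =
    (x - y) ^ 2 * (-3 * x ^ 2 - 2 * x * y - 3 * y ^ 2) * qq x y x ^ 2 * qq x y y ^ 2 := by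
  unfold be al qq
  ring

lemma der1 {k : Type} [Field k] (x y : k) : 4 * x ^ 3 + al x y = (x - y) * qq x y x := by
  unfold al qq
  ring

lemma der2 {k : Type} [Field k] (x y : k) : 4 * y ^ 3 + al x y = (y - x) * qq x y y := by
  unfold al qq
  ring

lemma PB_inj {k : Type} [Field k] (h2 : (2 : k) ≠ 0) (x y a b n m z s t a' b' n' m' z' s' t' : k)
    (hn : n ≠ 0) (hm : m ≠ 0) (h : n * m * (4 * b ^ 2) = - qq x y a)
    (hn' : n' ≠ 0) (hm' : m' ≠ 0)
    (hd : 256 * (be x y) ^ 3 - 27 * (al x y) ^ 4 ≠ 0)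
    (e : PB x y a b n m z s t = PB x y a' b' n' m' z' s' t') :
    a = a' ∧ b = b' ∧ n = n' ∧ z = z' ∧ s = s' ∧ t = t' := by
  have hB := PB_symm x y a b n m z s t
  have hf := PB_fpol h2 x y a b n m z s t hn hm h
  have e1 := PB_eig1 h2 x y a b n m z s t hn
  have e2 := PB_eig2 h2 x y a b n m z s t hm
  have e1' := PB_eig1 h2 x y a' b' n' m' z' s' t' hn'
  have e2' := PB_eig2 h2 x y a' b' n' m' z' s' t' hm'
  rw [← e] at e1' e2'
  obtain ⟨c, hc⟩ := eig_prop _ hB _ _ hd hf x _ _ e1 e1' (u1_ne _ _ _)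
  obtain ⟨d, hdd⟩ := eig_prop _ hB _ _ hd hf y _ _ e2 e2' (u2_ne _ _ _ _ _)
  have c0 := congrFun hc 0
  have c1 := congrFun hc 1
  have c2 := congrFun hc 2
  have c3 := congrFun hc 3
  simp [u1] at c0 c1 c2 c3
  subst c0
  simp at c1 c2 c3
  subst c1 c2
  have hnn : n' = n := by linear_combination c3
  subst hnn
  have d0 := congrFun hdd 0
  have d1 := congrFun hdd 1
  have d2 := congrFun hdd 2
  simp [u2] at d0 d1 d2
  have hd1 : d = 1 := by linear_combination s' * d0 - d1
  subst hd1
  simp at d0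
  subst d0
  have hmm : m' = m := by linear_combination d2
  subst hmm
  unfold PB at e
  have e' := conj_inj _ _ _ _ (GP_mul _ _ _ _) e
  have f1 := congrFun (congrFun e' 2) 3
  have f2 := congrFun (congrFun e' 0) 3
  simp [BP, smat] at f1 f2
  have ha : a = a' := by
    field_simp at f2
    linear_combination f2
  exact ⟨ha, f1, rfl, rfl, rfl, rfl⟩

/-- square class of an eigenvalue -/
def Scl {k : Type} [Field k] (B : Matrix (Fin 4) (Fin 4) k) (a x : k) : Prop :=
  ∃ u : Fin 4 → k, u ≠ 0 ∧ B *ᵥ u = x • (A0 k *ᵥ u) ∧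
    IsSquare ((u ⬝ᵥ (A0 k *ᵥ u)) * (4 * x ^ 3 + a))

lemma Scl_iff {k : Type} [Field k] (B : Matrix (Fin 4) (Fin 4) k) (hB : B.IsSymm) (a b : k)
    (hd : 256 * b ^ 3 - 27 * a ^ 4 ≠ 0)
    (hf : fpol B = Polynomial.X ^ 4 + Polynomial.C a * Polynomial.X + Polynomial.C b)
    (x : k) (u : Fin 4 → k) (hu : u ≠ 0) (he : B *ᵥ u = x • (A0 k *ᵥ u)) :
    Scl B a x ↔ IsSquare ((u ⬝ᵥ (A0 k *ᵥ u)) * (4 * x ^ 3 + a)) := by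
  constructor
  · rintro ⟨w, hw, hew, hs⟩
    obtain ⟨c, hc⟩ := eig_prop B hB a b hd hf x w u hew he hw
    subst hc
    obtain ⟨r, hr⟩ := hs
    refine ⟨c * r, ?_⟩
    rw [Matrix.mulVec_smul, smul_dotProduct, dotProduct_smul, smul_eq_mul, smul_eq_mul]
    linear_combination c ^ 2 * hr
  · intro h
    exact ⟨u, hu, he, h⟩

lemma nsq_mul {k : Type} [Field k] [Fintype k] (x y : k) (hx : ¬ IsSquare x) (hy : ¬ IsSquare y) :
    IsSquare (x * y) := by
  classical
  have hx0 : x ≠ 0 := by rintro rfl; exact hx (IsSquare.zero)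
  have hy0 : y ≠ 0 := by rintro rfl; exact hy (IsSquare.zero)
  have h1 := (quadraticChar_neg_one_iff_not_isSquare (a := x)).2 hx
  have h2 := (quadraticChar_neg_one_iff_not_isSquare (a := y)).2 hy
  rw [← quadraticChar_one_iff_isSquare (mul_ne_zero hx0 hy0), map_mul, h1, h2]
  norm_num

lemma sq_key {k : Type} [Field k] (x y a b n m : k) (hxy : x ≠ y)
    (h : n * m * (4 * b ^ 2) = - qq x y a)
    (hs : IsSquare ((2 * n) * (2 * m) * (4 * x ^ 3 + al x y) * (4 * y ^ 3 + al x y))) :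
    IsSquare (qq x y a * (qq x y x * qq x y y)) := by
  rw [der1, der2] at hs
  obtain ⟨r, hr⟩ := hs
  have hxy' : x - y ≠ 0 := sub_ne_zero.2 hxy
  refine ⟨b * r / (x - y), ?_⟩
  field_simp
  linear_combination ((x - y) ^ 2 * qq x y x * qq x y y) * h + b ^ 2 * hr

lemma PB_ndist {k : Type} [Field k] (h2 : (2 : k) ≠ 0) (x y a b n m z s t : k)
    (hn : n ≠ 0) (hm : m ≠ 0) (h : n * m * (4 * b ^ 2) = - qq x y a) (hxy : x ≠ y)
    (hd : 256 * (be x y) ^ 3 - 27 * (al x y) ^ 4 ≠ 0)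
    (hs : ¬ IsSquare (qq x y a * (qq x y x * qq x y y))) : ¬ Distg (PB x y a b n m z s t) := by
  intro hD
  have := crit _ (PB_symm x y a b n m z s t) _ _ hd (PB_fpol h2 x y a b n m z s t hn hm h) x y _ _
    (PB_eig1 h2 x y a b n m z s t hn) (PB_eig2 h2 x y a b n m z s t hm) (u1_ne _ _ _)
    (u2_ne _ _ _ _ _) hD
  rw [u1_norm, u2_norm] at this
  exact hs (sq_key x y a b n m hxy h this)

lemma PB_par {k : Type} [Field k] [Fintype k] (h2 : (2 : k) ≠ 0) (x y a b n m z s t : k)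
    (hn : n ≠ 0) (hm : m ≠ 0) (h : n * m * (4 * b ^ 2) = - qq x y a) (hxy : x ≠ y)
    (hd : 256 * (be x y) ^ 3 - 27 * (al x y) ^ 4 ≠ 0)
    (hs : ¬ IsSquare (qq x y a * (qq x y x * qq x y y))) :
    ¬ (Scl (PB x y a b n m z s t) (al x y) x ↔ Scl (PB x y a b n m z s t) (al x y) y) := by
  have hf := PB_fpol h2 x y a b n m z s t hn hm h
  rw [Scl_iff _ (PB_symm x y a b n m z s t) _ _ hd hf x _ (u1_ne _ _ _)
    (PB_eig1 h2 x y a b n m z s t hn), Scl_iff _ (PB_symm x y a b n m z s t) _ _ hd hf y _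
    (u2_ne _ _ _ _ _) (PB_eig2 h2 x y a b n m z s t hm), u1_norm, u2_norm]
  intro hi
  apply hs
  apply sq_key x y a b n m hxy h
  have : IsSquare ((2 * n * (4 * x ^ 3 + al x y)) * (2 * m * (4 * y ^ 3 + al x y))) := by
    by_cases h1 : IsSquare (2 * n * (4 * x ^ 3 + al x y))
    · exact h1.mul (hi.1 h1)
    · exact nsq_mul _ _ h1 (fun h3 => h1 (hi.2 h3))
  convert this using 1
  ring

lemma fpol_coef {k : Type} [Field k] (a b a' b' : k)
    (h : Polynomial.X ^ 4 + Polynomial.C a * Polynomial.X + Polynomial.C b =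
      Polynomial.X ^ 4 + Polynomial.C a' * Polynomial.X + Polynomial.C b') : a = a' ∧ b = b' := by
  have h0 := congrArg (fun q => Polynomial.coeff q 0) h
  have h1 := congrArg (fun q => Polynomial.coeff q 1) h
  simp [Polynomial.coeff_X, Polynomial.coeff_C] at h0 h1
  exact ⟨h1, h0⟩

lemma root_count {k : Type} [Field k] [Fintype k] [DecidableEq k] (P : Polynomial k) (hP : P ≠ 0)
    (d : ℕ) (hd : P.natDegree ≤ d) :
    (Finset.univ.filter (fun x : k => P.eval x = 0)).card ≤ d := by
  refine le_trans (Finset.card_le_card (t := P.roots.toFinset) ?_)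
    (le_trans (Multiset.toFinset_card_le _) (le_trans P.card_roots' hd))
  intro x hx
  simp only [Finset.mem_filter, Finset.mem_univ, true_and] at hx
  simp [hP, hx]

lemma quad_count {k : Type} [Field k] [Fintype k] [DecidableEq k] (u v w : k) (hu : u ≠ 0) :
    (Finset.univ.filter (fun x : k => u * x ^ 2 + v * x + w = 0)).card ≤ 2 := by
  have h := root_count (Polynomial.C u * Polynomial.X ^ 2 + Polynomial.C v * Polynomial.X
    + Polynomial.C w) (by
      intro h
      have := Polynomial.natDegree_quadratic (b := v) (c := w) hu
      rw [h] at this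
      simp at this) 2 (Polynomial.natDegree_quadratic_le)
  simpa using h

lemma cubic_count {k : Type} [Field k] [Fintype k] [DecidableEq k] (u w : k) (hu : u ≠ 0) :
    (Finset.univ.filter (fun x : k => u * x ^ 3 - w = 0)).card ≤ 3 := by
  have h := root_count (Polynomial.C u * Polynomial.X ^ 3 + Polynomial.C 0 * Polynomial.X ^ 2 +
    Polynomial.C 0 * Polynomial.X
    + Polynomial.C (-w)) (by
      intro h
      have := Polynomial.natDegree_cubic (b := 0) (c := 0) (d := -w) hu
      rw [h] at this
      simp at this) 3 (Polynomial.natDegree_cubic_le)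
  simpa [sub_eq_add_neg] using h

lemma quart_count {k : Type} [Field k] [Fintype k] [DecidableEq k] (a b : k) :
    (Finset.univ.filter (fun x : k => x ^ 4 + a * x + b = 0)).card ≤ 4 := by
  have hdeg : (Polynomial.X ^ 4 + Polynomial.C a * Polynomial.X
    + Polynomial.C b : Polynomial k).natDegree = 4 := by compute_degree!
  have h := root_count (Polynomial.X ^ 4 + Polynomial.C a * Polynomial.X
    + Polynomial.C b) (by
      intro h
      rw [h] at hdeg
      simp at hdeg) 4 (le_of_eq hdeg)
  simpa using h

lemma conic_count {k : Type} [Field k] [Fintype k] [DecidableEq k] (h2 : (2 : k) ≠ 0) (s c : k)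
    (hD : s ^ 2 - 4 * c ≠ 0) :
    (Finset.univ.filter (fun p : k × k => p.2 ^ 2 = p.1 ^ 2 + s * p.1 + c)).card
      = Fintype.card k - 1 := by
  have h4 : (4 : k) ≠ 0 := by
    have : (4 : k) = 2 * 2 := by norm_num
    rw [this]; exact mul_ne_zero h2 h2
  have e : (Finset.univ.erase (0 : k)).card = Fintype.card k - 1 := by
    rw [Finset.card_erase_of_mem (Finset.mem_univ _), Finset.card_univ]
  rw [← e]
  have hne : ∀ p : k × k, p.2 ^ 2 = p.1 ^ 2 + s * p.1 + c → 2 * p.1 + s - 2 * p.2 ≠ 0 := by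
    intro p hp h0
    apply hD
    linear_combination 4 * hp + (2 * p.1 + s + 2 * p.2) * h0
  refine Finset.card_nbij' (fun p => 2 * p.1 + s - 2 * p.2)
    (fun u => ((u + (s ^ 2 - 4 * c) / u - 2 * s) / 4, ((s ^ 2 - 4 * c) / u - u) / 4)) ?_ ?_ ?_ ?_
  · intro p hp
    simp at hp
    simpa using hne p hp
  · intro u hu
    simp at hu
    simp
    field_simp
    ring
  · intro p hp
    simp at hp
    have h0 := hne p hp
    have key : (s ^ 2 - 4 * c) / (2 * p.1 + s - 2 * p.2) = 2 * p.1 + s + 2 * p.2 := by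
      rw [div_eq_iff h0]
      linear_combination 4 * hp
    ext
    · simp only [key]
      field_simp
      ring
    · simp only [key]
      field_simp
      ring
  · intro u hu
    simp at hu
    simp
    field_simp
    ring

lemma char_sum {k : Type} [Field k] [Fintype k] [DecidableEq k] (h2 : (2 : k) ≠ 0) (s c : k)
    (hD : s ^ 2 - 4 * c ≠ 0) : ∑ a : k, quadraticChar k (a ^ 2 + s * a + c) = -1 := by
  have hc : ringChar k ≠ 2 := by
    intro h
    apply h2
    have := ringChar.Nat.cast_ringChar (R := k)
    rw [h] at this
    exact_mod_cast this
  have h1 := conic_count h2 s c hD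
  have h3 : (Finset.univ.filter (fun p : k × k => p.2 ^ 2 = p.1 ^ 2 + s * p.1 + c)).card =
      ∑ a : k, (Finset.univ.filter (fun y : k => y ^ 2 = a ^ 2 + s * a + c)).card := by
    rw [Finset.card_filter, Fintype.sum_prod_type]
    apply Finset.sum_congr rfl
    intro a _
    rw [Finset.card_filter]
  have h4 : ∀ a : k, ((Finset.univ.filter (fun y : k => y ^ 2 = a ^ 2 + s * a + c)).card : ℤ) =
      quadraticChar k (a ^ 2 + s * a + c) + 1 := by
    intro a
    rw [← quadraticChar_card_sqrts hc]
    congr 2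
    ext y
    simp
  have h5 : ((Fintype.card k - 1 : ℕ) : ℤ) = ∑ a : k, (quadraticChar k (a ^ 2 + s * a + c) + 1) := by
    rw [← h1, h3]
    push_cast
    exact Finset.sum_congr rfl (fun a _ => h4 a)
  rw [Finset.sum_add_distrib] at h5
  have := Fintype.card_pos (α := k)
  simp only [Finset.sum_const, Finset.card_univ, nsmul_eq_mul, mul_one] at h5
  rw [Nat.cast_sub this] at h5
  push_cast at h5
  linarith

lemma T_count {k : Type} [Field k] [Fintype k] [DecidableEq k] (h2 : (2 : k) ≠ 0) (s c r : k)
    (hD : s ^ 2 - 4 * c ≠ 0) :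
    r ≠ 0 → Fintype.card k ≤ 2 * (Finset.univ.filter
      (fun a : k => quadraticChar k ((a ^ 2 + s * a + c) * r) = -1)).card + 3 := by
  intro hr
  have h0 : (Finset.univ.filter (fun x : k => x ^ 2 + s * x + c = 0)).card ≤ 2 := by
    simpa using quad_count 1 s c one_ne_zero
  have hs := char_sum h2 s c hD
  have hs' : ∑ a : k, quadraticChar k ((a ^ 2 + s * a + c) * r) = - quadraticChar k r := by
    simp only [map_mul]
    rw [← Finset.sum_mul, hs]
    ring
  have hr1 : -1 ≤ quadraticChar k r := by
    rcases quadraticChar_dichotomy hr with h | h <;> rw [h] <;> norm_num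
  have hle : ∑ a : k, (1 - quadraticChar k ((a ^ 2 + s * a + c) * r)) ≤
      ∑ a : k, (2 * (if quadraticChar k ((a ^ 2 + s * a + c) * r) = -1 then (1:ℤ) else 0) +
        (if a ^ 2 + s * a + c = 0 then (1:ℤ) else 0)) := by
    apply Finset.sum_le_sum
    intro a _
    by_cases hq : a ^ 2 + s * a + c = 0
    · simp [hq]
    · rcases quadraticChar_dichotomy (mul_ne_zero hq hr) with h | h <;> rw [h] <;> simp [hq]
  rw [Finset.sum_sub_distrib, hs', Finset.sum_add_distrib, ← Finset.mul_sum, Finset.sum_boole,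
    Finset.sum_boole] at hle
  simp only [Finset.sum_const, Finset.card_univ, nsmul_eq_mul, mul_one] at hle
  have : ((Finset.univ.filter (fun x : k => x ^ 2 + s * x + c = 0)).card : ℤ) ≤ 2 := by
    exact_mod_cast h0
  have : (Fintype.card k : ℤ) ≤ 2 * ((Finset.univ.filter
      (fun a : k => quadraticChar k ((a ^ 2 + s * a + c) * r) = -1)).card : ℤ) + 3 := by
    linarith
  exact_mod_cast this

def Good {k : Type} [Field k] (x y : k) : Prop :=
  x ≠ y ∧ qq x y x ≠ 0 ∧ qq x y y ≠ 0 ∧ -3 * x ^ 2 - 2 * x * y - 3 * y ^ 2 ≠ 0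

open Classical in
noncomputable def GS {k : Type} [Field k] [Fintype k] (x : k) : Finset k :=
  Finset.univ.filter (fun y => Good x y)

open Classical in
noncomputable def TS {k : Type} [Field k] [Fintype k] (x y : k) : Finset k :=
  Finset.univ.filter
    (fun a : k => quadraticChar k ((a ^ 2 + (x + y) * a + (x ^ 2 + x * y + y ^ 2)) *
      (qq x y x * qq x y y)) = -1)

lemma GS_card {k : Type} [Field k] [Fintype k] (h3 : (3 : k) ≠ 0) (x : k) :
    Fintype.card k ≤ (GS x).card + 7 := by
  classical
  have hsub : (Finset.univ : Finset k) ⊆ GS x ∪ ({x} ∪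
      ((Finset.univ.filter (fun y : k => 1 * y ^ 2 + (2 * x) * y + 3 * x ^ 2 = 0)) ∪
      ((Finset.univ.filter (fun y : k => 3 * y ^ 2 + (2 * x) * y + x ^ 2 = 0)) ∪
      (Finset.univ.filter (fun y : k => 3 * y ^ 2 + (2 * x) * y + 3 * x ^ 2 = 0))))) := by
    intro y _
    by_contra hy
    simp only [Finset.mem_union, Finset.mem_singleton, Finset.mem_filter, Finset.mem_univ,
      true_and, not_or, GS] at hy
    obtain ⟨hg, h1, h2, h3, h4⟩ := hy
    apply hg
    refine ⟨fun h => h1 h.symm, ?_, ?_, ?_⟩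
    · intro h
      apply h2
      rw [← h]; unfold qq; ring
    · intro h
      apply h3
      rw [← h]; unfold qq; ring
    · intro h
      apply h4
      linear_combination -h
  have h1 := Finset.card_le_card hsub
  have q1 := quad_count 1 (2 * x) (3 * x ^ 2) one_ne_zero
  have q2 := quad_count 3 (2 * x) (x ^ 2) h3
  have q3 := quad_count 3 (2 * x) (3 * x ^ 2) h3
  have := Finset.card_union_le (GS x) ({x} ∪
      ((Finset.univ.filter (fun y : k => 1 * y ^ 2 + (2 * x) * y + 3 * x ^ 2 = 0)) ∪
      ((Finset.univ.filter (fun y : k => 3 * y ^ 2 + (2 * x) * y + x ^ 2 = 0)) ∪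
      (Finset.univ.filter (fun y : k => 3 * y ^ 2 + (2 * x) * y + 3 * x ^ 2 = 0)))))
  have := Finset.card_union_le {x}
      ((Finset.univ.filter (fun y : k => 1 * y ^ 2 + (2 * x) * y + 3 * x ^ 2 = 0)) ∪
      ((Finset.univ.filter (fun y : k => 3 * y ^ 2 + (2 * x) * y + x ^ 2 = 0)) ∪
      (Finset.univ.filter (fun y : k => 3 * y ^ 2 + (2 * x) * y + 3 * x ^ 2 = 0))))
  have := Finset.card_union_le
      (Finset.univ.filter (fun y : k => 1 * y ^ 2 + (2 * x) * y + 3 * x ^ 2 = 0))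
      ((Finset.univ.filter (fun y : k => 3 * y ^ 2 + (2 * x) * y + x ^ 2 = 0)) ∪
      (Finset.univ.filter (fun y : k => 3 * y ^ 2 + (2 * x) * y + 3 * x ^ 2 = 0)))
  have := Finset.card_union_le
      (Finset.univ.filter (fun y : k => 3 * y ^ 2 + (2 * x) * y + x ^ 2 = 0))
      (Finset.univ.filter (fun y : k => 3 * y ^ 2 + (2 * x) * y + 3 * x ^ 2 = 0))
  rw [Finset.card_singleton] at *
  rw [Finset.card_univ] at h1
  omega

lemma TS_card {k : Type} [Field k] [Fintype k] (h2 : (2 : k) ≠ 0) (x y : k) (h : Good x y) :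
    Fintype.card k ≤ 2 * (TS x y).card + 3 := by
  classical
  obtain ⟨-, h1, h3, h4⟩ := h
  have := T_count h2 (x + y) (x ^ 2 + x * y + y ^ 2) (qq x y x * qq x y y) (by
    intro h; apply h4; linear_combination h) (mul_ne_zero h1 h3)
  convert this using 4
  unfold TS
  congr!

noncomputable def D3 (k : Type) [Field k] [Fintype k] : Finset (Σ _ : k, Σ _ : k, k) :=
  Finset.univ.sigma fun x => (GS x).sigma fun y => TS x y

lemma D3_card {k : Type} [Field k] [Fintype k] (h2 : (2 : k) ≠ 0) (h3 : (3 : k) ≠ 0) :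
    Fintype.card k * ((Fintype.card k - 7) * (Fintype.card k - 3)) ≤ 2 * (D3 k).card := by
  unfold D3
  rw [Finset.card_sigma, Finset.mul_sum, ← Finset.card_univ, ← smul_eq_mul]
  apply Finset.card_nsmul_le_sum
  intro x _
  rw [Finset.card_sigma, Finset.mul_sum, Finset.card_univ]
  calc (Fintype.card k - 7) * (Fintype.card k - 3) ≤ (GS x).card • (Fintype.card k - 3) := by
        rw [smul_eq_mul]
        apply Nat.mul_le_mul_right
        have := GS_card h3 x
        omega
    _ ≤ _ := by
        apply Finset.card_nsmul_le_sum
        intro y hy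
        have := TS_card h2 x y (by simpa [GS] using hy)
        omega

open Classical in
noncomputable def PP (k : Type) [Field k] [Fintype k] :
    Finset ((Σ _ : k, Σ _ : k, k) × (k × k × (k × k × k))) :=
  D3 k ×ˢ (Finset.univ.erase 0 ×ˢ (Finset.univ.erase 0 ×ˢ Finset.univ))

lemma PP_card {k : Type} [Field k] [Fintype k] (h2 : (2 : k) ≠ 0) (h3 : (3 : k) ≠ 0) :
    Fintype.card k * ((Fintype.card k - 7) * (Fintype.card k - 3)) *
      ((Fintype.card k - 1) * ((Fintype.card k - 1) * (Fintype.card k) ^ 3)) ≤ 2 * (PP k).card := by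
  classical
  have : (PP k).card = (D3 k).card *
      ((Fintype.card k - 1) * ((Fintype.card k - 1) * (Fintype.card k) ^ 3)) := by
    unfold PP
    rw [Finset.card_product, Finset.card_product, Finset.card_product,
      Finset.card_erase_of_mem (Finset.mem_univ _), Finset.card_univ, Finset.card_univ,
      Fintype.card_prod, Fintype.card_prod]
    ring
  rw [this, ← mul_assoc 2]
  exact Nat.mul_le_mul_right _ (D3_card h2 h3)

open Classical in
noncomputable def ND (k : Type) [Field k] [Fintype k] : Finset (Matrix (Fin 4) (Fin 4) k) :=
  Finset.univ.filter (fun B => B.IsSymm ∧ (∃ a b : k, 256 * b ^ 3 - 27 * a ^ 4 ≠ 0 ∧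
    fpol B = Polynomial.X ^ 4 + Polynomial.C a * Polynomial.X + Polynomial.C b) ∧ ¬ Distg B)

def FP {k : Type} [Field k] (w : (Σ _ : k, Σ _ : k, k) × (k × k × (k × k × k))) :
    Matrix (Fin 4) (Fin 4) k :=
  PB w.1.1 w.1.2.1 w.1.2.2 w.2.1 w.2.2.1
    (-(qq w.1.1 w.1.2.1 w.1.2.2) / (4 * w.2.2.1 * w.2.1 ^ 2)) w.2.2.2.1 w.2.2.2.2.1 w.2.2.2.2.2

lemma PP_mem {k : Type} [Field k] [Fintype k] (h2 : (2 : k) ≠ 0)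
    (x y a b n z s t : k) (h : (⟨⟨x, y, a⟩, b, n, z, s, t⟩ :
      (Σ _ : k, Σ _ : k, k) × (k × k × (k × k × k))) ∈ PP k) :
    b ≠ 0 ∧ n ≠ 0 ∧ -(qq x y a) / (4 * n * b ^ 2) ≠ 0 ∧ x ≠ y ∧
    n * (-(qq x y a) / (4 * n * b ^ 2)) * (4 * b ^ 2) = - qq x y a ∧
    256 * (be x y) ^ 3 - 27 * (al x y) ^ 4 ≠ 0 ∧
    ¬ IsSquare (qq x y a * (qq x y x * qq x y y)) := by
  classical
  have h4 : (4 : k) ≠ 0 := by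
    have : (4 : k) = 2 * 2 := by norm_num
    rw [this]; exact mul_ne_zero h2 h2
  simp only [PP, D3, Finset.mem_product, Finset.mem_sigma, Finset.mem_univ, true_and,
    Finset.mem_erase, and_true, GS, TS, Finset.mem_filter] at h
  obtain ⟨⟨⟨g1, g2, g3, g4⟩, hT⟩, hb, hn⟩ := h
  have hT' : ¬ IsSquare (qq x y a * (qq x y x * qq x y y)) := by
    rw [← quadraticChar_neg_one_iff_not_isSquare]
    exact hT
  have hq : qq x y a ≠ 0 := by
    intro h0
    rw [h0, zero_mul] at hT'
    exact hT' IsSquare.zero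
  refine ⟨hb, hn, ?_, g1, ?_, ?_, hT'⟩
  · exact div_ne_zero (neg_ne_zero.2 hq) (mul_ne_zero (mul_ne_zero h4 hn) (pow_ne_zero _ hb))
  · field_simp
  · rw [disc_id]
    exact mul_ne_zero (mul_ne_zero (mul_ne_zero (pow_ne_zero _ (sub_ne_zero.2 g1)) g4)
      (pow_ne_zero _ g2)) (pow_ne_zero _ g3)

lemma par_count {k : Type} [Field k] [Fintype k] [DecidableEq k] (R : Finset k) (hR : R.card ≤ 4)
    (S : k → Prop) [DecidablePred S] :
    ((R ×ˢ R).filter (fun w => ¬ (S w.1 ↔ S w.2))).card ≤ 8 := by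
  have hsub : (R ×ˢ R).filter (fun w => ¬ (S w.1 ↔ S w.2)) ⊆
      ((R.filter S) ×ˢ (R.filter (fun x => ¬ S x))) ∪
      ((R.filter (fun x => ¬ S x)) ×ˢ (R.filter S)) := by
    rintro ⟨x, y⟩ h
    simp only [Finset.mem_filter, Finset.mem_product, Finset.mem_union] at h ⊢
    tauto
  have h1 := Finset.card_le_card hsub
  have h2 := Finset.card_union_le ((R.filter S) ×ˢ (R.filter (fun x => ¬ S x)))
    ((R.filter (fun x => ¬ S x)) ×ˢ (R.filter S))
  rw [Finset.card_product, Finset.card_product] at h2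
  have h3 := Finset.card_filter_add_card_filter_not (s := R) S
  have h4 : (R.filter S).card ≤ 4 := by omega
  have h5 : (R.filter (fun x => ¬ S x)).card ≤ 4 - (R.filter S).card := by omega
  generalize (R.filter S).card = u at *
  generalize (R.filter (fun x => ¬ S x)).card = v at *
  have : u * v ≤ 4 := by
    have := Nat.mul_le_mul_left u h5
    interval_cases u <;> omega
  nlinarith

lemma lower_card {k : Type} [Field k] [Fintype k] (h2 : (2 : k) ≠ 0) :
    (PP k).card ≤ 8 * (ND k).card := by
  classical
  apply Finset.card_le_mul_card_image_of_maps_to (f := FP)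
  · rintro ⟨⟨x, y, a⟩, b, n, z, s, t⟩ h
    obtain ⟨hb, hn, hm, hxy, he, hd, hs⟩ := PP_mem h2 _ _ _ _ _ _ _ _ h
    simp only [ND, Finset.mem_filter, Finset.mem_univ, true_and, FP]
    exact ⟨PB_symm _ _ _ _ _ _ _ _ _, ⟨_, _, hd, PB_fpol h2 _ _ _ _ _ _ _ _ _ hn hm he⟩,
      PB_ndist h2 _ _ _ _ _ _ _ _ _ hn hm he hxy hd hs⟩
  · intro B hB
    simp only [ND, Finset.mem_filter, Finset.mem_univ, true_and] at hB
    obtain ⟨hsym, ⟨a0, b0, hd0, hf0⟩, -⟩ := hB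
    refine le_trans (Finset.card_le_card_of_injOn (fun w => (w.1.1, w.1.2.1))
      (t := ((Finset.univ.filter (fun x : k => x ^ 4 + a0 * x + b0 = 0)) ×ˢ
        (Finset.univ.filter (fun x : k => x ^ 4 + a0 * x + b0 = 0))).filter
        (fun w => ¬ (Scl B a0 w.1 ↔ Scl B a0 w.2))) ?_ ?_)
      (par_count _ (quart_count a0 b0) (fun x => Scl B a0 x))
    · rintro ⟨⟨x, y, a⟩, b, n, z, s, t⟩ h
      simp only [Finset.coe_filter, Set.mem_ofPred_eq] at h
      obtain ⟨h, hB⟩ := h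
      obtain ⟨hb, hn, hm, hxy, he, hd, hs⟩ := PP_mem h2 _ _ _ _ _ _ _ _ h
      simp only [FP] at hB
      have hf := PB_fpol h2 x y a b n _ z s t hn hm he
      have hp := PB_par h2 x y a b n _ z s t hn hm he hxy hd hs
      rw [hB] at hf hp
      obtain ⟨ha, hb'⟩ := fpol_coef _ _ _ _ (hf0.symm.trans hf)
      simp only [Finset.coe_filter, Set.mem_ofPred_eq, Finset.mem_product, Finset.mem_filter,
        Finset.mem_univ, true_and]
      rw [ha, hb']
      refine ⟨⟨?_, ?_⟩, hp⟩
      · unfold al be; ring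
      · unfold al be; ring
    · rintro ⟨⟨x, y, a⟩, b, n, z, s, t⟩ h ⟨⟨x', y', a'⟩, b', n', z', s', t'⟩ h' heq
      simp only [Prod.mk.injEq] at heq
      obtain ⟨rfl, rfl⟩ := heq
      simp only [Finset.coe_filter, Set.mem_ofPred_eq] at h h'
      obtain ⟨h, hB⟩ := h
      obtain ⟨h', hB'⟩ := h'
      obtain ⟨hb, hn, hm, hxy, he, hd, hs⟩ := PP_mem h2 _ _ _ _ _ _ _ _ h
      obtain ⟨hb', hn', hm', -, he', -, -⟩ := PP_mem h2 _ _ _ _ _ _ _ _ h'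
      have e := hB.trans hB'.symm
      simp only [FP] at e
      obtain ⟨rfl, rfl, rfl, rfl, rfl, rfl⟩ := PB_inj h2 _ _ _ _ _ _ _ _ _ _ _ _ _ _ _ _ hn hm he hn' hm' hd e
      rfl

def BI {k : Type} [Field k] (c d e h : k) : k := (-2 * d ^ 2 - 2 * c * h) / e
def BJ {k : Type} [Field k] (c d e h a : k) : k := (2 * d * e * BI c d e h - a) / (2 * c * e)
def BK {k : Type} [Field k] (c d e h a b : k) : k :=
  (2 * c * d * e * BJ c d e h a + c ^ 2 * h ^ 2 + 2 * c * d ^ 2 * h - d ^ 2 * e * BI c d e h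
    + d ^ 4 - b) / (c ^ 2 * e)

def B0 {k : Type} [Field k] (c d e h a b : k) : Matrix (Fin 4) (Fin 4) k :=
  smat 0 0 c d e (-d) h (BI c d e h) (BJ c d e h a) (BK c d e h a b)

lemma fpol_B0 {k : Type} [Field k] (h2 : (2 : k) ≠ 0) (c d e h a b : k) (hc : c ≠ 0) (he : e ≠ 0) :
    fpol (B0 c d e h a b) = Polynomial.X ^ 4 + Polynomial.C a * Polynomial.X
      + Polynomial.C b := by
  unfold B0
  rw [fpol_smat]
  have e3 : ∀ c : k, c = 0 → Polynomial.X ^ 4 + Polynomial.C c * Polynomial.X ^ 3 =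
      (Polynomial.X ^ 4 : Polynomial k) := by
    rintro c rfl; simp
  have e2 : ∀ c : k, c = 0 → Polynomial.X ^ 4 + Polynomial.C c * Polynomial.X ^ 2 =
      (Polynomial.X ^ 4 : Polynomial k) := by
    rintro c rfl; simp
  have hi : e * BI c d e h = -2 * d ^ 2 - 2 * c * h := by unfold BI; field_simp
  have hj : 2 * c * e * BJ c d e h a = 2 * d * e * BI c d e h - a := by unfold BJ; field_simp
  have hk : c ^ 2 * e * BK c d e h a b = 2 * c * d * e * BJ c d e h a + c ^ 2 * h ^ 2
    + 2 * c * d ^ 2 * h - d ^ 2 * e * BI c d e h + d ^ 4 - b := by unfold BK; field_simp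
  rw [e3, e2]
  · congr 3
    · congr 1
      linear_combination -hj
    · linear_combination -hk
  · linear_combination -hi
  · ring

def SS {k : Type} [Field k] (ε : Bool) : Matrix (Fin 4) (Fin 4) k := if ε then Sg else 1

lemma SS_mul {k : Type} [Field k] (ε : Bool) : SS (k := k) ε * SS ε = 1 := by
  cases ε <;> simp [SS, Sg_mul]

lemma SS_orth {k : Type} [Field k] (ε : Bool) : (SS (k := k) ε)ᵀ * A0 k * SS ε = A0 k := by
  cases ε <;> simp [SS, Sg_orth]

def LP {k : Type} [Field k] (ε : Bool) (s t : k) : Matrix (Fin 4) (Fin 4) k :=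
  Hm (-s) (-t) * SS ε
def LQ {k : Type} [Field k] (ε : Bool) (s t : k) : Matrix (Fin 4) (Fin 4) k := SS ε * Hm s t

lemma LP_mul {k : Type} [Field k] (ε : Bool) (s t : k) : LP ε s t * LQ ε s t = 1 := by
  unfold LP LQ
  rw [Matrix.mul_assoc, ← Matrix.mul_assoc (SS ε), SS_mul, Matrix.one_mul, Hm_inv]

lemma LP_orth {k : Type} [Field k] (ε : Bool) (s t : k) :
    (LP ε s t)ᵀ * A0 k * LP ε s t = A0 k :=
  orth_mul _ _ (Hm_orth _ _) (SS_orth _)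

def QB {k : Type} [Field k] (ε : Bool) (s t c d e h a b : k) : Matrix (Fin 4) (Fin 4) k :=
  (LP ε s t)ᵀ * B0 c d e h a b * LP ε s t

lemma QB_symm {k : Type} [Field k] (ε : Bool) (s t c d e h a b : k) :
    (QB ε s t c d e h a b).IsSymm :=
  conj_symm _ _ (smat_symm _ _ _ _ _ _ _ _ _ _)

lemma QB_fpol {k : Type} [Field k] (h2 : (2 : k) ≠ 0) (ε : Bool) (s t c d e h a b : k)
    (hc : c ≠ 0) (he : e ≠ 0) :
    fpol (QB ε s t c d e h a b) = Polynomial.X ^ 4 + Polynomial.C a * Polynomial.X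
      + Polynomial.C b := by
  unfold QB
  rw [fpol_conj _ _ (LP_orth _ _ _), fpol_B0 h2 c d e h a b hc he]

def vv {k : Type} [Field k] (ε : Bool) (s t : k) : Fin 4 → k := LQ ε s t *ᵥ ![1, 0, 0, 0]

lemma QB_form {k : Type} [Field k] (ε : Bool) (s t c d e h a b : k) (x y : Fin 4 → k) :
    (LQ ε s t *ᵥ x) ⬝ᵥ (QB ε s t c d e h a b *ᵥ (LQ ε s t *ᵥ y)) =
      x ⬝ᵥ (B0 c d e h a b *ᵥ y) := conj_form _ _ _ (LP_mul _ _ _) _ _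

lemma A_form {k : Type} [Field k] (ε : Bool) (s t : k) (x y : Fin 4 → k) :
    (LQ ε s t *ᵥ x) ⬝ᵥ (A0 k *ᵥ (LQ ε s t *ᵥ y)) = x ⬝ᵥ (A0 k *ᵥ y) := by
  have := conj_form (LP ε s t) (LQ ε s t) (A0 k) (LP_mul _ _ _) x y
  rwa [LP_orth] at this

lemma QB_dist {k : Type} [Field k] (ε : Bool) (s t c d e h a b : k) :
    Distg (QB ε s t c d e h a b) := by
  refine ⟨LQ ε s t *ᵥ ![1, 0, 0, 0], LQ ε s t *ᵥ ![0, 1, 0, 0], ?_, ?_, ?_, ?_, ?_, ?_⟩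
  · rw [LinearIndependent.pair_iff]
    intro x y hxy
    rw [← Matrix.mulVec_smul, ← Matrix.mulVec_smul, ← Matrix.mulVec_add] at hxy
    have h3 := congrArg (fun v => LP ε s t *ᵥ v) hxy
    simp only [Matrix.mulVec_mulVec, LP_mul, Matrix.one_mulVec, Matrix.mulVec_zero] at h3
    have f0 := congrFun h3 0
    have f1 := congrFun h3 1
    simp at f0 f1
    exact ⟨f0, f1⟩
  · rw [A_form]; simp [A0, Matrix.mulVec, dotProduct, Fin.sum_univ_four]
  · rw [QB_form]; simp [B0, smat, Matrix.mulVec, dotProduct, Fin.sum_univ_four]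
  · rw [A_form]; simp [A0, Matrix.mulVec, dotProduct, Fin.sum_univ_four]
  · rw [A_form]; simp [A0, Matrix.mulVec, dotProduct, Fin.sum_univ_four]
  · rw [QB_form]; simp [B0, smat, Matrix.mulVec, dotProduct, Fin.sum_univ_four]

lemma vv_false {k : Type} [Field k] (s t : k) : vv false s t = ![1, s, t, -(s * t)] := by
  ext i
  fin_cases i <;> simp [vv, LQ, SS, Hm, Matrix.mulVec, dotProduct, Fin.sum_univ_four]

lemma vv_true {k : Type} [Field k] (s t : k) : vv true s t = ![1, t, s, -(s * t)] := by
  ext i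
  fin_cases i <;> simp [vv, LQ, SS, Sg, Hm, Matrix.mulVec, dotProduct, Fin.sum_univ_four,
    Matrix.mul_apply]

lemma vv_props {k : Type} [Field k] (ε : Bool) (s t c d e h a b : k) :
    vv ε s t 0 = 1 ∧ vv ε s t ⬝ᵥ (A0 k *ᵥ vv ε s t) = 0 ∧
    vv ε s t ⬝ᵥ (QB ε s t c d e h a b *ᵥ vv ε s t) = 0 ∧
    vv ε s t ⬝ᵥ ((QB ε s t c d e h a b * A0 k * QB ε s t c d e h a b) *ᵥ vv ε s t) = 0 := by
  refine ⟨?_, ?_, ?_, ?_⟩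
  · cases ε <;> simp [vv_true, vv_false]
  · unfold vv
    rw [A_form]; simp [A0, Matrix.mulVec, dotProduct, Fin.sum_univ_four]
  · unfold vv
    rw [QB_form]; simp [B0, smat, Matrix.mulVec, dotProduct, Fin.sum_univ_four]
  · unfold vv QB
    rw [conj_sq _ _ (LP_orth _ _ _), conj_form _ _ _ (LP_mul _ _ _)]
    simp [B0, smat, A0, Matrix.mulVec, dotProduct, Fin.sum_univ_four, Matrix.mul_apply]

lemma B0_inj {k : Type} [Field k] (h2 : (2 : k) ≠ 0) (c d e h a b c' d' e' h' a' b' : k)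
    (hc : c ≠ 0) (he : e ≠ 0) (hc' : c' ≠ 0) (he' : e' ≠ 0)
    (H : B0 c d e h a b = B0 c' d' e' h' a' b') :
    c = c' ∧ d = d' ∧ e = e' ∧ h = h' ∧ a = a' ∧ b = b' := by
  have f1 := fpol_B0 h2 c d e h a b hc he
  have f2 := fpol_B0 h2 c' d' e' h' a' b' hc' he'
  rw [H] at f1
  obtain ⟨e1, e2⟩ := fpol_coef _ _ _ _ (f1.symm.trans f2)
  have g1 := congrFun (congrFun H 0) 2
  have g2 := congrFun (congrFun H 0) 3
  have g3 := congrFun (congrFun H 1) 1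
  have g4 := congrFun (congrFun H 1) 3
  simp [B0, smat] at g1 g2 g3 g4
  exact ⟨g1, g2, g3, g4, e1, e2⟩

lemma Sg_Hm {k : Type} [Field k] (s t : k) : Hm t s * Sg = Sg * Hm s t := by
  ext i j
  fin_cases i <;> fin_cases j <;> simp [Sg, Hm, Matrix.mul_apply, Fin.sum_univ_four, mul_comm]

lemma QB_cross {k : Type} [Field k] (s t c d e h a b s' t' c' d' e' h' a' b' : k)
    (hc' : c' ≠ 0) (H : QB false s t c d e h a b = QB true s' t' c' d' e' h' a' b')
    (hv : vv false s t = vv true s' t') : False := by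
  rw [vv_false, vv_true] at hv
  have v1 := congrFun hv 1
  have v2 := congrFun hv 2
  simp at v1 v2
  subst v1 v2
  have e1 : LP true t s = Sg * LP false s t := by
    simp [LP, SS, Sg_Hm]
  have e2 : QB true t s c' d' e' h' a' b' =
      (LP false s t)ᵀ * (Sgᵀ * B0 c' d' e' h' a' b' * Sg) * LP false s t := by
    unfold QB
    rw [e1, Matrix.transpose_mul]
    simp only [Matrix.mul_assoc]
  rw [e2] at H
  have e3 := conj_inj _ _ _ _ (LP_mul _ _ _) H
  have e4 := congrFun (congrFun e3 0) 1
  simp [B0, smat, Sg, Matrix.mul_apply, Fin.sum_univ_four] at e4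
  exact hc' e4.symm

lemma QB_inj {k : Type} [Field k] (h2 : (2 : k) ≠ 0) (ε ε' : Bool)
    (s t c d e h a b s' t' c' d' e' h' a' b' : k)
    (hc : c ≠ 0) (he : e ≠ 0) (hc' : c' ≠ 0) (he' : e' ≠ 0)
    (H : QB ε s t c d e h a b = QB ε' s' t' c' d' e' h' a' b')
    (hv : vv ε s t = vv ε' s' t') :
    ε = ε' ∧ s = s' ∧ t = t' ∧ c = c' ∧ d = d' ∧ e = e' ∧ h = h' ∧ a = a' ∧ b = b' := by
  have hε : ε = ε' := by
    cases ε <;> cases ε'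
    · rfl
    · exact (QB_cross _ _ _ _ _ _ _ _ _ _ _ _ _ _ _ _ hc' H hv).elim
    · exact (QB_cross _ _ _ _ _ _ _ _ _ _ _ _ _ _ _ _ hc H.symm hv.symm).elim
    · rfl
  subst hε
  have hst : s = s' ∧ t = t' := by
    have v1 := congrFun hv 1
    have v2 := congrFun hv 2
    cases ε <;> simp [vv_false, vv_true] at v1 v2
    · exact ⟨v1, v2⟩
    · exact ⟨v2, v1⟩
  obtain ⟨rfl, rfl⟩ := hst
  unfold QB at H
  have := B0_inj h2 _ _ _ _ _ _ _ _ _ _ _ _ hc he hc' he' (conj_inj _ _ _ _ (LP_mul _ _ _) H)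
  exact ⟨rfl, rfl, rfl, this⟩

open Classical in
noncomputable def E2 (k : Type) [Field k] [Fintype k] : Finset (Σ _ : k, k) :=
  Finset.univ.sigma fun a => Finset.univ.filter fun b => 256 * b ^ 3 - 27 * a ^ 4 ≠ 0

lemma E2_card {k : Type} [Field k] [Fintype k] (h2 : (2 : k) ≠ 0) :
    Fintype.card k * (Fintype.card k - 3) ≤ (E2 k).card := by
  classical
  unfold E2
  rw [Finset.card_sigma, ← Finset.card_univ, ← smul_eq_mul]
  apply Finset.card_nsmul_le_sum
  intro a _
  have h256 : (256 : k) ≠ 0 := by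
    have : (256 : k) = 2 ^ 8 := by norm_num
    rw [this]; exact pow_ne_zero _ h2
  have h := cubic_count 256 (27 * a ^ 4) h256
  have h3 := Finset.card_filter_add_card_filter_not (s := (Finset.univ : Finset k))
    (fun b => 256 * b ^ 3 - 27 * a ^ 4 = 0)
  rw [Finset.card_univ] at *
  simp only [ne_eq]
  omega

open Classical in
noncomputable def QQ (k : Type) [Field k] [Fintype k] :
    Finset ((Bool × k × k × k × k) × (k × k × (Σ _ : k, k))) :=
  Finset.univ ×ˢ (Finset.univ.erase 0 ×ˢ (Finset.univ.erase 0 ×ˢ E2 k))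

lemma QQ_card {k : Type} [Field k] [Fintype k] (h2 : (2 : k) ≠ 0) :
    2 * Fintype.card k ^ 4 * ((Fintype.card k - 1) * ((Fintype.card k - 1) *
      (Fintype.card k * (Fintype.card k - 3)))) ≤ (QQ k).card := by
  classical
  have h : (QQ k).card = 2 * Fintype.card k ^ 4 * ((Fintype.card k - 1) *
      ((Fintype.card k - 1) * (E2 k).card)) := by
    unfold QQ
    rw [Finset.card_product, Finset.card_product, Finset.card_product,
      Finset.card_erase_of_mem (Finset.mem_univ _), Finset.card_univ, Finset.card_univ]
    simp only [Fintype.card_prod, Fintype.card_bool]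
    ring
  rw [h]
  exact Nat.mul_le_mul_left _ (Nat.mul_le_mul_left _ (Nat.mul_le_mul_left _ (E2_card h2)))

open Classical in
noncomputable def DS (k : Type) [Field k] [Fintype k] : Finset (Matrix (Fin 4) (Fin 4) k) :=
  Finset.univ.filter (fun B => B.IsSymm ∧ (∃ a b : k, 256 * b ^ 3 - 27 * a ^ 4 ≠ 0 ∧
    fpol B = Polynomial.X ^ 4 + Polynomial.C a * Polynomial.X + Polynomial.C b) ∧ Distg B)

def FQ {k : Type} [Field k] (w : (Bool × k × k × k × k) × (k × k × (Σ _ : k, k))) :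
    Matrix (Fin 4) (Fin 4) k :=
  QB w.1.1 w.1.2.1 w.1.2.2.1 w.2.1 w.1.2.2.2.1 w.2.2.1 w.1.2.2.2.2 w.2.2.2.1 w.2.2.2.2

lemma QQ_mem {k : Type} [Field k] [Fintype k] (ε : Bool) (s t d h c e a b : k)
    (H : (⟨⟨ε, s, t, d, h⟩, c, e, a, b⟩ :
      (Bool × k × k × k × k) × (k × k × (Σ _ : k, k))) ∈ QQ k) :
    c ≠ 0 ∧ e ≠ 0 ∧ 256 * b ^ 3 - 27 * a ^ 4 ≠ 0 := by
  classical
  simp only [QQ, E2, Finset.mem_product, Finset.mem_sigma, Finset.mem_univ, true_and,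
    Finset.mem_erase, and_true, Finset.mem_filter] at H
  exact H

lemma dist_card {k : Type} [Field k] [Fintype k] (h2 : (2 : k) ≠ 0) :
    (QQ k).card ≤ 8 * (DS k).card := by
  classical
  apply Finset.card_le_mul_card_image_of_maps_to (f := FQ)
  · rintro ⟨⟨ε, s, t, d, h⟩, c, e, a, b⟩ H
    obtain ⟨hc, he, hd⟩ := QQ_mem _ _ _ _ _ _ _ _ _ H
    simp only [DS, Finset.mem_filter, Finset.mem_univ, true_and, FQ]
    exact ⟨QB_symm _ _ _ _ _ _ _ _ _, ⟨_, _, hd, QB_fpol h2 _ _ _ _ _ _ _ _ _ hc he⟩,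
      QB_dist _ _ _ _ _ _ _ _ _⟩
  · intro B hB
    simp only [DS, Finset.mem_filter, Finset.mem_univ, true_and] at hB
    obtain ⟨hsym, ⟨a0, b0, hd0, hf0⟩, -⟩ := hB
    rw [← Finset.card_image_of_injOn (f := fun w => vv w.1.1 w.1.2.1 w.1.2.2.1)]
    · apply lines8 B hsym a0 b0 hd0 hf0
      intro v hv
      rw [Finset.mem_image] at hv
      obtain ⟨⟨⟨ε, s, t, d, h⟩, c, e, a, b⟩, hw, rfl⟩ := hv
      rw [Finset.mem_filter] at hw
      obtain ⟨-, hw⟩ := hw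
      rw [← hw]
      exact vv_props _ _ _ _ _ _ _ _ _
    · rintro ⟨⟨ε, s, t, d, h⟩, c, e, a, b⟩ H ⟨⟨ε', s', t', d', h'⟩, c', e', a', b'⟩ H' heq
      simp only [Finset.coe_filter, Set.mem_ofPred_eq] at H H'
      obtain ⟨H, hB⟩ := H
      obtain ⟨H', hB'⟩ := H'
      obtain ⟨hc, he, hd⟩ := QQ_mem _ _ _ _ _ _ _ _ _ H
      obtain ⟨hc', he', hd'⟩ := QQ_mem _ _ _ _ _ _ _ _ _ H'
      have E := hB.trans hB'.symm
      simp only [FQ] at E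
      obtain ⟨rfl, rfl, rfl, rfl, rfl, rfl, rfl, rfl, rfl⟩ :=
        QB_inj h2 _ _ _ _ _ _ _ _ _ _ _ _ _ _ _ _ _ _ hc he hc' he' E heq
      rfl

lemma coef_cond {k : Type} [Field k] (h2 : (2 : k) ≠ 0) (B : Matrix (Fin 4) (Fin 4) k)
    (hB : B.IsSymm) (a b : k)
    (hf : fpol B = Polynomial.X ^ 4 + Polynomial.C a * Polynomial.X + Polynomial.C b) :
    B 1 2 = - B 0 3 ∧ 2 * B 0 3 ^ 2 + B 0 0 * B 3 3 + B 1 1 * B 2 2 + 2 * B 0 1 * B 2 3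
      + 2 * B 0 2 * B 1 3 = 0 := by
  rw [eq_smat B hB, fpol_smat] at hf
  have f3 := congrArg (fun q => Polynomial.coeff q 3) hf
  have f2 := congrArg (fun q => Polynomial.coeff q 2) hf
  simp only [Polynomial.coeff_add, Polynomial.coeff_C_mul, Polynomial.coeff_X_pow,
    Polynomial.coeff_X, Polynomial.coeff_C] at f3 f2
  norm_num at f3 f2
  have h1 : B 1 2 = - B 0 3 := by
    rcases f3 with h | h
    · exact absurd h h2
    · linear_combination h
  refine ⟨h1, ?_⟩
  rw [h1] at f2
  linear_combination -f2

open Classical in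
noncomputable def AS (k : Type) [Field k] [Fintype k] : Finset (Matrix (Fin 4) (Fin 4) k) :=
  Finset.univ.filter (fun B => B.IsSymm ∧ (∃ a b : k,
    fpol B = Polynomial.X ^ 4 + Polynomial.C a * Polynomial.X + Polynomial.C b))

lemma AS_card {k : Type} [Field k] [Fintype k] (h2 : (2 : k) ≠ 0) :
    (AS k).card ≤ Fintype.card k ^ 8 + 2 * Fintype.card k ^ 7 := by
  classical
  rw [← Finset.card_filter_add_card_filter_not (fun B => B 0 0 ≠ 0)]
  apply add_le_add
  · have e : Fintype.card k ^ 8 =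
        (Finset.univ : Finset (k × k × k × k × k × k × k × k)).card := by
      rw [Finset.card_univ]
      simp only [Fintype.card_prod]
      ring
    rw [e]
    apply Finset.card_le_card_of_injOn
      (fun B => (B 0 0, B 0 1, B 0 2, B 0 3, B 1 1, B 1 3, B 2 2, B 2 3))
    · intro B _
      simp
    · intro B hB B' hB' heq
      simp only [Finset.coe_filter, Set.mem_ofPred_eq, AS, Finset.mem_filter, Finset.mem_univ,
        true_and] at hB hB'
      obtain ⟨⟨hs, a, b, hf⟩, h0⟩ := hB
      obtain ⟨⟨hs', a', b', hf'⟩, h0'⟩ := hB'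
      obtain ⟨c1, c2⟩ := coef_cond h2 B hs a b hf
      obtain ⟨c1', c2'⟩ := coef_cond h2 B' hs' a' b' hf'
      simp only [Prod.mk.injEq] at heq
      obtain ⟨e1, e2, e3, e4, e5, e6, e7, e8⟩ := heq
      have e9 : B 1 2 = B' 1 2 := by rw [c1, c1', e4]
      have e10 : B 3 3 = B' 3 3 := by
        apply mul_left_cancel₀ h0
        rw [e1, e2, e3, e4, e5, e6, e7, e8] at c2
        rw [e1]
        linear_combination c2 - c2'
      rw [eq_smat B hs, eq_smat B' hs', e1, e2, e3, e4, e5, e6, e7, e8, e9, e10]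
  · have e : Fintype.card k ^ 7 =
        (Finset.univ : Finset (k × k × k × k × k × k × k)).card := by
      rw [Finset.card_univ]
      simp only [Fintype.card_prod]
      ring
    rw [e]
    apply Finset.card_le_mul_card_image_of_maps_to
      (f := fun B => (B 0 1, B 0 2, B 1 1, B 1 3, B 2 2, B 2 3, B 3 3))
    · intro B _
      simp
    · rintro ⟨x1, x2, x3, x4, x5, x6, x7⟩ _
      refine le_trans (Finset.card_le_card_of_injOn (fun B => B 0 3)
        (t := Finset.univ.filter (fun x : k => 2 * x ^ 2 + 0 * x +
          (x3 * x5 + 2 * x1 * x6 + 2 * x2 * x4) = 0)) ?_ ?_) (quad_count 2 0 _ h2)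
      · intro B hB
        simp only [Finset.coe_filter, Set.mem_ofPred_eq, AS, Finset.mem_filter, Finset.mem_univ,
          true_and, Prod.mk.injEq, ne_eq, not_not] at hB ⊢
        obtain ⟨⟨⟨hs, a, b, hf⟩, h0⟩, e1, e2, e3, e4, e5, e6, e7⟩ := hB
        obtain ⟨c1, c2⟩ := coef_cond h2 B hs a b hf
        rw [h0, e1, e2, e3, e4, e5, e6, e7] at c2
        linear_combination c2
      · intro B hB B' hB' heq
        simp only [Finset.coe_filter, Set.mem_ofPred_eq, AS, Finset.mem_filter, Finset.mem_univ,
          true_and, Prod.mk.injEq, ne_eq, not_not] at hB hB'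
        obtain ⟨⟨⟨hs, a, b, hf⟩, h0⟩, e1, e2, e3, e4, e5, e6, e7⟩ := hB
        obtain ⟨⟨⟨hs', a', b', hf'⟩, h0'⟩, e1', e2', e3', e4', e5', e6', e7'⟩ := hB'
        obtain ⟨c1, c2⟩ := coef_cond h2 B hs a b hf
        obtain ⟨c1', c2'⟩ := coef_cond h2 B' hs' a' b' hf'
        have heq' : B 0 3 = B' 0 3 := heq
        rw [eq_smat B hs, eq_smat B' hs', c1, c1', heq', h0, h0', e1, e2, e3, e4, e5, e6, e7,
          e1', e2', e3', e4', e5', e6', e7']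

lemma upper_card {k : Type} [Field k] [Fintype k] (h2 : (2 : k) ≠ 0) :
    (ND k).card + (DS k).card ≤ (AS k).card := by
  classical
  rw [← Finset.card_union_of_disjoint]
  · apply Finset.card_le_card
    intro B hB
    simp only [ND, DS, AS, Finset.mem_union, Finset.mem_filter, Finset.mem_univ, true_and] at hB ⊢
    rcases hB with ⟨h1, ⟨a, b, -, h⟩, -⟩ | ⟨h1, ⟨a, b, -, h⟩, -⟩
    · exact ⟨h1, a, b, h⟩
    · exact ⟨h1, a, b, h⟩
  · rw [Finset.disjoint_left]
    intro B h1 h2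
    simp only [ND, DS, Finset.mem_filter, Finset.mem_univ, true_and] at h1 h2
    exact h1.2.2 h2.2.2

lemma ND_mem {k : Type} [Field k] [Fintype k] (B : Matrix (Fin 4) (Fin 4) k) :
    B ∈ ND k ↔ B.IsSymm ∧ (∃ a b : k, 256 * b ^ 3 - 27 * a ^ 4 ≠ 0 ∧
    fpol B = Polynomial.X ^ 4 + Polynomial.C a * Polynomial.X + Polynomial.C b) ∧ ¬ Distg B := by
  simp only [ND, Finset.mem_filter, Finset.mem_univ, true_and]

lemma final_bounds (p : ℕ) [Fact p.Prime] (hp : 7 ≤ p) :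
    ((p : ℝ) ^ 8 / 16 - 4 * (p : ℝ) ^ 7 ≤ ((ND (ZMod p)).card : ℝ)) ∧
    (((ND (ZMod p)).card : ℝ) ≤ (3 / 4) * (p : ℝ) ^ 8 + 4 * (p : ℝ) ^ 7) := by
  have hs : ∀ m : ℕ, 0 < m → m < 7 → ((m : ℕ) : ZMod p) ≠ 0 := by
    intro m h0 h7 h
    rw [ZMod.natCast_eq_zero_iff] at h
    have := Nat.le_of_dvd h0 h
    omega
  have h2 : (2 : ZMod p) ≠ 0 := by exact_mod_cast hs 2 (by norm_num) (by norm_num)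
  have h3 : (3 : ZMod p) ≠ 0 := by exact_mod_cast hs 3 (by norm_num) (by norm_num)
  have a1 := PP_card h2 h3
  have a2 := lower_card h2
  have b1 := QQ_card h2
  have b2 := dist_card h2
  have b3 := AS_card h2
  have b4 := upper_card h2
  rw [ZMod.card] at a1 b1 b3
  have hq : (7 : ℝ) ≤ p := by exact_mod_cast hp
  have c7 : ((p - 7 : ℕ) : ℝ) = (p : ℝ) - 7 := by rw [Nat.cast_sub hp]; norm_num
  have c3 : ((p - 3 : ℕ) : ℝ) = (p : ℝ) - 3 := by rw [Nat.cast_sub (by omega)]; norm_num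
  have c1 : ((p - 1 : ℕ) : ℝ) = (p : ℝ) - 1 := by rw [Nat.cast_sub (by omega)]; norm_num
  have a1' : (p : ℝ) * (((p : ℝ) - 7) * ((p : ℝ) - 3)) * (((p : ℝ) - 1) * (((p : ℝ) - 1) *
      (p : ℝ) ^ 3)) ≤ 2 * ((PP (ZMod p)).card : ℝ) := by
    rw [← c7, ← c3, ← c1]; exact_mod_cast a1
  have a2' : ((PP (ZMod p)).card : ℝ) ≤ 8 * ((ND (ZMod p)).card : ℝ) := by exact_mod_cast a2
  have b1' : 2 * (p : ℝ) ^ 4 * (((p : ℝ) - 1) * (((p : ℝ) - 1) * ((p : ℝ) * ((p : ℝ) - 3)))) ≤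
      ((QQ (ZMod p)).card : ℝ) := by
    rw [← c3, ← c1]; exact_mod_cast b1
  have b2' : ((QQ (ZMod p)).card : ℝ) ≤ 8 * ((DS (ZMod p)).card : ℝ) := by exact_mod_cast b2
  have b3' : ((AS (ZMod p)).card : ℝ) ≤ (p : ℝ) ^ 8 + 2 * (p : ℝ) ^ 7 := by exact_mod_cast b3
  have b4' : ((ND (ZMod p)).card : ℝ) + ((DS (ZMod p)).card : ℝ) ≤ ((AS (ZMod p)).card : ℝ) := by
    exact_mod_cast b4
  generalize ((ND (ZMod p)).card : ℝ) = N at *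
  generalize ((PP (ZMod p)).card : ℝ) = P at *
  generalize ((QQ (ZMod p)).card : ℝ) = Q at *
  generalize ((DS (ZMod p)).card : ℝ) = D at *
  generalize ((AS (ZMod p)).card : ℝ) = A at *
  generalize (p : ℝ) = q at *
  have h7 : 0 ≤ q ^ 7 := by positivity
  constructor
  · have k1 : 0 ≤ q ^ 4 * (42 * q ^ 2 - 52 * q + 21) := by
      apply mul_nonneg (by positivity)
      nlinarith
    nlinarith
  · have k1 : 0 ≤ q ^ 5 * (7 * q - 3) := by
      apply mul_nonneg (by positivity)
      linarith
    nlinarith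

/-- **Proposition 2.3**: for p ≥ 7, the number d_p of symmetric 4×4 matrices B over 𝔽_p
with invariant polynomial of the form x⁴+ax+b of nonzero discriminant that are not
𝔽_p-distinguished satisfies p⁸/16 + O(p⁷) ≤ d_p ≤ (3/4)p⁸ + O(p⁷). -/
theorem stmt_7 :
    ∃ c : ℝ, 0 < c ∧ ∀ p : ℕ, p.Prime → 7 ≤ p →
      ((p : ℝ) ^ 8 / 16 - c * (p : ℝ) ^ 7 ≤
        (Nat.card {B : Matrix (Fin 4) (Fin 4) (ZMod p) // B.IsSymm ∧
          (∃ a b : ZMod p, 256 * b ^ 3 - 27 * a ^ 4 ≠ 0 ∧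
            Matrix.det ((Polynomial.X : Polynomial (ZMod p)) •
                ((A0 (ZMod p)).map Polynomial.C) - B.map Polynomial.C) =
              Polynomial.X ^ 4 + Polynomial.C a * Polynomial.X + Polynomial.C b) ∧
          ¬ ∃ v w : Fin 4 → ZMod p, LinearIndependent (ZMod p) ![v, w] ∧
            v ⬝ᵥ (A0 (ZMod p)).mulVec v = 0 ∧ v ⬝ᵥ B.mulVec v = 0 ∧
            w ⬝ᵥ (A0 (ZMod p)).mulVec w = 0 ∧ v ⬝ᵥ (A0 (ZMod p)).mulVec w = 0 ∧
            v ⬝ᵥ B.mulVec w = 0} : ℝ)) ∧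
      ((Nat.card {B : Matrix (Fin 4) (Fin 4) (ZMod p) // B.IsSymm ∧
          (∃ a b : ZMod p, 256 * b ^ 3 - 27 * a ^ 4 ≠ 0 ∧
            Matrix.det ((Polynomial.X : Polynomial (ZMod p)) •
                ((A0 (ZMod p)).map Polynomial.C) - B.map Polynomial.C) =
              Polynomial.X ^ 4 + Polynomial.C a * Polynomial.X + Polynomial.C b) ∧
          ¬ ∃ v w : Fin 4 → ZMod p, LinearIndependent (ZMod p) ![v, w] ∧
            v ⬝ᵥ (A0 (ZMod p)).mulVec v = 0 ∧ v ⬝ᵥ B.mulVec v = 0 ∧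
            w ⬝ᵥ (A0 (ZMod p)).mulVec w = 0 ∧ v ⬝ᵥ (A0 (ZMod p)).mulVec w = 0 ∧
            v ⬝ᵥ B.mulVec w = 0} : ℝ) ≤ (3 / 4) * (p : ℝ) ^ 8 + c * (p : ℝ) ^ 7) := by
  refine ⟨4, by norm_num, ?_⟩
  intro p hp h7
  haveI : Fact p.Prime := ⟨hp⟩
  have key := final_bounds p h7
  have e : ∀ Q : Matrix (Fin 4) (Fin 4) (ZMod p) → Prop,
      (∀ B, Q B ↔ B ∈ ND (ZMod p)) → Nat.card {B // Q B} = (ND (ZMod p)).card := by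
    intro Q hQ
    rw [Nat.card_congr (Equiv.subtypeEquivRight hQ)]
    simp
  have hQ := e _ (fun B => (by
    exact (ND_mem B).symm : (B.IsSymm ∧
          (∃ a b : ZMod p, 256 * b ^ 3 - 27 * a ^ 4 ≠ 0 ∧
            Matrix.det ((Polynomial.X : Polynomial (ZMod p)) •
                ((A0 (ZMod p)).map Polynomial.C) - B.map Polynomial.C) =
              Polynomial.X ^ 4 + Polynomial.C a * Polynomial.X + Polynomial.C b) ∧
          ¬ ∃ v w : Fin 4 → ZMod p, LinearIndependent (ZMod p) ![v, w] ∧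
            v ⬝ᵥ (A0 (ZMod p)).mulVec v = 0 ∧ v ⬝ᵥ B.mulVec v = 0 ∧
            w ⬝ᵥ (A0 (ZMod p)).mulVec w = 0 ∧ v ⬝ᵥ (A0 (ZMod p)).mulVec w = 0 ∧
            v ⬝ᵥ B.mulVec w = 0) ↔ B ∈ ND (ZMod p)))
  rw [hQ]
  exact key
end

section
/- Let Δ(a,b) = 256b³ − 27a⁴. For a prime p, say p² weakly divides Δ(a,b) if p² ∣ Δ(a,b) and there exist integers a' ≡ a (mod p), b' ≡ b (mod p) with p² ∤ Δ(a',b'). Let m be a squarefree positive integer and (a,b) ∈ ℤ² be such that for every prime p ∣ m, p² weakly divides Δ(a,b). Then there exists a symmetric 4×4 matrix B with entries in (1/4)ℤ such that the (1,1)- and (1,2)-entries of B are 0, the (1,3)-entry of B equals m, and det(A₀x − B) = x⁴ + ax + b, where A₀ is the 4×4 matrix with 1's on the anti-diagonal and 0's elsewhere. -/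
open Matrix

theorem lift_weak_coprime (p : ℕ) (hp : p.Prime) (a b a' b' : ℤ)
    (h : (p : ℤ) ^ 2 ∣ 256 * b ^ 3 - 27 * a ^ 4) (ha : a' ≡ a [ZMOD p]) (hb : b' ≡ b [ZMOD p])
    (hn : ¬ ((p : ℤ) ^ 2 ∣ 256 * b' ^ 3 - 27 * a' ^ 4)) : ¬ (p : ℤ) ∣ 3 * a := by
  intro hd
  have hpp : Prime (p : ℤ) := Nat.prime_iff_prime_int.mp hp
  have hp1 : (p : ℤ) ∣ 256 * b ^ 3 - 27 * a ^ 4 := dvd_trans (dvd_pow_self _ two_ne_zero) h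
  have h27 : (p : ℤ) ∣ 27 * a ^ 4 := by
    have : 27 * a ^ 4 = (3 * a) * (9 * a ^ 3) := by ring
    rw [this]; exact Dvd.dvd.mul_right hd _
  have h256 : (p : ℤ) ∣ 256 * b ^ 3 := by
    have := dvd_add hp1 h27
    simpa using this
  -- divisibility by p of b', or p = 2
  have key : (p : ℤ) ^ 2 ∣ 256 * b' ^ 3 := by
    rcases hpp.dvd_or_dvd h256 with h2 | h2
    · have h2' : (p : ℤ) ∣ 2 := hpp.dvd_of_dvd_pow (n := 8) (by norm_num; exact h2)
      have := pow_dvd_pow_of_dvd h2' 2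
      exact Dvd.dvd.mul_right (this.trans (by norm_num)) _
    · have hbb : (p : ℤ) ∣ b := hpp.dvd_of_dvd_pow h2
      have hb' : (p : ℤ) ∣ b' := (Int.ModEq.dvd_iff hb).mpr hbb
      have := pow_dvd_pow_of_dvd hb' 2
      exact Dvd.dvd.mul_left (this.trans (pow_dvd_pow _ (by norm_num))) _
  have key2 : (p : ℤ) ^ 2 ∣ 27 * a' ^ 4 := by
    rcases hpp.dvd_or_dvd hd with h3 | h3
    · have := pow_dvd_pow_of_dvd h3 2
      exact Dvd.dvd.mul_right (this.trans (by norm_num)) _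
    · have ha' : (p : ℤ) ∣ a' := (Int.ModEq.dvd_iff ha).mpr h3
      have := pow_dvd_pow_of_dvd ha' 2
      exact Dvd.dvd.mul_left (this.trans (pow_dvd_pow _ (by norm_num))) _
  exact hn (dvd_sub key key2)

theorem lift_sq_dvd (m : ℕ) (hm : Squarefree m) (D : ℤ)
    (h : ∀ p : ℕ, p.Prime → p ∣ m → (p : ℤ) ^ 2 ∣ D) : (m : ℤ) ^ 2 ∣ D := by
  rw [← Int.natAbs_dvd_natAbs, Int.natAbs_pow, Int.natAbs_natCast]
  rw [← Nat.prod_primeFactors_of_squarefree hm, ← Finset.prod_pow]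
  apply Finset.prod_dvd_of_isRelPrime
  · intro p hp q hq hpq
    simp only [Finset.mem_coe, Nat.mem_primeFactors] at hp hq
    exact Nat.coprime_iff_isRelPrime.mp (((Nat.coprime_primes hp.1 hq.1).mpr hpq).pow 2 2)
  · intro p hp
    have hp := Nat.mem_primeFactors.mp hp
    have := h p hp.1 hp.2.1
    rw [← Int.natAbs_dvd_natAbs, Int.natAbs_pow, Int.natAbs_natCast] at this
    exact this

/-- **Theorem 2.4 (existence of the lift σ_m)**: if m is squarefree and p² weakly divides
Δ(a,b) = 256b³-27a⁴ for every prime p ∣ m, then there is a symmetric 4×4 matrix B with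
entries in (1/4)ℤ, with (1,1)- and (1,2)-entries 0 and (1,3)-entry m, such that
det(A₀x - B) = x⁴ + ax + b. -/
theorem stmt_8 (m : ℕ) (hm : Squarefree m) (hmpos : 0 < m) (a b : ℤ)
    (hweak : ∀ p : ℕ, p.Prime → p ∣ m →
      ((p : ℤ) ^ 2 ∣ 256 * b ^ 3 - 27 * a ^ 4 ∧
        ∃ a' b' : ℤ, a' ≡ a [ZMOD p] ∧ b' ≡ b [ZMOD p] ∧
          ¬ ((p : ℤ) ^ 2 ∣ 256 * b' ^ 3 - 27 * a' ^ 4))) :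
    ∃ B : Matrix (Fin 4) (Fin 4) ℚ, B.IsSymm ∧
      (∀ i j, ∃ n : ℤ, B i j = (n : ℚ) / 4) ∧
      B 0 0 = 0 ∧ B 0 1 = 0 ∧ B 0 2 = (m : ℚ) ∧
      Matrix.det ((Polynomial.X : Polynomial ℚ) • ((A0 ℚ).map Polynomial.C) -
          B.map Polynomial.C) =
        Polynomial.X ^ 4 + Polynomial.C (a : ℚ) * Polynomial.X + Polynomial.C (b : ℚ) := by
  have hD : (m : ℤ) ^ 2 ∣ 256 * b ^ 3 - 27 * a ^ 4 :=
    lift_sq_dvd m hm _ fun p hp hpm => (hweak p hp hpm).1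
  have hcop : IsCoprime (3 * a) ((m : ℤ) ^ 2) := by
    apply IsCoprime.pow_right
    rw [Int.isCoprime_iff_gcd_eq_one]
    apply Nat.Coprime.gcd_eq_one
    apply Nat.coprime_of_dvd
    intro p hp h1 h2
    rw [Int.natAbs_natCast] at h2
    obtain ⟨h, a', b', ha, hb, hn⟩ := hweak p hp h2
    exact lift_weak_coprime p hp a b a' b' h ha hb hn (Int.natCast_dvd.mpr h1)
  obtain ⟨s, t, hst⟩ := hcop
  obtain ⟨D, hD⟩ := hD
  -- the double root modulo m²
  obtain ⟨r, hr⟩ : ∃ r, r = -4 * b * s := ⟨_, rfl⟩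
  have hr3 : 3 * a * r = -4 * b + (m : ℤ) ^ 2 * (4 * b * t) := by
    rw [hr]; linear_combination (-4 * b) * hst
  obtain ⟨w, hw⟩ : ∃ w, w = 4 * b * t := ⟨_, rfl⟩
  rw [← hw] at hr3
  have hcop : IsCoprime ((m : ℤ) ^ 2) (3 * a) := ⟨t, s, by linarith⟩
  have hr3' : 3 * a * r ≡ -4 * b [ZMOD (m : ℤ) ^ 2] :=
    (Int.modEq_iff_dvd.mpr ⟨-w, by rw [hr3]; ring⟩)
  have hD' : 256 * b ^ 3 - 27 * a ^ 4 ≡ 0 [ZMOD (m : ℤ) ^ 2] :=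
    Int.modEq_zero_iff_dvd.mpr ⟨D, hD⟩
  have h1 : (m : ℤ) ^ 2 ∣ 4 * r ^ 3 + a := by
    apply (hcop.pow_right (n := 3)).dvd_of_dvd_mul_left
    rw [← Int.modEq_zero_iff_dvd]
    calc (3 * a) ^ 3 * (4 * r ^ 3 + a) = 4 * (3 * a * r) ^ 3 + 27 * a ^ 4 := by ring
      _ ≡ 4 * (-4 * b) ^ 3 + 27 * a ^ 4 [ZMOD (m : ℤ) ^ 2] :=
        ((hr3'.pow 3).mul_left 4).add_right _
      _ = (-1) * (256 * b ^ 3 - 27 * a ^ 4) := by ring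
      _ ≡ (-1) * 0 [ZMOD (m : ℤ) ^ 2] := hD'.mul_left _
      _ = 0 := by ring
  have h0 : (m : ℤ) ^ 2 ∣ r ^ 4 + a * r + b := by
    apply (hcop.pow_right (n := 4)).dvd_of_dvd_mul_left
    rw [← Int.modEq_zero_iff_dvd]
    calc (3 * a) ^ 4 * (r ^ 4 + a * r + b)
        = (3 * a * r) ^ 4 + 27 * a ^ 4 * (3 * a * r) + 81 * a ^ 4 * b := by ring
      _ ≡ (-4 * b) ^ 4 + 27 * a ^ 4 * (-4 * b) + 81 * a ^ 4 * b [ZMOD (m : ℤ) ^ 2] :=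
        ((hr3'.pow 4).add (hr3'.mul_left _)).add_right _
      _ = b * (256 * b ^ 3 - 27 * a ^ 4) := by ring
      _ ≡ b * 0 [ZMOD (m : ℤ) ^ 2] := hD'.mul_left _
      _ = 0 := by ring
  obtain ⟨u, hu⟩ := h0
  obtain ⟨v, hv⟩ := (dvd_pow_self (m : ℤ) two_ne_zero).trans h1
  have ha : (a : ℚ) = m * v - 4 * r ^ 3 := by
    have : a = m * v - 4 * r ^ 3 := by linarith
    rw [this]; push_cast; ring
  have hb : (b : ℚ) = m ^ 2 * u - r ^ 4 - a * r := by
    have : b = m ^ 2 * u - r ^ 4 - a * r := by linarith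
    exact_mod_cast this
  rw [ha] at hb
  obtain ⟨z, hz⟩ : ∃ z : ℚ, z = -(v : ℚ) / 2 := ⟨_, rfl⟩
  have hvz : (v : ℚ) = -2 * z := by rw [hz]; ring
  refine ⟨!![0, 0, (m : ℚ), (r : ℚ); 0, 1, -(r : ℚ), 0;
    (m : ℚ), -(r : ℚ), -2 * (r : ℚ) ^ 2, z; (r : ℚ), 0, z, -(u : ℚ)], ?_, ?_, ?_, ?_, ?_, ?_⟩
  · ext i j
    fin_cases i <;> fin_cases j <;> rfl
  · have e0 : ∃ n : ℤ, (0 : ℚ) = (n : ℚ) / 4 := ⟨0, by norm_num⟩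
    have e1 : ∃ n : ℤ, (1 : ℚ) = (n : ℚ) / 4 := ⟨4, by norm_num⟩
    have em : ∃ n : ℤ, (m : ℚ) = (n : ℚ) / 4 := ⟨4 * m, by push_cast; ring⟩
    have er : ∃ n : ℤ, (r : ℚ) = (n : ℚ) / 4 := ⟨4 * r, by push_cast; ring⟩
    have er' : ∃ n : ℤ, -(r : ℚ) = (n : ℚ) / 4 := ⟨-4 * r, by push_cast; ring⟩
    have err : ∃ n : ℤ, -2 * (r : ℚ) ^ 2 = (n : ℚ) / 4 := ⟨-8 * r ^ 2, by push_cast; ring⟩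
    have ez : ∃ n : ℤ, z = (n : ℚ) / 4 := ⟨-2 * v, by rw [hz]; push_cast; ring⟩
    have eu : ∃ n : ℤ, -(u : ℚ) = (n : ℚ) / 4 := ⟨-4 * u, by push_cast; ring⟩
    intro i j
    fin_cases i <;> fin_cases j <;> assumption
  · rfl
  · rfl
  · rfl
  · rw [hb, ha, hvz]
    simp [A0, Matrix.det_succ_row_zero, Fin.sum_univ_succ, Fin.succAbove]
    have h2 : (Polynomial.C (2 : ℚ)) = 2 := rfl
    have h4 : (Polynomial.C (4 : ℚ)) = 4 := rfl
    try simp only [h2, h4]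
    ring
end

section
/- Let Δ(a,b) = 256b³ − 27a⁴, which is the discriminant of f(x) = x⁴ + ax + b. Let p be a prime and (a,b) ∈ ℤ² be such that p² weakly divides Δ(a,b), i.e., p² ∣ Δ(a,b) and there exist integers a' ≡ a (mod p), b' ≡ b (mod p) with p² ∤ Δ(a',b'). Suppose r is an integer such that, writing f(x + r) = x⁴ + b₁x³ + b₂x² + b₃x + b₄, one has p ∣ b₃ and p ∣ b₄. Then p² ∣ b₄. -/
/-- Modulo `p²`, the discriminant is `6912 r⁸ b₄` whenever `p ∣ b₃` and `p ∣ b₄`. -/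
theorem disc_congr (p r a b : ℤ) (h3 : p ∣ 4 * r ^ 3 + a) (h4 : p ∣ r ^ 4 + a * r + b) :
    p ^ 2 ∣ 256 * b ^ 3 - 27 * a ^ 4 - 6912 * r ^ 8 * (r ^ 4 + a * r + b) := by
  obtain ⟨u, hu⟩ := h3
  obtain ⟨v, hv⟩ := h4
  obtain rfl : a = p * u - 4 * r ^ 3 := by linarith
  obtain rfl : b = p * (v - r * u) + 3 * r ^ 4 := by linear_combination hv
  refine ⟨256 * (p * (v - r * u) ^ 3 + 9 * r ^ 4 * (v - r * u) ^ 2)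
    - 27 * (p ^ 2 * u ^ 4 - 16 * r ^ 3 * p * u ^ 3 + 96 * r ^ 6 * u ^ 2), ?_⟩
  ring

/-- **Weak divisibility forces p² ∣ b₄** (claim in §2.2): if p² weakly divides
Δ(a,b) = 256b³-27a⁴ and r is an integer with f(x+r) = x⁴+b₁x³+b₂x²+b₃x+b₄ where
p ∣ b₃ and p ∣ b₄, then p² ∣ b₄. -/
theorem stmt_9 (p : ℕ) (hp : p.Prime) (a b : ℤ)
    (hdvd : (p : ℤ) ^ 2 ∣ 256 * b ^ 3 - 27 * a ^ 4)
    (hweak : ∃ a' b' : ℤ, a' ≡ a [ZMOD p] ∧ b' ≡ b [ZMOD p] ∧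
      ¬ ((p : ℤ) ^ 2 ∣ 256 * b' ^ 3 - 27 * a' ^ 4))
    (r b1 b2 b3 b4 : ℤ)
    (hcomp : ((Polynomial.X : Polynomial ℤ) + Polynomial.C r) ^ 4 +
        Polynomial.C a * ((Polynomial.X : Polynomial ℤ) + Polynomial.C r) +
        Polynomial.C b =
      Polynomial.X ^ 4 + Polynomial.C b1 * Polynomial.X ^ 3 +
        Polynomial.C b2 * Polynomial.X ^ 2 + Polynomial.C b3 * Polynomial.X +
        Polynomial.C b4)
    (h3 : (p : ℤ) ∣ b3) (h4 : (p : ℤ) ∣ b4) :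
    (p : ℤ) ^ 2 ∣ b4 := by
  have e3 : 4 * r ^ 3 + a = b3 := by
    have h := congrArg (fun q => (Polynomial.derivative q).eval 0) hcomp
    simp [Polynomial.derivative_pow] at h
    linarith
  have e4 : r ^ 4 + a * r + b = b4 := by
    have h := congrArg (Polynomial.eval 0) hcomp
    simpa using h
  have hpi : Prime (p : ℤ) := Nat.prime_iff_prime_int.mp hp
  subst e3 e4
  have key := disc_congr p r a b h3 h4
  have hd : (p : ℤ) ^ 2 ∣ 6912 * r ^ 8 * (r ^ 4 + a * r + b) := by
    have := dvd_sub hdvd key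
    simpa using this
  by_cases hc : (p : ℤ) ∣ 6912 * r ^ 8
  · exfalso
    obtain ⟨a', b', ha, hb, hn⟩ := hweak
    obtain ⟨k, hk⟩ := ha.symm.dvd
    obtain ⟨l, hl⟩ := hb.symm.dvd
    obtain rfl : a' = a + p * k := by linarith
    obtain rfl : b' = b + p * l := by linarith
    have h3' : (p : ℤ) ∣ 4 * r ^ 3 + (a + p * k) := by
      rw [← add_assoc]
      exact dvd_add h3 (dvd_mul_right _ _)
    have h4' : (p : ℤ) ∣ r ^ 4 + (a + p * k) * r + (b + p * l) := by
      have := dvd_add h4 (dvd_mul_right (p : ℤ) (k * r + l))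
      have e : r ^ 4 + (a + p * k) * r + (b + p * l)
          = r ^ 4 + a * r + b + p * (k * r + l) := by ring
      rw [e]
      exact this
    have key' := disc_congr p r _ _ h3' h4'
    have h2 := mul_dvd_mul hc h4'
    rw [← sq] at h2
    apply hn
    simpa using dvd_add key' h2
  · have hcop : IsCoprime ((p : ℤ) ^ 2) (6912 * r ^ 8) :=
      ((Prime.coprime_iff_not_dvd hpi).mpr hc).pow_left
    exact hcop.dvd_of_dvd_mul_left hd
end
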